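/- Let G be a finitely generated linear group (i.e. a group admitting an injective homomorphism into GL_n(F) for some n and some field F) and let μ be a courteous probability measure on G. If there exists k ≥ 1 such that dim HF_k(G,μ) < ∞, then G is virtually nilpotent. -/

import Mathlib

open scoped ENNReal

/-- The word length of `x` with respect to a generating set `S`:
the least `n` such that `x` is a product of `n` elements of `S`. -/
noncomputable def wordLen {G : Type*} [Group G] (S : Set G) (x : G) : ℕ :=
  sInf {n : ℕ | ∃ l : List G, (∀ s ∈ l, s ∈ S) ∧ l.length = n ∧ l.prod = x}

/-- `f : G → ℂ` is `μ`-harmonic: `f x = ∑ₛ μ(s) f(x s⁻¹)`. -/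
def IsHarmonic {G : Type*} [Group G] (μ : G → ℝ) (f : G → ℂ) : Prop :=
  ∀ x : G, f x = ∑' s : G, (μ s : ℂ) * f (x * s⁻¹)

/-- The polynomial-`k`-seminorm `‖f‖ₖ = limsup_{r → ∞} r^{-k} · max_{|x| ≤ r} |f(x)|`,
valued in `ℝ≥0∞`. -/
noncomputable def polyNorm {G : Type*} [Group G] (S : Set G) (k : ℕ) (f : G → ℂ) : ℝ≥0∞ :=
  Filter.limsup
    (fun r : ℕ => ((r : ℝ≥0∞) ^ k)⁻¹ * ⨆ (x : G) (_ : wordLen S x ≤ r), (‖f x‖₊ : ℝ≥0∞))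
    Filter.atTop

/-- `HFk S μ k` : the set of `μ`-harmonic functions of polynomial growth of degree at most `k`. -/
noncomputable def HFk {G : Type*} [Group G] (S : Set G) (μ : G → ℝ) (k : ℕ) : Set (G → ℂ) :=
  {f | IsHarmonic μ f ∧ polyNorm S k f < ⊤}

/-- A length function on a group. -/
structure IsLen {G : Type*} [Group G] (ℓ : G → ℝ) : Prop where
  nonneg : ∀ x, 0 ≤ ℓ x
  one : ℓ 1 = 0
  mul_le : ∀ x y, ℓ (x * y) ≤ ℓ x + ℓ y
  inv : ∀ x, ℓ x⁻¹ = ℓ x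

/-- A symmetric probability measure of full support with an exponential moment. -/
structure Nice {G : Type*} [Group G] (ℓ : G → ℝ) (μ : G → ℝ) (ζ : ℝ) : Prop where
  len : IsLen ℓ
  pos_exp : 0 < ζ
  pos : ∀ x, 0 < μ x
  hasSum : HasSum μ 1
  symm : ∀ x, μ x⁻¹ = μ x
  summable : Summable fun x => μ x * Real.exp (ζ * ℓ x)

/-- Harmonicity, including convergence of the defining series. -/
def Harm {G : Type*} [Group G] (μ : G → ℝ) (f : G → ℂ) : Prop :=
  ∀ x, HasSum (fun s => (μ s : ℂ) * f (x * s⁻¹)) (f x)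

/-- Harmonic functions of linear growth lie in a finite-dimensional space. -/
def FD {G : Type*} [Group G] (ℓ : G → ℝ) (μ : G → ℝ) : Prop :=
  ∃ W : Submodule ℂ (G → ℂ), FiniteDimensional ℂ W ∧
    ∀ (f : G → ℂ) (C : ℝ), (∀ x, ‖f x‖ ≤ C * (1 + ℓ x)) → Harm μ f → f ∈ W

/-- A left-invariant finitely additive probability measure on all subsets. -/
structure InvMean (G : Type*) [Group G] where
  m : Set G → ℝ
  nonneg : ∀ A, 0 ≤ m A
  univ : m Set.univ = 1
  union : ∀ A B, Disjoint A B → m (A ∪ B) = m A + m B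
  inv : ∀ (g : G) (A : Set G), m ((fun x => g * x) ⁻¹' A) = m A

section Conv

variable {G : Type*} [Group G]

/-- Convolution of nonnegative functions. -/
noncomputable def conv (a b : G → ℝ≥0∞) (x : G) : ℝ≥0∞ := ∑' y, a (x * y⁻¹) * b y

theorem conv_assoc (a b c : G → ℝ≥0∞) : conv (conv a b) c = conv a (conv b c) := by
  funext x
  simp only [conv, ← ENNReal.tsum_mul_left, ← ENNReal.tsum_mul_right]
  rw [ENNReal.tsum_comm (f := fun u y => a (x * u⁻¹) * (b (u * y⁻¹) * c y))]
  refine tsum_congr fun y => ?_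
  symm
  refine ((Equiv.mulRight y).tsum_eq _).symm.trans (tsum_congr fun z => ?_)
  simp [mul_assoc]

theorem conv_inv (a b : G → ℝ≥0∞) (x : G) :
    conv a b x⁻¹ = conv (fun y => b y⁻¹) (fun y => a y⁻¹) x := by
  unfold conv
  refine ((Equiv.mulRight x⁻¹).tsum_eq _).symm.trans (tsum_congr fun z => ?_)
  simp [mul_comm]

theorem tsum_conv_mul_le (a b w : G → ℝ≥0∞) (hw : ∀ x y, w (x * y) ≤ w x * w y) :
    ∑' x, conv a b x * w x ≤ (∑' x, a x * w x) * ∑' x, b x * w x := by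
  simp only [conv, ← ENNReal.tsum_mul_right, ← ENNReal.tsum_mul_left]
  rw [ENNReal.tsum_comm]
  refine ENNReal.tsum_le_tsum fun y => ?_
  rw [← (Equiv.mulRight y).tsum_eq]
  refine ENNReal.tsum_le_tsum fun z => ?_
  simp only [Equiv.coe_mulRight, mul_inv_cancel_right]
  calc a z * b y * w (z * y) ≤ a z * b y * (w z * w y) := by gcongr; exact hw _ _
    _ = _ := by ring

theorem tsum_conv (a b : G → ℝ≥0∞) : ∑' x, conv a b x = (∑' x, a x) * ∑' x, b x := by
  simp only [conv, ← ENNReal.tsum_mul_right, ← ENNReal.tsum_mul_left]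
  rw [ENNReal.tsum_comm]
  refine tsum_congr fun y => ?_
  rw [← (Equiv.mulRight y).tsum_eq]
  refine tsum_congr fun z => ?_
  simp

open Classical in
/-- Convolution powers. -/
noncomputable def convPow (m : G → ℝ≥0∞) : ℕ → G → ℝ≥0∞
  | 0 => fun x => if x = 1 then 1 else 0
  | n + 1 => conv (convPow m n) m

open Classical in
theorem conv_one (a : G → ℝ≥0∞) : conv a (fun x => if x = 1 then 1 else 0) = a := by
  funext x
  unfold conv
  rw [tsum_eq_single 1 (by intro b hb; simp [hb])]
  simp

open Classical in
theorem one_conv (a : G → ℝ≥0∞) : conv (fun x => if x = 1 then 1 else 0) a = a := by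
  funext x
  unfold conv
  rw [tsum_eq_single x (by
    intro b hb; beta_reduce; rw [if_neg, zero_mul]; rwa [mul_inv_eq_one, eq_comm])]
  simp

theorem convPow_succ' (m : G → ℝ≥0∞) (n : ℕ) : convPow m (n + 1) = conv m (convPow m n) := by
  induction n with
  | zero => simp only [convPow]; rw [conv_one, one_conv]
  | succ n ih =>
    rw [convPow, ih, conv_assoc, ← ih]
    rfl

theorem convPow_inv (m : G → ℝ≥0∞) (hm : ∀ x, m x⁻¹ = m x) (n : ℕ) (x : G) :
    convPow m n x⁻¹ = convPow m n x := by
  induction n generalizing x with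
  | zero => by_cases h : x = 1 <;> simp [convPow, h]
  | succ n ih =>
    rw [convPow, conv_inv]
    simp only [hm, ih]
    exact (congrFun (convPow_succ' m n) x).symm

theorem tsum_convPow (m : G → ℝ≥0∞) (hm : ∑' x, m x = 1) (n : ℕ) : ∑' x, convPow m n x = 1 := by
  classical
  induction n with
  | zero => simp [convPow]
  | succ n ih => rw [convPow, tsum_conv, ih, hm, one_mul]

theorem tsum_convPow_mul_le (m w : G → ℝ≥0∞) (hw1 : w 1 = 1) (hw : ∀ x y, w (x * y) ≤ w x * w y)
    (n : ℕ) : ∑' x, convPow m n x * w x ≤ (∑' x, m x * w x) ^ n := by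
  classical
  induction n with
  | zero =>
    rw [tsum_eq_single 1 (by intro b hb; simp [convPow, hb])]
    simp [convPow, hw1]
  | succ n ih =>
    rw [convPow, pow_succ]
    exact (tsum_conv_mul_le _ _ _ hw).trans (mul_le_mul_left ih _)

theorem exists_convPow_ne_zero (m : G → ℝ≥0∞) (hm : ∀ x, m x⁻¹ = m x)
    (hgen : Subgroup.closure {x | m x ≠ 0} = ⊤) (x : G) : ∃ n, convPow m n x ≠ 0 := by
  have hstep : ∀ x y n, convPow m n x ≠ 0 → m y ≠ 0 → convPow m (n + 1) (x * y) ≠ 0 := by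
    intro x y n hx hy h0
    rw [convPow, conv, ENNReal.tsum_eq_zero] at h0
    have := h0 y
    simp [hx, hy] at this
  have hx : x ∈ Subgroup.closure {x | m x ≠ 0} := hgen ▸ Subgroup.mem_top x
  induction hx using Subgroup.closure_induction_right with
  | one => exact ⟨0, by simp [convPow]⟩
  | mul_right x _ y hy ih => obtain ⟨n, hn⟩ := ih; exact ⟨n + 1, hstep _ _ _ hn hy⟩
  | mul_inv_cancel x _ y hy ih =>
    obtain ⟨n, hn⟩ := ih; exact ⟨n + 1, hstep _ _ _ hn (by rw [hm]; exact hy)⟩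

/-- The geometric mixture of convolution powers. -/
noncomputable def geomConv (m : G → ℝ≥0∞) (x : G) : ℝ≥0∞ :=
  ∑' n : ℕ, (2⁻¹ : ℝ≥0∞) ^ (n + 1) * convPow m n x

open Classical in
theorem geomConv_eq (m : G → ℝ≥0∞) (x : G) :
    geomConv m x = 2⁻¹ * (if x = 1 then 1 else 0) + 2⁻¹ * conv (geomConv m) m x := by
  rw [geomConv, tsum_eq_zero_add' ENNReal.summable]
  congr 1
  · simp [convPow]
  · simp only [conv, geomConv, ← ENNReal.tsum_mul_right, ← ENNReal.tsum_mul_left, convPow]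
    rw [ENNReal.tsum_comm]
    refine tsum_congr fun y => tsum_congr fun n => ?_
    ring

theorem tsum_geomConv (m : G → ℝ≥0∞) (hm : ∑' x, m x = 1) : ∑' x, geomConv m x = 1 := by
  simp only [geomConv]
  rw [ENNReal.tsum_comm]
  simp only [ENNReal.tsum_mul_left, tsum_convPow m hm, mul_one]
  rw [ENNReal.tsum_geometric_add_one, ENNReal.one_sub_inv_two, inv_inv]
  exact ENNReal.inv_mul_cancel (by simp) (by simp)

theorem tsum_geomConv_mul_lt (m w : G → ℝ≥0∞) (hw1 : w 1 = 1)
    (hw : ∀ x y, w (x * y) ≤ w x * w y) (h2 : ∑' x, m x * w x < 2) :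
    ∑' x, geomConv m x * w x < ⊤ := by
  simp only [geomConv, ← ENNReal.tsum_mul_right]
  rw [ENNReal.tsum_comm]
  simp only [mul_assoc, ENNReal.tsum_mul_left]
  set E := ∑' x, m x * w x
  calc ∑' n : ℕ, (2⁻¹ : ℝ≥0∞) ^ (n + 1) * ∑' x, convPow m n x * w x
      ≤ ∑' n : ℕ, 2⁻¹ * (2⁻¹ * E) ^ n := by
        refine ENNReal.tsum_le_tsum fun n => ?_
        rw [pow_succ, mul_pow, mul_comm (_ ^ n) _, mul_assoc]
        gcongr
        exact tsum_convPow_mul_le m w hw1 hw n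
    _ = 2⁻¹ * (1 - 2⁻¹ * E)⁻¹ := by rw [ENNReal.tsum_mul_left, ENNReal.tsum_geometric]
    _ < ⊤ := by
      refine ENNReal.mul_lt_top (by simp) ?_
      rw [ENNReal.inv_lt_top, tsub_pos_iff_lt]
      calc 2⁻¹ * E < 2⁻¹ * 2 := by
            rw [mul_comm, mul_comm _ (2 : ℝ≥0∞)]
            exact ENNReal.mul_lt_mul_left (by simp) (by simp) h2
        _ = 1 := ENNReal.inv_mul_cancel (by simp) (by simp)

end Conv

section FullSupport

variable {G : Type*} [Group G]

theorem IsLen.one_add_mul_le {ℓ : G → ℝ} (hℓ : IsLen ℓ) (x y : G) :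
    1 + ℓ (x * y) ≤ (1 + ℓ x) * (1 + ℓ y) := by
  nlinarith [hℓ.mul_le x y, hℓ.nonneg x, hℓ.nonneg y, mul_nonneg (hℓ.nonneg x) (hℓ.nonneg y)]

theorem exists_exp_moment_lt_two {X : Type*} {ℓ μ : X → ℝ} (h0 : ∀ x, 0 ≤ μ x)
    (h1 : HasSum μ 1) {ζ : ℝ} (hζ : 0 < ζ) (hs : Summable fun x => μ x * Real.exp (ζ * ℓ x)) :
    ∃ ζ' > 0, ζ' ≤ ζ ∧ (Summable fun x => μ x * Real.exp (ζ' * ℓ x)) ∧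
      ∑' x, μ x * Real.exp (ζ' * ℓ x) < 2 := by
  set M := ∑' x, μ x * Real.exp (ζ * ℓ x) with hM
  have hM0 : 0 ≤ M := tsum_nonneg fun s => mul_nonneg (h0 s) (Real.exp_pos _).le
  set t := 1 / (M + 1) with ht
  have ht0 : 0 < t := by positivity
  have ht1 : t ≤ 1 := by rw [ht, div_le_one (by positivity)]; linarith
  have hc : ∀ x, Real.exp (t * ζ * ℓ x) ≤ (1 - t) + t * Real.exp (ζ * ℓ x) := by
    intro x
    have := convexOn_exp.2 (Set.mem_univ 0) (Set.mem_univ (ζ * ℓ x)) (sub_nonneg.2 ht1) ht0.le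
      (by ring)
    simpa [mul_assoc] using this
  have hsum : HasSum (fun x => μ x * ((1 - t) + t * Real.exp (ζ * ℓ x))) ((1 - t) + t * M) := by
    have := (h1.mul_right (1 - t)).add (hs.hasSum.mul_left t)
    rw [one_mul] at this
    refine this.congr_fun fun x => ?_
    ring
  have hle : ∀ x, μ x * Real.exp (t * ζ * ℓ x) ≤ μ x * ((1 - t) + t * Real.exp (ζ * ℓ x)) :=
    fun x => mul_le_mul_of_nonneg_left (hc x) (h0 x)
  have hsm : Summable fun x => μ x * Real.exp (t * ζ * ℓ x) :=
    Summable.of_nonneg_of_le (fun x => mul_nonneg (h0 x) (Real.exp_pos _).le) hle hsum.summable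
  refine ⟨t * ζ, by positivity, by nlinarith, hsm, ?_⟩
  refine (hasSum_le hle hsm.hasSum hsum).trans_lt ?_
  have : t * M < 1 := by rw [ht, one_div, inv_mul_eq_div, div_lt_one (by positivity)]; linarith
  linarith

theorem summable_linear_of_exp {ℓ μ : G → ℝ} (hℓ : IsLen ℓ) (h0 : ∀ x, 0 ≤ μ x)
    {ζ : ℝ} (hζ : 0 < ζ) (hs : Summable fun x => μ x * Real.exp (ζ * ℓ x)) :
    Summable fun x => μ x * (1 + ℓ x) := by
  refine Summable.of_nonneg_of_le
    (fun x => mul_nonneg (h0 x) (by linarith [hℓ.nonneg x])) (fun x => ?_) (hs.mul_left (1 + 1 / ζ))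
  have h1 := Real.add_one_le_exp (ζ * ℓ x)
  have h2 : 1 ≤ Real.exp (ζ * ℓ x) := Real.one_le_exp (mul_nonneg hζ.le (hℓ.nonneg x))
  have h3 : ℓ x ≤ 1 / ζ * Real.exp (ζ * ℓ x) := by
    calc ℓ x = 1 / ζ * (ζ * ℓ x) := by field_simp
      _ ≤ _ := mul_le_mul_of_nonneg_left (by linarith) (by positivity)
  have h4 : 1 + ℓ x ≤ (1 + 1 / ζ) * Real.exp (ζ * ℓ x) := by nlinarith
  nlinarith [mul_le_mul_of_nonneg_left h4 (h0 x)]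

theorem Harm.of_geometric {ℓ μ ν : G → ℝ} {ζ : ℝ} (hν : Nice ℓ ν ζ) (h0 : ∀ x, 0 ≤ μ x)
    (hs : Summable fun x => μ x * (1 + ℓ x))
    (hνμ : ∀ (s : G) [Decidable (s = 1)],
      HasSum (fun y => ν (s * y⁻¹) * μ y) (2 * ν s - if s = 1 then 1 else 0))
    {f : G → ℂ} {C : ℝ} (hC : ∀ x, ‖f x‖ ≤ C * (1 + ℓ x)) (hf : Harm ν f) : Harm μ f := by
  classical
  intro x
  have hℓ := hν.len
  have hC0 : 0 ≤ C := by
    have := (norm_nonneg _).trans (hC 1)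
    rw [hℓ.one] at this; linarith
  have hνs := summable_linear_of_exp hℓ (fun x => (hν.pos x).le) hν.pos_exp hν.summable
  have hone : ∀ x, 0 ≤ 1 + ℓ x := fun x => by linarith [hℓ.nonneg x]
  have hprod : Summable fun p : G × G =>
      (μ p.1 : ℂ) * ((ν p.2 : ℂ) * f (x * p.1⁻¹ * p.2⁻¹)) := by
    have h1 := (hs.mul_of_nonneg hνs (fun y => mul_nonneg (h0 y) (hone y))
      (fun y => mul_nonneg (hν.pos y).le (hone y))).mul_left (C * (1 + ℓ x))
    refine Summable.of_norm_bounded h1 fun p => ?_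
    rw [norm_mul, norm_mul, Complex.norm_real, Complex.norm_real, Real.norm_of_nonneg (h0 _),
      Real.norm_of_nonneg (hν.pos _).le]
    have h2 : ‖f (x * p.1⁻¹ * p.2⁻¹)‖ ≤ C * ((1 + ℓ x) * (1 + ℓ p.1) * (1 + ℓ p.2)) := by
      refine (hC _).trans (mul_le_mul_of_nonneg_left ?_ hC0)
      calc 1 + ℓ (x * p.1⁻¹ * p.2⁻¹) ≤ (1 + ℓ (x * p.1⁻¹)) * (1 + ℓ p.2⁻¹) := hℓ.one_add_mul_le _ _
        _ ≤ (1 + ℓ x) * (1 + ℓ p.1⁻¹) * (1 + ℓ p.2⁻¹) :=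
          mul_le_mul_of_nonneg_right (hℓ.one_add_mul_le _ _) (hone _)
        _ = _ := by rw [hℓ.inv, hℓ.inv]
    have h3 := mul_le_mul_of_nonneg_left h2 (mul_nonneg (h0 p.1) (hν.pos p.2).le)
    nlinarith
  obtain ⟨A, hA⟩ := hprod
  have hA1 : HasSum (fun y => (μ y : ℂ) * f (x * y⁻¹)) A :=
    hA.prod_fiberwise fun y => (hf (x * y⁻¹)).mul_left (μ y : ℂ)
  let e : G × G ≃ G × G :=
    { toFun := fun p => (p.2, p.1 * p.2⁻¹)
      invFun := fun p => (p.2 * p.1, p.1)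
      left_inv := fun p => by simp
      right_inv := fun p => by simp }
  have hA2 := (e.hasSum_iff.2 hA).prod_fiberwise
    (g := fun s => ((2 * ν s - if s = 1 then 1 else 0 : ℝ) : ℂ) * f (x * s⁻¹)) fun s => by
      refine ((Complex.hasSum_ofReal.2 (hνμ s)).mul_right (f (x * s⁻¹))).congr_fun fun y => ?_
      simp only [e, Function.comp, Equiv.coe_fn_mk]
      push_cast
      rw [show x * y⁻¹ * (s * y⁻¹)⁻¹ = x * s⁻¹ by group]
      ring
  have hA3 : HasSum (fun s => ((2 * ν s - if s = 1 then 1 else 0 : ℝ) : ℂ) * f (x * s⁻¹))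
      (2 * f x - f x) := by
    have h1 : HasSum (fun s : G => if s = 1 then f x else 0) (f x) := by
      convert hasSum_ite_eq (1 : G) (f x) using 1
    refine (((hf x).mul_left 2).sub h1).congr_fun fun s => ?_
    split_ifs with h
    · subst h; push_cast; simp; ring
    · push_cast; ring
  have := hA2.unique hA3
  rw [this] at hA1
  convert hA1 using 1
  ring

/-- Passing to a measure of full support. -/
theorem exists_nice {ℓ μ : G → ℝ} (hℓ : IsLen ℓ) (h0 : ∀ x, 0 ≤ μ x)
    (h1 : HasSum μ 1) (hsym : ∀ x, μ x⁻¹ = μ x) (hgen : Subgroup.closure {x | μ x ≠ 0} = ⊤)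
    {ζ : ℝ} (hζ : 0 < ζ) (hs : Summable fun x => μ x * Real.exp (ζ * ℓ x)) :
    ∃ (ν : G → ℝ) (ζ' : ℝ), Nice ℓ ν ζ' ∧ ∀ (f : G → ℂ) (C : ℝ), (∀ x, ‖f x‖ ≤ C * (1 + ℓ x)) →
      Harm ν f → Harm μ f := by
  classical
  obtain ⟨ζ', hζ', -, hs', hlt⟩ := exists_exp_moment_lt_two h0 h1 hζ hs
  set m : G → ℝ≥0∞ := fun x => ENNReal.ofReal (μ x) with hm
  set w : G → ℝ≥0∞ := fun x => ENNReal.ofReal (Real.exp (ζ' * ℓ x)) with hw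
  have hm1 : ∑' x, m x = 1 := by
    rw [← ENNReal.ofReal_tsum_of_nonneg h0 h1.summable, h1.tsum_eq, ENNReal.ofReal_one]
  have hw1 : w 1 = 1 := by simp [hw, hℓ.one]
  have hwm : ∀ x y, w (x * y) ≤ w x * w y := by
    intro x y
    simp only [hw]
    rw [← ENNReal.ofReal_mul (Real.exp_pos _).le, ← Real.exp_add]
    refine ENNReal.ofReal_le_ofReal (Real.exp_le_exp.2 ?_)
    nlinarith [hℓ.mul_le x y]
  have hE : ∑' x, m x * w x < 2 := by
    have : ∀ x, m x * w x = ENNReal.ofReal (μ x * Real.exp (ζ' * ℓ x)) := fun x =>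
      (ENNReal.ofReal_mul (h0 x)).symm
    simp only [this]
    rw [← ENNReal.ofReal_tsum_of_nonneg (fun x => mul_nonneg (h0 x) (Real.exp_pos _).le) hs']
    rw [← ENNReal.ofReal_ofNat 2]
    exact (ENNReal.ofReal_lt_ofReal_iff (by norm_num)).2 hlt
  have hN1 := tsum_geomConv m hm1
  have hNtop : ∀ x, geomConv m x ≠ ⊤ := fun x =>
    ne_top_of_le_ne_top ENNReal.one_ne_top (hN1 ▸ ENNReal.le_tsum x)
  have hmtop : ∀ x, m x ≠ ⊤ := fun x => ENNReal.ofReal_ne_top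
  have hminv : ∀ x, m x⁻¹ = m x := fun x => by simp only [hm, hsym]
  have hν : Nice ℓ (fun x => (geomConv m x).toReal) ζ' := by
    refine ⟨hℓ, hζ', fun x => ?_, ?_, fun x => ?_, ?_⟩
    · refine ENNReal.toReal_pos (fun hz => ?_) (hNtop x)
      obtain ⟨n, hn⟩ := exists_convPow_ne_zero m hminv
        (by convert hgen using 4 with x; simp only [hm, ne_eq, ENNReal.ofReal_eq_zero, not_le]
            exact ⟨ne_of_gt, fun h => lt_of_le_of_ne (h0 x) (Ne.symm h)⟩) x
      rw [geomConv, ENNReal.tsum_eq_zero] at hz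
      have := hz n
      simp [hn] at this
    · have := ENNReal.hasSum_toReal (f := geomConv m) (by rw [hN1]; exact ENNReal.one_ne_top)
      rwa [← ENNReal.tsum_toReal_eq hNtop, hN1, ENNReal.toReal_one] at this
    · simp only [geomConv, convPow_inv m hminv]
    · have := ENNReal.summable_toReal (tsum_geomConv_mul_lt m w hw1 hwm hE).ne
      refine this.congr fun x => ?_
      rw [ENNReal.toReal_mul, ENNReal.toReal_ofReal (Real.exp_pos _).le]
  refine ⟨_, ζ', hν, fun f C hC hf => Harm.of_geometric hν h0
    (summable_linear_of_exp hℓ h0 hζ hs) (fun s _ => ?_) hC hf⟩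
  have h2 := geomConv_eq m s
  have h3 : conv (geomConv m) m s ≠ ⊤ := by
    intro h; rw [h] at h2
    apply hNtop s; rw [h2]; simp
  have h4 : HasSum (fun y => (geomConv m (s * y⁻¹)).toReal * μ y) (conv (geomConv m) m s).toReal := by
    have := ENNReal.hasSum_toReal (f := fun y => geomConv m (s * y⁻¹) * m y) h3
    rw [← ENNReal.tsum_toReal_eq (fun y => ENNReal.mul_ne_top (hNtop _) (hmtop _))] at this
    refine this.congr_fun fun y => ?_
    rw [ENNReal.toReal_mul, ENNReal.toReal_ofReal (h0 y)]
  convert h4 using 1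
  have h5 := congrArg ENNReal.toReal h2
  rw [ENNReal.toReal_add (by split_ifs <;> simp)
    (ENNReal.mul_ne_top (by simp) h3), ENNReal.toReal_mul, ENNReal.toReal_mul] at h5
  rw [h5]
  split_ifs
  · simp; ring
  · simp

end FullSupport

section WordLength

variable {G : Type*} [Group G] {S : Set G}

theorem exists_word (hgen : Subgroup.closure S = ⊤) (hsym : ∀ s ∈ S, s⁻¹ ∈ S) (x : G) :
    ∃ l : List G, (∀ s ∈ l, s ∈ S) ∧ l.length = wordLen S x ∧ l.prod = x := by
  have hne : {n : ℕ | ∃ l : List G, (∀ s ∈ l, s ∈ S) ∧ l.length = n ∧ l.prod = x}.Nonempty := by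
    have hx : x ∈ Subgroup.closure S := hgen ▸ Subgroup.mem_top x
    have hx' : x ∈ (Subgroup.closure S).toSubmonoid := hx
    rw [Subgroup.closure_toSubmonoid] at hx'
    obtain ⟨l, hl, hp⟩ := Submonoid.exists_list_of_mem_closure hx'
    refine ⟨l.length, l, fun s hs => ?_, rfl, hp⟩
    rcases hl s hs with h | h
    · exact h
    · simpa using hsym _ h
  exact Nat.sInf_mem hne

theorem wordLen_le {l : List G} (hl : ∀ s ∈ l, s ∈ S) : wordLen S l.prod ≤ l.length :=
  Nat.sInf_le ⟨l, hl, rfl, rfl⟩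

theorem isLen_wordLen (hgen : Subgroup.closure S = ⊤) (hsym : ∀ s ∈ S, s⁻¹ ∈ S) :
    IsLen fun x => (wordLen S x : ℝ) := by
  have hinv : ∀ x, wordLen S x⁻¹ ≤ wordLen S x := by
    intro x
    obtain ⟨l, hl, hn, rfl⟩ := exists_word hgen hsym x
    rw [← hn, List.prod_inv_reverse]
    refine (wordLen_le fun s hs => ?_).trans (by simp)
    simp only [List.mem_reverse, List.mem_map] at hs
    obtain ⟨t, ht, rfl⟩ := hs
    exact hsym _ (hl t ht)
  refine ⟨fun x => by positivity, ?_, fun x y => ?_, fun x => ?_⟩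
  · have := wordLen_le (S := S) (l := []) (by simp)
    simpa using this
  · obtain ⟨l, hl, hn, rfl⟩ := exists_word hgen hsym x
    obtain ⟨l', hl', hn', rfl⟩ := exists_word hgen hsym y
    rw [← hn, ← hn', ← List.prod_append]
    have := wordLen_le (S := S) (l := l ++ l') (by
      intro s hs; rcases List.mem_append.1 hs with h | h; exacts [hl s h, hl' s h])
    rw [List.length_append] at this
    exact_mod_cast this
  · have h1 := hinv x
    have h2 := hinv x⁻¹
    rw [inv_inv] at h2
    exact_mod_cast le_antisymm h1 h2

theorem polyNorm_lt_top {k : ℕ} (hk : 1 ≤ k) {f : G → ℂ} {C : ℝ}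
    (hf : ∀ x, ‖f x‖ ≤ C * (1 + wordLen S x)) : polyNorm S k f < ⊤ := by
  have hC : ∀ᶠ r : ℕ in Filter.atTop, ((r : ℝ≥0∞) ^ k)⁻¹ *
      ⨆ (x : G) (_ : wordLen S x ≤ r), (‖f x‖₊ : ℝ≥0∞) ≤ ENNReal.ofReal (2 * |C|) := by
    filter_upwards [Filter.eventually_ge_atTop 1] with r hr
    have hr0 : (r : ℝ≥0∞) ≠ 0 := by exact_mod_cast (by omega)
    have hrk : ((r : ℝ≥0∞) ^ k)⁻¹ ≤ (r : ℝ≥0∞)⁻¹ := by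
      rw [ENNReal.inv_le_inv]
      calc (r : ℝ≥0∞) = (r : ℝ≥0∞) ^ 1 := (pow_one _).symm
        _ ≤ _ := pow_le_pow_right₀ (by exact_mod_cast hr) hk
    have hsup : ⨆ (x : G) (_ : wordLen S x ≤ r), (‖f x‖₊ : ℝ≥0∞) ≤
        r * ENNReal.ofReal (2 * |C|) := by
      refine iSup₂_le fun x hx => ?_
      rw [← ENNReal.ofReal_natCast, ← ENNReal.ofReal_mul (by positivity), ← enorm_eq_nnnorm,
        ← ofReal_norm]
      refine ENNReal.ofReal_le_ofReal ((hf x).trans ?_)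
      have h1 : (wordLen S x : ℝ) ≤ r := by exact_mod_cast hx
      have h2 : (1 : ℝ) ≤ r := by exact_mod_cast hr
      have h3 : (0 : ℝ) ≤ wordLen S x := by positivity
      nlinarith [le_abs_self C, abs_nonneg C]
    calc _ ≤ (r : ℝ≥0∞)⁻¹ * (r * ENNReal.ofReal (2 * |C|)) := mul_le_mul' hrk hsup
      _ = ENNReal.ofReal (2 * |C|) := by
        rw [← mul_assoc, ENNReal.inv_mul_cancel hr0 (ENNReal.natCast_ne_top r), one_mul]
  exact (Filter.limsup_le_of_le (by isBoundedDefault) hC).trans_lt ENNReal.ofReal_lt_top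

theorem fd_of_HFk {μ : G → ℝ} {k : ℕ} (hk : 1 ≤ k)
    (hfin : ∃ W : Submodule ℂ (G → ℂ), FiniteDimensional ℂ W ∧ HFk S μ k ⊆ (W : Set (G → ℂ))) :
    FD (fun x => (wordLen S x : ℝ)) μ := by
  obtain ⟨W, hW, hsub⟩ := hfin
  exact ⟨W, hW, fun f C hf hh => hsub ⟨fun x => (hh x).tsum_eq.symm, polyNorm_lt_top hk hf⟩⟩

theorem exists_nice_fd (hgen : Subgroup.closure S = ⊤) (hsym : ∀ s ∈ S, s⁻¹ ∈ S)
    {μ : G → ℝ} (h0 : ∀ x, 0 ≤ μ x) (h1 : HasSum μ 1) (hμ : ∀ x, μ x⁻¹ = μ x)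
    (hadapted : Subgroup.closure {x | μ x ≠ 0} = ⊤)
    (hsmooth : ∃ ζ : ℝ, 0 < ζ ∧ Summable fun x => μ x * Real.exp (ζ * wordLen S x))
    {k : ℕ} (hk : 1 ≤ k)
    (hfin : ∃ W : Submodule ℂ (G → ℂ), FiniteDimensional ℂ W ∧ HFk S μ k ⊆ (W : Set (G → ℂ))) :
    ∃ (ν : G → ℝ) (ζ : ℝ), Nice (fun x => (wordLen S x : ℝ)) ν ζ ∧
      FD (fun x => (wordLen S x : ℝ)) ν := by
  obtain ⟨ζ, hζ, hs⟩ := hsmooth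
  obtain ⟨ν, ζ', hν, H⟩ := exists_nice (isLen_wordLen hgen hsym) h0 h1 hμ hadapted hζ hs
  obtain ⟨W, hW, hsub⟩ := fd_of_HFk hk hfin
  exact ⟨ν, ζ', hν, W, hW, fun f C hf hh => hsub f C hf (H f C hf hh)⟩

end WordLength

/-- The averaging operator. -/
noncomputable def avg {G : Type*} [Group G] (μ : G → ℝ) (u : G → ℂ) (x : G) : ℂ :=
  ∑' s, (μ s : ℂ) * u (x * s⁻¹)

/-- The averaging operator on real functions. -/
noncomputable def avgR {G : Type*} [Group G] (μ : G → ℝ) (u : G → ℝ) (x : G) : ℝ :=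
  ∑' s, μ s * u (x * s⁻¹)

section AvgBasics

variable {G : Type*} [Group G] {ℓ μ : G → ℝ} {ζ : ℝ}

theorem Nice.summable_of_le (hμ : Nice ℓ μ ζ) {K : ℝ} {D : G → ℂ}
    (hD : ∀ s, ‖D s‖ ≤ K * Real.exp (ζ * ℓ s)) : Summable fun s => (μ s : ℂ) * D s := by
  refine Summable.of_norm_bounded (hμ.summable.mul_left K) fun s => ?_
  rw [norm_mul, Complex.norm_real, Real.norm_of_nonneg (hμ.pos s).le]
  nlinarith [hD s, hμ.pos s, mul_le_mul_of_nonneg_left (hD s) (hμ.pos s).le]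

theorem Nice.norm_tsum_le (hμ : Nice ℓ μ ζ) {K : ℝ} {D : G → ℂ}
    (hD : ∀ s, ‖D s‖ ≤ K * Real.exp (ζ * ℓ s)) :
    ‖∑' s, (μ s : ℂ) * D s‖ ≤ K * ∑' s, μ s * Real.exp (ζ * ℓ s) := by
  rw [← tsum_mul_left]
  refine tsum_of_norm_bounded (hμ.summable.mul_left K).hasSum fun s => ?_
  rw [norm_mul, Complex.norm_real, Real.norm_of_nonneg (hμ.pos s).le]
  nlinarith [hD s, hμ.pos s, mul_le_mul_of_nonneg_left (hD s) (hμ.pos s).le]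

theorem Nice.summableR_of_le (hμ : Nice ℓ μ ζ) {K : ℝ} {D : G → ℝ}
    (hD : ∀ s, |D s| ≤ K * Real.exp (ζ * ℓ s)) : Summable fun s => μ s * D s := by
  refine Summable.of_norm_bounded (hμ.summable.mul_left K) fun s => ?_
  rw [norm_mul, Real.norm_of_nonneg (hμ.pos s).le, Real.norm_eq_abs]
  nlinarith [hD s, hμ.pos s, mul_le_mul_of_nonneg_left (hD s) (hμ.pos s).le]

theorem Nice.one_le_exp (hμ : Nice ℓ μ ζ) (s : G) : 1 ≤ Real.exp (ζ * ℓ s) :=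
  Real.one_le_exp (mul_nonneg hμ.pos_exp.le (hμ.len.nonneg s))

theorem Nice.summable_bdd (hμ : Nice ℓ μ ζ) {K : ℝ} {u : G → ℂ} (hu : ∀ x, ‖u x‖ ≤ K) (x : G) :
    Summable fun s => (μ s : ℂ) * u (x * s⁻¹) := by
  refine hμ.summable_of_le (K := K) fun s => (hu _).trans ?_
  have := hμ.one_le_exp s
  have h0 : 0 ≤ K := (norm_nonneg _).trans (hu 1)
  nlinarith

theorem Nice.summableR_bdd (hμ : Nice ℓ μ ζ) {K : ℝ} {u : G → ℝ} (hu : ∀ x, |u x| ≤ K) (x : G) :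
    Summable fun s => μ s * u (x * s⁻¹) := by
  refine hμ.summableR_of_le (K := K) fun s => (hu _).trans ?_
  have := hμ.one_le_exp s
  have h0 : 0 ≤ K := (abs_nonneg _).trans (hu 1)
  nlinarith

theorem Nice.avgR_le_of_le (hμ : Nice ℓ μ ζ) {K : ℝ} {u : G → ℝ} (hu0 : ∀ x, |u x| ≤ K)
    {B : ℝ} (hu : ∀ x, u x ≤ B) (x : G) : avgR μ u x ≤ B := by
  have h1 : HasSum (fun s => μ s * B) B := by simpa using hμ.hasSum.mul_right B
  exact hasSum_le (fun s => mul_le_mul_of_nonneg_left (hu _) (hμ.pos s).le)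
    (hμ.summableR_bdd hu0 x).hasSum h1

theorem Nice.norm_avg_le (hμ : Nice ℓ μ ζ) {K : ℝ} {u : G → ℂ} (hu : ∀ x, ‖u x‖ ≤ K) (x : G) :
    ‖avg μ u x‖ ≤ K := by
  have h1 : HasSum (fun s => μ s * K) K := by simpa using hμ.hasSum.mul_right K
  refine tsum_of_norm_bounded h1 fun s => ?_
  rw [norm_mul, Complex.norm_real, Real.norm_of_nonneg (hμ.pos s).le]
  exact mul_le_mul_of_nonneg_left (hu _) (hμ.pos s).le

end AvgBasics

section Barrier

variable {G : Type*} [Group G] {ℓ μ : G → ℝ} {ζ : ℝ}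

theorem exists_growth_one_sided (hμ : Nice ℓ μ ζ) {h : G → ℝ} {C c r : ℝ} (hC : 0 ≤ C) (hc : 0 < c)
    (hcC : 2 * c * C ≤ ζ)
    (hlip : ∀ x s, |h (x * s⁻¹) - h x| ≤ C * ℓ s)
    (hharm : ∀ x, HasSum (fun s => μ s * h (x * s⁻¹)) (h x))
    (hr : r ≠ 0) (Sig : Finset G) (hvar : ∀ x, ∃ s ∈ Sig, h (x * s⁻¹) = h x + r) :
    ∃ δ > 0, ∃ w : ℝ, ∀ x, w ≤ h x → (1 + δ) * Real.exp (-c * |h x|) ≤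
      avgR μ (fun y => Real.exp (-c * |h y|)) x := by
  obtain ⟨s₀, hs₀, -⟩ := hvar 1
  obtain ⟨q, hq, hqS⟩ : ∃ q > 0, ∀ s ∈ Sig, q ≤ μ s := by
    obtain ⟨s, hs, hmin⟩ := Sig.exists_min_image μ ⟨s₀, hs₀⟩
    exact ⟨μ s, hμ.pos s, hmin⟩
  set M := ∑' s, μ s * Real.exp (ζ * ℓ s) with hM
  have hM0 : 0 ≤ M := tsum_nonneg fun s => mul_nonneg (hμ.pos s).le (Real.exp_pos _).le
  set e := Real.exp (-c * r) - 1 + c * r with he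
  have he0 : 0 < e := by
    have := Real.add_one_lt_exp (x := -c * r) (by simp [hr, hc.ne'])
    linarith
  set δ := q * e / 2 with hδ
  have hδ0 : 0 < δ := by positivity
  obtain ⟨w, hw0, hw⟩ : ∃ w ≥ 0, Real.exp (-c * w) * M ≤ δ := by
    have ht : Filter.Tendsto (fun w : ℝ => Real.exp (-c * w) * M) Filter.atTop (nhds (0 * M)) := by
      refine Filter.Tendsto.mul_const _ (Real.tendsto_exp_atBot.comp ?_)
      exact (Filter.tendsto_id.const_mul_atTop_of_neg (by linarith))
    rw [zero_mul] at ht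
    obtain ⟨w, hw⟩ := ((ht.eventually (ge_mem_nhds hδ0)).and (Filter.eventually_ge_atTop 0)).exists
    exact ⟨w, hw.2, hw.1⟩
  refine ⟨δ, hδ0, w, fun x hx => ?_⟩
  have hx0 : 0 ≤ h x := hw0.trans hx
  rw [abs_of_nonneg hx0]
  -- the sum of the exponential increments
  have hsξ : HasSum (fun s => μ s * (h (x * s⁻¹) - h x)) 0 := by
    have := (hharm x).sub (hμ.hasSum.mul_right (h x))
    simp only [one_mul, sub_self] at this
    refine this.congr_fun fun s => ?_
    ring
  have hsum1 : Summable fun s => μ s * Real.exp (-c * (h (x * s⁻¹) - h x)) := by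
    refine hμ.summableR_of_le (K := 1) fun s => ?_
    rw [Real.abs_exp, one_mul]
    apply Real.exp_le_exp.2
    have h1 := (abs_le.1 (hlip x s)).1
    have h2 := hμ.len.nonneg s
    have h3 : 0 ≤ c * C * ℓ s := by positivity
    have h4 : 2 * c * C * ℓ s ≤ ζ * ℓ s := mul_le_mul_of_nonneg_right hcC h2
    nlinarith
  have hlow : 1 + 2 * δ ≤ ∑' s, μ s * Real.exp (-c * (h (x * s⁻¹) - h x)) := by
    have hs2 : HasSum (fun s => μ s * (Real.exp (-c * (h (x * s⁻¹) - h x)) - 1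
        + c * (h (x * s⁻¹) - h x))) ((∑' s, μ s * Real.exp (-c * (h (x * s⁻¹) - h x))) - 1 + c * 0) := by
      refine ((hsum1.hasSum.sub hμ.hasSum).add (hsξ.mul_left c)).congr_fun ?_
      intro s; ring
    obtain ⟨s, hs, hsr⟩ := hvar x
    have h1 := le_hasSum hs2 s fun t _ => mul_nonneg (hμ.pos t).le (by
      have := Real.add_one_le_exp (-c * (h (x * t⁻¹) - h x)); linarith)
    have h2 : h (x * s⁻¹) - h x = r := by linarith
    rw [h2] at h1
    have h3 : q * e ≤ μ s * e := mul_le_mul_of_nonneg_right (hqS s hs) he0.le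
    linarith
  have hterm : ∀ s, μ s * Real.exp (-c * (h (x * s⁻¹) - h x)) * Real.exp (-c * h x)
      - μ s * Real.exp (ζ * ℓ s) * (Real.exp (-c * w) * Real.exp (-c * h x)) ≤
      μ s * Real.exp (-c * |h (x * s⁻¹)|) := by
    intro s
    have key : Real.exp (-c * (h (x * s⁻¹) - h x)) * Real.exp (-c * h x)
      - Real.exp (ζ * ℓ s) * (Real.exp (-c * w) * Real.exp (-c * h x)) ≤
        Real.exp (-c * |h (x * s⁻¹)|) := by
      rw [← Real.exp_add, ← Real.exp_add, ← Real.exp_add]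
      have e1 : -c * (h (x * s⁻¹) - h x) + -c * h x = -c * h (x * s⁻¹) := by ring
      rw [e1]
      rcases le_or_gt 0 (h (x * s⁻¹)) with hh | hh
      · rw [abs_of_nonneg hh]
        linarith [Real.exp_pos (ζ * ℓ s + (-c * w + -c * h x))]
      · have h1 := (abs_le.1 (hlip x s)).1
        have h2 := hμ.len.nonneg s
        have h4 : 2 * c * C * ℓ s ≤ ζ * ℓ s := mul_le_mul_of_nonneg_right hcC h2
        have : -c * h (x * s⁻¹) ≤ ζ * ℓ s + (-c * w + -c * h x) := by
          have h5 : w - C * ℓ s ≤ 0 := by linarith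
          have h6 : c * w ≤ c * C * ℓ s := by nlinarith
          nlinarith
        linarith [Real.exp_le_exp.2 this, Real.exp_pos (-c * |h (x * s⁻¹)|)]
    have := mul_le_mul_of_nonneg_left key (hμ.pos s).le
    linarith
  have hbd : Summable fun s => μ s * Real.exp (-c * |h (x * s⁻¹)|) := by
    refine hμ.summableR_bdd (u := fun y => Real.exp (-c * |h y|)) (K := 1) (fun y => ?_) x
    rw [Real.abs_exp]
    exact Real.exp_le_one_iff.2 (by nlinarith [abs_nonneg (h y)])
  have hfin := hasSum_le hterm
    ((hsum1.hasSum.mul_right (Real.exp (-c * h x))).sub (hμ.summable.hasSum.mul_right _))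
    hbd.hasSum
  refine le_trans ?_ hfin
  have hE := Real.exp_pos (-c * h x)
  rw [← hM]
  nlinarith [mul_le_mul_of_nonneg_right hlow hE.le, mul_le_mul_of_nonneg_right hw hE.le]

theorem exists_growth_two_sided (hμ : Nice ℓ μ ζ) {h : G → ℝ} {C c r : ℝ} (hC : 0 ≤ C) (hc : 0 < c)
    (hcC : 2 * c * C ≤ ζ)
    (hlip : ∀ x s, |h (x * s⁻¹) - h x| ≤ C * ℓ s)
    (hharm : ∀ x, HasSum (fun s => μ s * h (x * s⁻¹)) (h x))
    (hr : r ≠ 0) (Sig : Finset G) (hvar : ∀ x, ∃ s ∈ Sig, h (x * s⁻¹) = h x + r) :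
    ∃ δ > 0, ∃ w : ℝ, ∀ x, w ≤ |h x| → (1 + δ) * Real.exp (-c * |h x|) ≤
      avgR μ (fun y => Real.exp (-c * |h y|)) x := by
  obtain ⟨δ₁, h1, w₁, H1⟩ := exists_growth_one_sided hμ hC hc hcC hlip hharm hr Sig hvar
  obtain ⟨δ₂, h2, w₂, H2⟩ := exists_growth_one_sided hμ (h := fun x => -h x) hC hc hcC
    (fun x s => by rw [← abs_neg]; convert hlip x s using 2; ring)
    (fun x => by simpa using (hharm x).neg) (neg_ne_zero.2 hr) Sig
    (fun x => by obtain ⟨s, hs, h⟩ := hvar x; exact ⟨s, hs, by rw [h]; ring⟩)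
  simp only [abs_neg] at H2
  refine ⟨min δ₁ δ₂, lt_min h1 h2, max w₁ w₂, fun x hx => ?_⟩
  rcases abs_cases (h x) with ⟨hh, _⟩ | ⟨hh, _⟩
  · refine le_trans ?_ (H1 x ((le_max_left _ _).trans (hh ▸ hx)))
    gcongr; exact min_le_left _ _
  · refine le_trans ?_ (H2 x ((le_max_right _ _).trans (hh ▸ hx)))
    gcongr; exact min_le_right _ _

/-- The barrier function. -/
theorem exists_barrier (hμ : Nice ℓ μ ζ) {h : G → ℝ} {C c r : ℝ} (hC : 0 ≤ C) (hc : 0 < c)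
    (hcC : 2 * c * C ≤ ζ)
    (hlip : ∀ x s, |h (x * s⁻¹) - h x| ≤ C * ℓ s)
    (hharm : ∀ x, HasSum (fun s => μ s * h (x * s⁻¹)) (h x))
    (hr : r ≠ 0) (Sig : Finset G) (hvar : ∀ x, ∃ s ∈ Sig, h (x * s⁻¹) = h x + r) :
    ∃ w : ℝ, ∀ κ > 0, ∀ C₁ ≥ 0, ∃ (B : ℝ) (W : G → ℝ), (∀ x, 0 ≤ W x ∧ W x ≤ B) ∧
      ∀ x, C₁ * Real.exp (-c * |h x|) + avgR μ W x - (if |h x| ≤ w then κ else 0) * W x ≤ W x := by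
  obtain ⟨δ, hδ, w, H⟩ := exists_growth_two_sided hμ hC hc hcC hlip hharm hr Sig hvar
  refine ⟨w, fun κ hκ C₁ hC₁ => ?_⟩
  set K₀ := 1 + (1 + δ) / κ with hK
  have hK1 : κ * (K₀ - 1) = 1 + δ := by rw [hK]; field_simp; ring
  have hK2 : 1 ≤ K₀ := by rw [hK]; have : 0 < (1 + δ) / κ := by positivity
                          linarith
  have hexp : ∀ y, 0 < Real.exp (-c * |h y|) ∧ Real.exp (-c * |h y|) ≤ 1 := fun y =>
    ⟨Real.exp_pos _, Real.exp_le_one_iff.2 (by nlinarith [abs_nonneg (h y)])⟩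
  refine ⟨C₁ / δ * K₀, fun x => C₁ / δ * (K₀ - Real.exp (-c * |h x|)), fun x => ⟨?_, ?_⟩,
    fun x => ?_⟩
  · have := (hexp x).2
    exact mul_nonneg (by positivity) (by linarith)
  · have := (hexp x).1
    exact mul_le_mul_of_nonneg_left (by linarith) (by positivity)
  have hsE : Summable fun s => μ s * Real.exp (-c * |h (x * s⁻¹)|) := by
    refine hμ.summableR_bdd (u := fun y => Real.exp (-c * |h y|)) (K := 1) (fun y => ?_) x
    rw [Real.abs_exp]; exact (hexp y).2
  have hav : avgR μ (fun x => C₁ / δ * (K₀ - Real.exp (-c * |h x|))) x =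
      C₁ / δ * (K₀ - avgR μ (fun y => Real.exp (-c * |h y|)) x) := by
    have h1 := ((hμ.hasSum.mul_right K₀).sub hsE.hasSum).mul_left (C₁ / δ)
    rw [one_mul] at h1
    unfold avgR
    rw [← h1.tsum_eq]
    congr 1; ext s; ring
  rw [hav]
  have hA : 0 ≤ C₁ / δ := by positivity
  have hA2 : C₁ = C₁ / δ * δ := by field_simp
  set A := C₁ / δ with hAdef
  rw [hA2]
  set E := Real.exp (-c * |h x|) with hE
  set Q := avgR μ (fun y => Real.exp (-c * |h y|)) x with hQ
  have hE' := hexp x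
  rw [← hE] at hE'
  split_ifs with hw
  · have hQ0 : 0 ≤ Q := tsum_nonneg fun s => mul_nonneg (hμ.pos s).le (hexp _).1.le
    have h2 : δ * E + (K₀ - Q) - κ * (K₀ - E) ≤ K₀ - E := by
      have : κ * (K₀ - E) ≥ κ * (K₀ - 1) := mul_le_mul_of_nonneg_left (by linarith) hκ.le
      nlinarith
    nlinarith [mul_le_mul_of_nonneg_left h2 hA]
  · have h2 : δ * E + (K₀ - Q) ≤ K₀ - E := by
      have := H x (le_of_not_ge hw)
      linarith
    nlinarith [mul_le_mul_of_nonneg_left h2 hA]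

end Barrier

section Equivariant

variable {G : Type*} [Group G] {ℓ μ : G → ℝ} {ζ : ℝ}

theorem norm_convex_combination_le {p q ε : ℝ} (hp : 0 < p) (hq : 0 < q) (hp1 : p ≤ 1)
    (hq1 : q ≤ 1) (hε : 0 < ε) (hε1 : ε ≤ 1) {z : ℂ} (hz : ‖z‖ = 1) (hre : z.re ≤ 1 - ε) :
    ‖(p : ℂ) + q * z‖ ≤ p + q - p * q * ε / 2 := by
  have h1 : 0 ≤ p + q - p * q * ε / 2 := by
    have : p * q * ε ≤ p * 1 * 1 := by gcongr
    nlinarith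
  refine abs_le_of_sq_le_sq' ?_ h1 |>.2
  have h2 : z.re ^ 2 + z.im ^ 2 = 1 := by
    have := Complex.sq_norm z
    rw [hz, Complex.normSq_apply] at this
    nlinarith
  rw [Complex.sq_norm, Complex.normSq_apply]
  simp only [Complex.add_re, Complex.ofReal_re, Complex.mul_re, Complex.ofReal_im, zero_mul,
    sub_zero, Complex.add_im, Complex.mul_im, zero_add, add_zero]
  have h3 : 0 < p * q := mul_pos hp hq
  have h4 : p * q * z.re ≤ p * q * (1 - ε) := mul_le_mul_of_nonneg_left hre h3.le
  have h5 : (p * q * ε) * (p + q) ≤ (p * q * ε) * 2 :=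
    mul_le_mul_of_nonneg_left (by linarith) (by positivity)
  have h6 : (p + q * z.re) * (p + q * z.re) + q * z.im * (q * z.im) =
      p ^ 2 + 2 * (p * q * z.re) + q ^ 2 := by linear_combination q ^ 2 * h2
  rw [h6]
  nlinarith [sq_nonneg (p * q * ε)]

theorem Nice.le_one (hμ : Nice ℓ μ ζ) (x : G) : μ x ≤ 1 :=
  le_hasSum hμ.hasSum x fun _ _ => (hμ.pos _).le

theorem Nice.norm_avg_le_of_kill (hμ : Nice ℓ μ ζ) {u : G → ℂ} {K : ℝ} (hu : ∀ x, ‖u x‖ ≤ K)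
    {x t : G} {z : ℂ} {ε : ℝ} (hz : ‖z‖ = 1) (hε : 0 < ε) (hε1 : ε ≤ 1) (hre : z.re ≤ 1 - ε)
    (ht : t ≠ 1) (hut : u (x * t) = z * u x) :
    ‖avg μ u x‖ ≤ avgR μ (fun y => ‖u y‖) x - μ 1 * μ t * ε / 2 * ‖u x‖ := by
  classical
  have hti : t⁻¹ ≠ 1 := inv_ne_one.2 ht
  have hs := hμ.summable_bdd hu x
  have hsR : Summable fun s => μ s * ‖u (x * s⁻¹)‖ :=
    hμ.summableR_bdd (u := fun y => ‖u y‖) (K := K) (fun y => by simpa using hu y) x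
  have hT : ({1, t⁻¹} : Finset G).sum (fun s => (μ s : ℂ) * u (x * s⁻¹)) =
      ((μ 1 : ℂ) + μ t * z) * u x := by
    rw [Finset.sum_pair (Ne.symm hti)]
    simp only [inv_one, mul_one, inv_inv, hut, hμ.symm]
    ring
  have hTR : ({1, t⁻¹} : Finset G).sum (fun s => μ s * ‖u (x * s⁻¹)‖) =
      (μ 1 + μ t) * ‖u x‖ := by
    rw [Finset.sum_pair (Ne.symm hti)]
    simp only [inv_one, mul_one, inv_inv, hut, hμ.symm, norm_mul, hz, one_mul]
    ring
  unfold avg avgR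
  rw [← hs.sum_add_tsum_subtype_compl {1, t⁻¹}, ← hsR.sum_add_tsum_subtype_compl {1, t⁻¹}, hT, hTR]
  refine (norm_add_le _ _).trans ?_
  have h1 : ‖∑' s : { s // s ∉ ({1, t⁻¹} : Finset G) }, (μ s : ℂ) * u (x * (s : G)⁻¹)‖ ≤
      ∑' s : { s // s ∉ ({1, t⁻¹} : Finset G) }, μ s * ‖u (x * (s : G)⁻¹)‖ := by
    refine tsum_of_norm_bounded (hsR.subtype _).hasSum fun s => ?_
    rw [norm_mul, Complex.norm_real, Real.norm_of_nonneg (hμ.pos s).le]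
    rfl
  have h2 := norm_convex_combination_le (hμ.pos 1) (hμ.pos t) (hμ.le_one 1) (hμ.le_one t) hε hε1
    hz hre
  rw [norm_mul]
  nlinarith [mul_le_mul_of_nonneg_right h2 (norm_nonneg (u x))]

theorem Nice.avg_equivariant {N : Subgroup G} {θ : G → ℂ} {u : G → ℂ}
    (hu : ∀ t ∈ N, ∀ x, u (t * x) = θ t * u x) :
    ∀ t ∈ N, ∀ x, avg μ u (t * x) = θ t * avg μ u x := by
  intro t ht x
  unfold avg
  rw [← tsum_mul_left]
  congr 1; ext s
  rw [mul_assoc, hu t ht]; ring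

theorem Nice.sum_norm_iterate_le (hμ : Nice ℓ μ ζ) {h : G → ℝ} {w κ B A : ℝ} {W : G → ℝ} {F : G → ℂ}
    (hW : ∀ x, 0 ≤ W x ∧ W x ≤ B) (hκ : κ ≤ μ 1)
    (hFb : ∀ x, ‖F x‖ ≤ A)
    (hbar : ∀ x, ‖F x‖ + avgR μ W x - (if |h x| ≤ w then κ else 0) * W x ≤ W x)
    (hkill : ∀ n x, ‖avg μ ((avg μ)^[n] F) x‖ ≤ avgR μ (fun y => ‖(avg μ)^[n] F y‖) x -
      (if |h x| ≤ w then κ else 0) * ‖(avg μ)^[n] F x‖) (n : ℕ) :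
    ∀ x, ∑ i ∈ Finset.range n, ‖(avg μ)^[i] F x‖ ≤ W x := by
  have hib : ∀ i x, ‖(avg μ)^[i] F x‖ ≤ A := by
    intro i
    induction i with
    | zero => exact hFb
    | succ i ih => intro x; rw [Function.iterate_succ_apply']; exact hμ.norm_avg_le ih x
  induction n with
  | zero => intro x; simpa using (hW x).1
  | succ n ih =>
    intro x
    rw [Finset.sum_range_succ']
    simp only [Function.iterate_succ_apply', Function.iterate_zero, id]
    set k := if |h x| ≤ w then κ else 0 with hk
    have hk1 : k ≤ μ 1 := by rw [hk]; split_ifs; exacts [hκ, (hμ.pos 1).le]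
    have h1 : ∑ i ∈ Finset.range n, ‖avg μ ((avg μ)^[i] F) x‖ ≤
        ∑ i ∈ Finset.range n, (avgR μ (fun y => ‖(avg μ)^[i] F y‖) x - k * ‖(avg μ)^[i] F x‖) :=
      Finset.sum_le_sum fun i _ => hkill i x
    have hs : ∀ i, Summable fun s => μ s * ‖(avg μ)^[i] F (x * s⁻¹)‖ := fun i =>
      hμ.summableR_bdd (u := fun y => ‖(avg μ)^[i] F y‖) (K := A) (fun y => by simpa using hib i y) x
    have h2 : HasSum (fun s => μ s * ∑ i ∈ Finset.range n, ‖(avg μ)^[i] F (x * s⁻¹)‖)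
        (∑ i ∈ Finset.range n, avgR μ (fun y => ‖(avg μ)^[i] F y‖) x) := by
      simp only [Finset.mul_sum]
      exact hasSum_sum fun i _ => (hs i).hasSum
    have hWs : Summable fun s => μ s * W (x * s⁻¹) :=
      hμ.summableR_bdd (u := W) (K := B) (fun y => by rw [abs_of_nonneg (hW y).1]; exact (hW y).2) x
    have h3 := le_hasSum (hWs.hasSum.sub h2) 1 fun s _ => by
      have := mul_le_mul_of_nonneg_left (ih (x * s⁻¹)) (hμ.pos s).le
      linarith
    simp only [inv_one, mul_one] at h3
    have h4 : k * (W x - ∑ i ∈ Finset.range n, ‖(avg μ)^[i] F x‖) ≤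
        μ 1 * (W x - ∑ i ∈ Finset.range n, ‖(avg μ)^[i] F x‖) :=
      mul_le_mul_of_nonneg_right hk1 (by linarith [ih x])
    have h5 := hbar x
    rw [Finset.sum_sub_distrib, ← Finset.mul_sum] at h1
    unfold avgR at h1 h5 h3
    unfold avgR at *
    linarith

theorem increment_bound {C c a ζ hx hy l : ℝ} {p q : ℂ} (hC : 0 ≤ C) (ha : 0 < a) (hac : a ≤ c)
    (hζ : 0 < ζ) (haC : a * C ≤ ζ / 4) (hl : 0 ≤ l) (hlip : |hy - hx| ≤ C * l)
    (hq : ‖q‖ = 1) (hflat : ‖q - p‖ ≤ C * Real.exp (-c * hx + ζ / 2 * l)) :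
    ‖((max hy 0 : ℝ) : ℂ) * q - ((max hx 0 : ℝ) : ℂ) * p -
      (if 0 ≤ hx then ((hy - hx : ℝ) : ℂ) * p else 0)‖ ≤
      (1 / a + 2 * C / a + 2 * C * C / ζ) * Real.exp (-(a / 2) * |hx|) * Real.exp (ζ * l) := by
  have habs := abs_le.1 hlip
  have hexpb : ∀ y : ℝ, y ≤ -(a / 2) * |hx| + ζ * l →
      Real.exp y ≤ Real.exp (-(a / 2) * |hx|) * Real.exp (ζ * l) := fun y hy => by
    rw [← Real.exp_add]; exact Real.exp_le_exp.2 hy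
  set X := Real.exp (-(a / 2) * |hx|) * Real.exp (ζ * l) with hX
  have hX0 : 0 < X := by positivity
  have haCl : a * (C * l) ≤ ζ / 4 * l := by nlinarith
  have hζl : 0 ≤ ζ * l := by positivity
  rw [mul_assoc, ← hX]
  have e1 : 0 ≤ 2 * C / a := by positivity
  have e2 : 0 ≤ 2 * C * C / ζ := by positivity
  have e3 : 0 < 1 / a := by positivity
  split_ifs with h0
  · rw [max_eq_left h0, abs_of_nonneg h0] at *
    have hrw : ((max hy 0 : ℝ) : ℂ) * q - (hx : ℂ) * p - ((hy - hx : ℝ) : ℂ) * p =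
        ((max hy 0 - hy : ℝ) : ℂ) * q + (hy : ℂ) * (q - p) := by push_cast; ring
    rw [hrw]
    refine (norm_add_le _ _).trans ?_
    rw [norm_mul, norm_mul, hq, mul_one, Complex.norm_real, Complex.norm_real]
    have p1 : ‖max hy 0 - hy‖ ≤ 1 / a * X := by
      have h1 : a * (max hy 0 - hy) ≤ X := by
        rcases le_total 0 hy with h | h
        · rw [max_eq_left h]; simp [hX0.le]
        · rw [max_eq_right h]
          have h2 := Real.add_one_le_exp (-a * hy)
          have h3 := hexpb (-a * hy) (by nlinarith)
          linarith
      rw [Real.norm_of_nonneg (by linarith [le_max_left hy 0]), one_div, inv_mul_eq_div,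
        le_div_iff₀ ha]
      linarith
    have p2 : ‖hy‖ * ‖q - p‖ ≤ (2 * C / a + 2 * C * C / ζ) * X := by
      have hyb : ‖hy‖ ≤ hx + C * l := by
        rw [Real.norm_eq_abs, abs_le]; constructor <;> nlinarith [mul_nonneg hC hl]
      have h1 : hx ≤ 2 / a * Real.exp (a / 2 * hx) := by
        have := Real.add_one_le_exp (a / 2 * hx)
        calc hx = 2 / a * (a / 2 * hx) := by field_simp
          _ ≤ _ := mul_le_mul_of_nonneg_left (by linarith) (by positivity)
      have h2 : l ≤ 2 / ζ * Real.exp (ζ / 2 * l) := by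
        have := Real.add_one_le_exp (ζ / 2 * l)
        calc l = 2 / ζ * (ζ / 2 * l) := by field_simp
          _ ≤ _ := mul_le_mul_of_nonneg_left (by linarith) (by positivity)
      have h3 : Real.exp (a / 2 * hx) * Real.exp (-c * hx + ζ / 2 * l) ≤ X := by
        rw [← Real.exp_add]; exact hexpb _ (by nlinarith)
      have h4 : Real.exp (ζ / 2 * l) * Real.exp (-c * hx + ζ / 2 * l) ≤ X := by
        rw [← Real.exp_add]; exact hexpb _ (by nlinarith)
      calc ‖hy‖ * ‖q - p‖ ≤ (hx + C * l) * (C * Real.exp (-c * hx + ζ / 2 * l)) := by gcongr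
        _ ≤ (2 / a * Real.exp (a / 2 * hx) + C * (2 / ζ * Real.exp (ζ / 2 * l))) *
            (C * Real.exp (-c * hx + ζ / 2 * l)) := by gcongr
        _ = 2 * C / a * (Real.exp (a / 2 * hx) * Real.exp (-c * hx + ζ / 2 * l)) +
            2 * C * C / ζ * (Real.exp (ζ / 2 * l) * Real.exp (-c * hx + ζ / 2 * l)) := by ring
        _ ≤ 2 * C / a * X + 2 * C * C / ζ * X := by gcongr
        _ = _ := by ring
    linarith
  · push Not at h0
    rw [max_eq_right h0.le, abs_of_neg h0] at *
    simp only [Complex.ofReal_zero, zero_mul, sub_zero]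
    rw [norm_mul, hq, mul_one, Complex.norm_real]
    have h1 : a * max hy 0 ≤ X := by
      rcases le_total 0 hy with h | h
      · rw [max_eq_left h]
        have h2 := Real.add_one_le_exp (a * hy)
        have h3 := hexpb (a * hy) (by nlinarith)
        linarith
      · rw [max_eq_right h]; simp [hX0.le]
    have p1 : ‖max hy 0‖ ≤ 1 / a * X := by
      rw [Real.norm_of_nonneg (le_max_right _ _), one_div, inv_mul_eq_div, le_div_iff₀ ha]
      linarith
    nlinarith [mul_nonneg e1 hX0.le, mul_nonneg e2 hX0.le]

theorem exists_equivariant_harmonic (hμ : Nice ℓ μ ζ) {h : G → ℝ} {ψ : G → ℂ} {C c r : ℝ}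
    (hC : 0 ≤ C) (hc : 0 < c)
    (hlip : ∀ x s, |h (x * s⁻¹) - h x| ≤ C * ℓ s)
    (hharm : ∀ x, HasSum (fun s => μ s * h (x * s⁻¹)) (h x))
    (hr : r ≠ 0) (Sig : Finset G) (hvar : ∀ x, ∃ s ∈ Sig, h (x * s⁻¹) = h x + r)
    (hψ1 : ∀ x, ‖ψ x‖ = 1)
    (hflat : ∀ x s, ‖ψ (x * s⁻¹) - ψ x‖ ≤ C * Real.exp (-c * h x + ζ / 2 * ℓ s))
    (N : Subgroup G) (θ : G → ℂ) (hψN : ∀ t ∈ N, ∀ x, ψ (t * x) = θ t * ψ x)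
    (hhN : ∀ t ∈ N, ∀ x, h (t * x) = h x)
    (hkill : ∀ w : ℝ, ∃ ε > 0, ∃ T : Finset G, ∀ x, |h x| ≤ w →
      ∃ t ∈ T, x * t * x⁻¹ ∈ N ∧ (θ (x * t * x⁻¹)).re ≤ 1 - ε) :
    ∃ f : G → ℂ, Harm μ f ∧ (∃ C', ∀ x, ‖f x - ((max (h x) 0 : ℝ) : ℂ) * ψ x‖ ≤ C') ∧
      ∀ t ∈ N, ∀ x, f (t * x) = θ t * f x := by
  classical
  have hζ := hμ.pos_exp
  set a := min c (ζ / (4 * (C + 1))) with ha_def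
  have ha : 0 < a := lt_min hc (by positivity)
  have hac : a ≤ c := min_le_left _ _
  have haC : a * C ≤ ζ / 4 := by
    have h1 : a * (C + 1) ≤ ζ / 4 := by
      calc a * (C + 1) ≤ ζ / (4 * (C + 1)) * (C + 1) :=
            mul_le_mul_of_nonneg_right (min_le_right _ _) (by positivity)
        _ = ζ / 4 := by field_simp
    nlinarith
  set g : G → ℂ := fun x => ((max (h x) 0 : ℝ) : ℂ) * ψ x with hg
  set M := ∑' s, μ s * Real.exp (ζ * ℓ s) with hM
  have hM0 : 0 ≤ M := tsum_nonneg fun s => mul_nonneg (hμ.pos s).le (Real.exp_pos _).le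
  set K := 1 / a + 2 * C / a + 2 * C * C / ζ with hK
  have hK0 : 0 ≤ K := by positivity
  -- one-step increments of `g`
  have hstep : ∀ x, ∃ F : ℂ, HasSum (fun s => (μ s : ℂ) * g (x * s⁻¹)) (g x + F) ∧
      ‖F‖ ≤ (K * M) * Real.exp (-(a / 2) * |h x|) := by
    intro x
    set D : G → ℂ := fun s => g (x * s⁻¹) - g x -
      (if 0 ≤ h x then ((h (x * s⁻¹) - h x : ℝ) : ℂ) * ψ x else 0) with hD
    have hDb : ∀ s, ‖D s‖ ≤ K * Real.exp (-(a / 2) * |h x|) * Real.exp (ζ * ℓ s) := fun s =>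
      increment_bound hC ha hac hζ haC (hμ.len.nonneg s) (hlip x s) (hψ1 _) (hflat x s)
    have h1 := (hμ.summable_of_le hDb).hasSum
    have h2 := hμ.norm_tsum_le hDb
    refine ⟨∑' s, (μ s : ℂ) * D s, ?_, h2.trans_eq (by rw [← hM]; ring)⟩
    have h3 : HasSum (fun s => (μ s : ℂ) * g x) (g x) := by
      have := (Complex.hasSum_ofReal.2 hμ.hasSum).mul_right (g x)
      simpa using this
    have h4 : HasSum (fun s => (μ s : ℂ) *
        (if 0 ≤ h x then ((h (x * s⁻¹) - h x : ℝ) : ℂ) * ψ x else 0)) 0 := by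
      split_ifs with h0
      · have h5 := ((hharm x).sub (hμ.hasSum.mul_right (h x)))
        rw [one_mul, sub_self] at h5
        have h6 := (Complex.hasSum_ofReal.2 h5).mul_right (ψ x)
        rw [Complex.ofReal_zero, zero_mul] at h6
        refine h6.congr_fun fun s => ?_
        push_cast; ring
      · simp
    have h7 := (h3.add h1).add h4
    rw [add_zero] at h7
    refine h7.congr_fun fun s => ?_
    simp only [hD]; ring
  choose F hF1 hF2 using hstep
  have hgN : ∀ t ∈ N, ∀ x, g (t * x) = θ t * g x := fun t ht x => by
    simp only [hg]; rw [hhN t ht, hψN t ht]; ring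
  have hFN : ∀ t ∈ N, ∀ x, F (t * x) = θ t * F x := by
    intro t ht x
    have h1 := (hF1 x).mul_left (θ t)
    have h2 : HasSum (fun s => (μ s : ℂ) * g (t * x * s⁻¹)) (θ t * (g x + F x)) := by
      refine h1.congr_fun fun s => ?_
      rw [mul_assoc, hgN t ht]; ring
    have h3 := (hF1 (t * x)).unique h2
    rw [hgN t ht] at h3
    linear_combination h3
  have hFit : ∀ n, ∀ t ∈ N, ∀ x, (avg μ)^[n] F (t * x) = θ t * (avg μ)^[n] F x := by
    intro n
    induction n with
    | zero => exact hFN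
    | succ n ih => rw [Function.iterate_succ_apply']; exact Nice.avg_equivariant ih
  have hFA : ∀ x, ‖F x‖ ≤ K * M := fun x => (hF2 x).trans
    (mul_le_of_le_one_right (by positivity)
      (Real.exp_le_one_iff.2 (by nlinarith [abs_nonneg (h x), mul_nonneg ha.le (abs_nonneg (h x))])))
  have hib : ∀ i x, ‖(avg μ)^[i] F x‖ ≤ K * M := by
    intro i
    induction i with
    | zero => exact hFA
    | succ i ih => intro x; rw [Function.iterate_succ_apply']; exact hμ.norm_avg_le ih x
  obtain ⟨w, hw⟩ := exists_barrier hμ hC (half_pos ha) (by nlinarith) hlip hharm hr Sig hvar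
  obtain ⟨ε, hε, T, hT⟩ := hkill w
  set ε' := min ε 1 with hε'
  have hε'0 : 0 < ε' := lt_min hε one_pos
  obtain ⟨q, hq, hqT⟩ : ∃ q > 0, ∀ s ∈ insert 1 T, q ≤ μ s := by
    obtain ⟨s, hs, hmin⟩ := (insert 1 T).exists_min_image μ ⟨1, Finset.mem_insert_self _ _⟩
    exact ⟨μ s, hμ.pos s, hmin⟩
  have hq1 : q ≤ 1 := (hqT 1 (Finset.mem_insert_self _ _)).trans (hμ.le_one 1)
  set κ := μ 1 * q * ε' / 2 with hκ
  have hκ0 : 0 < κ := by have := hμ.pos 1; positivity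
  have hκ1 : κ ≤ μ 1 := by
    have h1 : μ 1 * q * ε' ≤ μ 1 * 1 * 1 := by
      have := (hμ.pos 1).le
      gcongr
      exact min_le_right _ _
    rw [hκ]; linarith [hμ.pos 1]
  obtain ⟨B, W, hWB, hbar⟩ := hw κ hκ0 (K * M) (by positivity)
  have hθ : ∀ t ∈ N, ‖θ t‖ = 1 := fun t ht => by
    have := congrArg norm (hψN t ht 1)
    rwa [norm_mul, hψ1, hψ1, mul_one, eq_comm] at this
  have hθ1 : θ 1 = 1 := by
    have := hψN 1 N.one_mem 1
    rw [one_mul] at this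
    have h0 : ψ 1 ≠ 0 := fun h => by have := hψ1 1; rw [h] at this; simp at this
    exact (mul_right_cancel₀ h0 ((one_mul _).trans this)).symm
  have hsum := hμ.sum_norm_iterate_le (h := h) (w := w) (κ := κ) (B := B) (W := W) (F := F) hWB
    hκ1 hFA (fun x => le_trans (by linarith [hF2 x]) (hbar x)) (by
      intro n x
      split_ifs with hx
      · obtain ⟨t, htT, htN, htre⟩ := hT x hx
        have ht1 : t ≠ 1 := by
          rintro rfl
          rw [mul_one, mul_inv_cancel, hθ1] at htre
          simp at htre; linarith
        have := hμ.norm_avg_le_of_kill (hib n) (x := x) (t := t) (hθ _ htN) hε'0 (min_le_right _ _)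
          (htre.trans (by linarith [min_le_left ε 1])) ht1
          (by rw [← hFit n _ htN]; group)
        refine this.trans (sub_le_sub_left (mul_le_mul_of_nonneg_right ?_ (norm_nonneg _)) _)
        have h1 := hqT t (Finset.mem_insert_of_mem htT)
        have := (hμ.pos 1).le
        rw [hκ]
        gcongr
      · rw [zero_mul, sub_zero]
        refine tsum_of_norm_bounded (hμ.summableR_bdd (u := fun y => ‖(avg μ)^[n] F y‖) (K := K * M)
          (fun y => by simpa using hib n y) x).hasSum fun s => ?_
        rw [norm_mul, Complex.norm_real, Real.norm_of_nonneg (hμ.pos s).le])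
  have hsm : ∀ x, Summable fun i => ‖(avg μ)^[i] F x‖ := fun x =>
    summable_of_sum_range_le (fun _ => norm_nonneg _) fun n => hsum n x
  have hsm' : ∀ x, Summable fun i => (avg μ)^[i] F x := fun x => (hsm x).of_norm
  refine ⟨fun x => g x + ∑' i, (avg μ)^[i] F x, fun x => ?_, ⟨B, fun x => ?_⟩, fun t ht x => ?_⟩
  · -- harmonicity by dominated convergence
    have hpart : ∀ n, HasSum (fun s => (μ s : ℂ) * (g (x * s⁻¹) +
        ∑ i ∈ Finset.range n, (avg μ)^[i] F (x * s⁻¹)))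
        (g x + ∑ i ∈ Finset.range (n + 1), (avg μ)^[i] F x) := by
      intro n
      have h1 : HasSum (fun s => ∑ i ∈ Finset.range n, (μ s : ℂ) * (avg μ)^[i] F (x * s⁻¹))
          (∑ i ∈ Finset.range n, (avg μ)^[i + 1] F x) := by
        refine hasSum_sum fun i _ => ?_
        rw [Function.iterate_succ_apply']
        exact (hμ.summable_bdd (hib i) x).hasSum
      have h2 := (hF1 x).add h1
      rw [Finset.sum_range_succ', add_comm (∑ i ∈ Finset.range n, _), ← add_assoc]
      refine h2.congr_fun fun s => ?_
      rw [mul_add, Finset.mul_sum]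
    have hbound : Summable fun s => ‖(μ s : ℂ) * g (x * s⁻¹)‖ + μ s * B :=
      (hF1 x).summable.norm.add (hμ.hasSum.summable.mul_right B)
    have hlim := tendsto_tsum_of_dominated_convergence (𝓕 := Filter.atTop)
      (f := fun (n : ℕ) s => (μ s : ℂ) * (g (x * s⁻¹) +
        ∑ i ∈ Finset.range n, (avg μ)^[i] F (x * s⁻¹)))
      (g := fun s => (μ s : ℂ) * (g (x * s⁻¹) + ∑' i, (avg μ)^[i] F (x * s⁻¹))) hbound
      (fun s => ((hsm' _).hasSum.tendsto_sum_nat.const_add _).const_mul _)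
      (Filter.Eventually.of_forall fun n s => by
        rw [mul_add]
        refine (norm_add_le _ _).trans (add_le_add_right ?_ _)
        rw [norm_mul, Complex.norm_real, Real.norm_of_nonneg (hμ.pos s).le]
        exact mul_le_mul_of_nonneg_left ((norm_sum_le _ _).trans ((hsum n _).trans (hWB _).2))
          (hμ.pos s).le)
    have hlim2 : Filter.Tendsto (fun n => g x + ∑ i ∈ Finset.range (n + 1), (avg μ)^[i] F x)
        Filter.atTop (nhds (g x + ∑' i, (avg μ)^[i] F x)) :=
      (((hsm' x).hasSum.tendsto_sum_nat.comp (Filter.tendsto_add_atTop_nat 1)).const_add _)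
    simp only [fun n => (hpart n).tsum_eq] at hlim
    change HasSum (fun s => (μ s : ℂ) * (g (x * s⁻¹) + ∑' i, (avg μ)^[i] F (x * s⁻¹)))
      (g x + ∑' i, (avg μ)^[i] F x)
    rw [tendsto_nhds_unique hlim2 hlim]
    refine Summable.hasSum (Summable.of_norm_bounded hbound fun s => ?_)
    rw [mul_add]
    refine (norm_add_le _ _).trans (add_le_add_right ?_ _)
    rw [norm_mul, Complex.norm_real, Real.norm_of_nonneg (hμ.pos s).le]
    exact mul_le_mul_of_nonneg_left ((norm_tsum_le_tsum_norm (hsm _)).trans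
      ((Real.tsum_le_of_sum_range_le (fun _ => norm_nonneg _) fun n => hsum n _).trans (hWB _).2))
      (hμ.pos s).le
  · change ‖g x + _ - g x‖ ≤ B
    rw [add_sub_cancel_left]
    exact (norm_tsum_le_tsum_norm (hsm _)).trans
      ((Real.tsum_le_of_sum_range_le (fun _ => norm_nonneg _) fun n => hsum n _).trans (hWB _).2)
  · change g (t * x) + ∑' i, (avg μ)^[i] F (t * x) = θ t * (g x + ∑' i, (avg μ)^[i] F x)
    rw [mul_add, hgN t ht, ← tsum_mul_left]
    simp only [hFit _ t ht]

end Equivariant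

section Mean

variable {G : Type*} [Group G] {ℓ μ : G → ℝ} {ζ : ℝ}

open Filter Topology

theorem eq_max_of_harmonic (hμ : Nice ℓ μ ζ) {u : G → ℝ} {M : ℝ} (hle : ∀ x, u x ≤ M)
    (h1 : u 1 = M) (hh : HasSum (fun s => μ s * u s⁻¹) (u 1)) (x : G) : u x = M := by
  have h2 := (hμ.hasSum.mul_right M).sub hh
  rw [one_mul, h1, sub_self] at h2
  have h3 := (hasSum_zero_iff_of_nonneg (fun s => by
    have := mul_le_mul_of_nonneg_left (hle s⁻¹) (hμ.pos s).le
    simpa using this)).1 h2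
  have h4 := congrFun h3 x⁻¹
  simp only [inv_inv, Pi.zero_apply] at h4
  have h5 : μ x⁻¹ * (M - u x) = 0 := by rw [mul_sub]; exact h4
  rcases mul_eq_zero.1 h5 with h | h
  · exact absurd h (hμ.pos _).ne'
  · linarith

open scoped BoundedContinuousFunction in
theorem bounded_harmonic_const (hμ : Nice ℓ μ ζ) (hFD : FD ℓ μ) {u : G → ℝ} {K : ℝ}
    (hK : ∀ x, |u x| ≤ K) (hu : ∀ x, HasSum (fun s => μ s * u (x * s⁻¹)) (u x)) (x : G) :
    u x = u 1 := by
  obtain ⟨W, hW, hWmem⟩ := hFD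
  let _ : TopologicalSpace G := ⊥
  have _ : DiscreteTopology G := ⟨rfl⟩
  let V : Submodule ℂ (G →ᵇ ℂ) :=
    { carrier := {f | Harm μ f}
      zero_mem' := fun x => by simp
      add_mem' := fun {f g} hf hg x => by
        refine ((hf x).add (hg x)).congr_fun fun s => ?_
        simp [mul_add]
      smul_mem' := fun c f hf x => by
        refine ((hf x).mul_left c).congr_fun fun s => ?_
        simp; ring }
  have hVW : ∀ f ∈ V, (f : G → ℂ) ∈ W := fun f hf => hWmem f ‖f‖ (fun x => by
    have := f.norm_coe_le_norm x
    nlinarith [hμ.len.nonneg x, norm_nonneg f, mul_nonneg (norm_nonneg f) (hμ.len.nonneg x)]) hf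
  let toW : V →ₗ[ℂ] W :=
    { toFun := fun f => ⟨f.1, hVW _ f.2⟩
      map_add' := fun f g => rfl
      map_smul' := fun c f => rfl }
  have hinj : Function.Injective toW := fun f g h => by
    have := congrArg Subtype.val h
    exact Subtype.ext (DFunLike.coe_injective this)
  have : FiniteDimensional ℂ V := FiniteDimensional.of_injective toW hinj
  have : ProperSpace V := FiniteDimensional.proper ℂ V
  set M := sSup (Set.range u) with hM
  have hbdd : BddAbove (Set.range u) := ⟨K, by rintro _ ⟨y, rfl⟩; exact (abs_le.1 (hK y)).2⟩
  have hle : ∀ y, u y ≤ M := fun y => le_csSup hbdd ⟨y, rfl⟩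
  obtain ⟨U, -, hUt, hU⟩ := exists_seq_tendsto_sSup (Set.range_nonempty u) hbdd
  choose p hp using hU
  have huh : ∀ g : G, Harm μ fun y => ((u (g * y) : ℝ) : ℂ) := fun g y => by
    have := Complex.hasSum_ofReal.2 (hu (g * y))
    refine this.congr_fun fun s => ?_
    push_cast; rw [mul_assoc]
  let T : ℕ → V := fun n => ⟨BoundedContinuousFunction.ofNormedAddCommGroup
    (fun y => ((u (p n * y) : ℝ) : ℂ)) continuous_of_discreteTopology K
    (fun y => by rw [Complex.norm_real]; exact hK _), huh (p n)⟩
  have hTapp : ∀ n y, (T n).1 y = ((u (p n * y) : ℝ) : ℂ) := fun n y => rfl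
  have hK0 : 0 ≤ K := (abs_nonneg _).trans (hK 1)
  have hTb : ∀ n, T n ∈ Metric.closedBall (0 : V) K := fun n => by
    rw [mem_closedBall_zero_iff]
    exact (BoundedContinuousFunction.norm_le hK0).2 fun y => by
      show ‖((u (p n * y) : ℝ) : ℂ)‖ ≤ K
      rw [Complex.norm_real]; exact hK _
  obtain ⟨g, -, φ, hφ, hlim⟩ := (isCompact_closedBall (0 : V) K).tendsto_subseq hTb
  have hpt : ∀ y, Tendsto (fun n => u (p (φ n) * y)) atTop (𝓝 (g.1 y).re) := by
    intro y
    have h1 : Continuous fun f : V => (f.1 y).re :=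
      Complex.continuous_re.comp ((BoundedContinuousFunction.evalCLM ℂ y).continuous.comp
        continuous_subtype_val)
    have h2 := (h1.tendsto g).comp hlim
    exact h2
  have hg1 : (g.1 1).re = M := by
    refine tendsto_nhds_unique (hpt 1) ?_
    simp only [mul_one, hp]
    exact hUt.comp hφ.tendsto_atTop
  have hgle : ∀ y, (g.1 y).re ≤ M := fun y => le_of_tendsto' (hpt y) fun n => hle _
  have hgM : ∀ y, (g.1 y).re = M := eq_max_of_harmonic hμ (u := fun y => (g.1 y).re) hgle hg1 (by
    have := Complex.hasSum_re (g.2 1)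
    refine this.congr_fun fun s => ?_
    simp)
  have huM : ∀ y, u y = M := by
    intro y
    have h1 : Tendsto (fun n => ‖T (φ n) - g‖) atTop (𝓝 0) := tendsto_iff_norm_sub_tendsto_zero.1 hlim
    have h2 : ∀ n, |u y - M| ≤ ‖T (φ n) - g‖ := fun n => by
      have h3 := ((T (φ n) - g).1).norm_coe_le_norm ((p (φ n))⁻¹ * y)
      have h4 := (Complex.abs_re_le_norm _).trans h3
      rw [Submodule.coe_sub, BoundedContinuousFunction.sub_apply, Complex.sub_re, hTapp, hgM,
        Complex.ofReal_re, mul_inv_cancel_left] at h4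
      exact h4
    have h3 := ge_of_tendsto' h1 h2
    have := abs_nonpos_iff.1 h3
    linarith
  rw [huM, huM]

/-- Cesàro averages of the iterates of the averaging operator. -/
noncomputable def cesaro (μ : G → ℝ) (u : G → ℝ) (n : ℕ) (x : G) : ℝ :=
  (∑ i ∈ Finset.range (n + 1), (avgR μ)^[i] u x) / (n + 1)

theorem iterate_avgR_mem (hμ : Nice ℓ μ ζ) {u : G → ℝ} (hu : ∀ x, 0 ≤ u x ∧ u x ≤ 1) (i : ℕ) :
    ∀ x, 0 ≤ (avgR μ)^[i] u x ∧ (avgR μ)^[i] u x ≤ 1 := by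
  induction i with
  | zero => exact hu
  | succ i ih =>
    intro x
    rw [Function.iterate_succ_apply']
    exact ⟨tsum_nonneg fun s => mul_nonneg (hμ.pos s).le (ih _).1,
      hμ.avgR_le_of_le (K := 1) (fun x => abs_le.2 ⟨by linarith [(ih x).1], (ih x).2⟩)
        (fun x => (ih x).2) x⟩

theorem cesaro_mem (hμ : Nice ℓ μ ζ) {u : G → ℝ} (hu : ∀ x, 0 ≤ u x ∧ u x ≤ 1) (n : ℕ) (x : G) :
    cesaro μ u n x ∈ Set.Icc (0 : ℝ) 1 := by
  constructor
  · exact div_nonneg (Finset.sum_nonneg fun i _ => (iterate_avgR_mem hμ hu i x).1) (by positivity)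
  · rw [cesaro, div_le_one (by positivity)]
    calc _ ≤ ∑ i ∈ Finset.range (n + 1), (1 : ℝ) :=
          Finset.sum_le_sum fun i _ => (iterate_avgR_mem hμ hu i x).2
      _ = _ := by simp

theorem iterate_avgR_translate {u : G → ℝ} (g : G) (i : ℕ) :
    ∀ x, (avgR μ)^[i] (fun y => u (g * y)) x = (avgR μ)^[i] u (g * x) := by
  induction i with
  | zero => intro x; rfl
  | succ i ih =>
    intro x
    rw [Function.iterate_succ_apply', Function.iterate_succ_apply']
    simp only [avgR, ih, mul_assoc]

theorem iterate_avgR_add (hμ : Nice ℓ μ ζ) {u v : G → ℝ} (hu : ∀ x, 0 ≤ u x ∧ u x ≤ 1)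
    (hv : ∀ x, 0 ≤ v x ∧ v x ≤ 1) (i : ℕ) :
    ∀ x, (avgR μ)^[i] (fun y => u y + v y) x = (avgR μ)^[i] u x + (avgR μ)^[i] v x := by
  have key : ∀ {w : G → ℝ}, (∀ x, 0 ≤ w x ∧ w x ≤ 1) → ∀ i x,
      Summable fun s => μ s * (avgR μ)^[i] w (x * s⁻¹) := fun {w} hw i x =>
    hμ.summableR_bdd (K := 1) (fun x => abs_le.2 ⟨by linarith [(iterate_avgR_mem hμ hw i x).1],
      (iterate_avgR_mem hμ hw i x).2⟩) x
  induction i with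
  | zero => intro x; rfl
  | succ i ih =>
    intro x
    rw [Function.iterate_succ_apply', Function.iterate_succ_apply', Function.iterate_succ_apply']
    simp only [avgR, ih, mul_add]
    exact (key hu i x).tsum_add (key hv i x)

theorem iterate_avgR_one (hμ : Nice ℓ μ ζ) (i : ℕ) :
    ∀ x, (avgR μ)^[i] (fun _ => (1 : ℝ)) x = 1 := by
  induction i with
  | zero => intro x; rfl
  | succ i ih =>
    intro x
    rw [Function.iterate_succ_apply']
    simp only [avgR, ih, mul_one, hμ.hasSum.tsum_eq]

theorem exists_invMean (hμ : Nice ℓ μ ζ) (hFD : FD ℓ μ) : Nonempty (InvMean G) := by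
  classical
  let ω : Ultrafilter ℕ := hyperfilter ℕ
  have hωtop : (ω : Filter ℕ) ≤ atTop := by
    rw [← Nat.cofinite_eq_atTop]; exact hyperfilter_le_cofinite
  have hlim : ∀ u : G → ℝ, ∃ L : G → ℝ, (∀ x, 0 ≤ u x ∧ u x ≤ 1) →
      ∀ x, L x ∈ Set.Icc (0 : ℝ) 1 ∧ Tendsto (fun n => cesaro μ u n x) ω (𝓝 (L x)) := by
    intro u
    by_cases hu : ∀ x, 0 ≤ u x ∧ u x ≤ 1
    · have : ∀ x, ∃ l ∈ Set.Icc (0 : ℝ) 1, Tendsto (fun n => cesaro μ u n x) ω (𝓝 l) := by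
        intro x
        have := (isCompact_Icc (a := (0 : ℝ)) (b := 1)).ultrafilter_le_nhds
          (ω.map fun n => cesaro μ u n x) (by
            rw [le_principal_iff]
            exact Ultrafilter.mem_map.2 (Filter.univ_mem' fun n => cesaro_mem hμ hu n x))
        obtain ⟨l, hl, h⟩ := this
        exact ⟨l, hl, h⟩
      choose L hL1 hL2 using this
      exact ⟨L, fun _ x => ⟨hL1 x, hL2 x⟩⟩
    · exact ⟨0, fun h => absurd h hu⟩
  choose L hL using hlim
  have hI : ∀ (A : Set G) (x : G), 0 ≤ A.indicator (fun _ => (1 : ℝ)) x ∧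
      A.indicator (fun _ => (1 : ℝ)) x ≤ 1 := fun A x => by
    by_cases h : x ∈ A <;> simp [h]
  have hconst : ∀ u : G → ℝ, (∀ x, 0 ≤ u x ∧ u x ≤ 1) → ∀ x, L u x = L u 1 := by
    intro u hu
    have hbd : ∀ x, |L u x| ≤ 1 := fun x =>
      abs_le.2 ⟨by linarith [(hL u hu x).1.1], (hL u hu x).1.2⟩
    refine bounded_harmonic_const hμ hFD hbd fun x => ?_
    have hs := hμ.summableR_bdd hbd x
    convert hs.hasSum using 1
    have h1 : Tendsto (fun n => ∑' s, μ s * cesaro μ u n (x * s⁻¹)) ω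
        (𝓝 (∑' s, μ s * L u (x * s⁻¹))) := by
      refine tendsto_tsum_of_dominated_convergence hμ.hasSum.summable
        (fun s => (hL u hu (x * s⁻¹)).2.const_mul _) (Eventually.of_forall fun n s => ?_)
      have := cesaro_mem hμ hu n (x * s⁻¹)
      rw [norm_mul, Real.norm_of_nonneg (hμ.pos s).le, Real.norm_of_nonneg this.1]
      exact mul_le_of_le_one_right (hμ.pos s).le this.2
    have h2 : ∀ n : ℕ, ∑' s, μ s * cesaro μ u n (x * s⁻¹) = cesaro μ u n x +
        ((avgR μ)^[n + 1] u x - u x) / (n + 1) := by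
      intro n
      have h3 : HasSum (fun s => ∑ i ∈ Finset.range (n + 1), μ s * (avgR μ)^[i] u (x * s⁻¹))
          (∑ i ∈ Finset.range (n + 1), (avgR μ)^[i + 1] u x) := by
        refine hasSum_sum fun i _ => ?_
        rw [Function.iterate_succ_apply']
        exact (hμ.summableR_bdd (K := 1) (fun x => abs_le.2
          ⟨by linarith [(iterate_avgR_mem hμ hu i x).1], (iterate_avgR_mem hμ hu i x).2⟩) x).hasSum
      have h4 := h3.div_const ((n : ℝ) + 1)
      have h5 : (fun s => μ s * cesaro μ u n (x * s⁻¹)) = fun s =>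
          (∑ i ∈ Finset.range (n + 1), μ s * (avgR μ)^[i] u (x * s⁻¹)) / ((n : ℝ) + 1) := by
        funext s
        rw [cesaro, ← Finset.mul_sum, mul_div_assoc]
      rw [h5, h4.tsum_eq, cesaro, ← add_div]
      congr 1
      rw [Finset.sum_range_succ, Finset.sum_range_succ']
      simp only [Function.iterate_zero, id]
      ring
    have h6 : Tendsto (fun n : ℕ => ((avgR μ)^[n + 1] u x - u x) / ((n : ℝ) + 1)) atTop (𝓝 0) := by
      refine squeeze_zero_norm (a := fun n : ℕ => 1 / ((n : ℝ) + 1)) (fun n => ?_)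
        tendsto_one_div_add_atTop_nhds_zero_nat
      rw [norm_div, Real.norm_of_nonneg (show (0 : ℝ) ≤ (n : ℝ) + 1 by positivity)]
      gcongr
      rw [Real.norm_eq_abs, abs_le]
      have := iterate_avgR_mem hμ hu (n + 1) x
      have h7 := hu x
      constructor <;> linarith
    simp only [h2] at h1
    have h8 := (hL u hu x).2.add (h6.mono_left hωtop)
    rw [add_zero] at h8
    exact tendsto_nhds_unique h8 h1
  refine ⟨⟨fun A => L (A.indicator fun _ => 1) 1, fun A => (hL _ (hI A) 1).1.1, ?_, ?_, ?_⟩⟩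
  · have h1 := (hL _ (hI Set.univ) 1).2
    refine tendsto_nhds_unique h1 ?_
    have h2 : ∀ n : ℕ, cesaro μ (Set.univ.indicator fun _ => (1 : ℝ)) n 1 = 1 := by
      intro n
      rw [Set.indicator_univ, cesaro]
      simp only [iterate_avgR_one hμ, Finset.sum_const, Finset.card_range, nsmul_eq_mul, mul_one]
      push_cast
      field_simp
    simp only [h2]
    exact tendsto_const_nhds
  · intro A B hAB
    have h1 := (hL _ (hI A) 1).2.add (hL _ (hI B) 1).2
    refine tendsto_nhds_unique (hL _ (hI (A ∪ B)) 1).2 (h1.congr fun n => ?_)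
    have h2 : (A ∪ B).indicator (fun _ => (1 : ℝ)) = fun y =>
        A.indicator (fun _ => (1 : ℝ)) y + B.indicator (fun _ => (1 : ℝ)) y :=
      Set.indicator_union_of_disjoint hAB _
    rw [h2]
    simp only [cesaro, iterate_avgR_add hμ (hI A) (hI B), Finset.sum_add_distrib, add_div]
  · intro g A
    rw [← hconst _ (hI A) g]
    refine tendsto_nhds_unique (hL _ (hI _) 1).2 ((hL _ (hI A) g).2.congr fun n => ?_)
    have h2 : ((fun x => g * x) ⁻¹' A).indicator (fun _ => (1 : ℝ)) = fun y =>
        A.indicator (fun _ => (1 : ℝ)) (g * y) := rfl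
    rw [h2]
    simp only [cesaro, iterate_avgR_translate, mul_one]

/-- A retraction of a group onto a subgroup commuting with left multiplication. -/
theorem exists_retraction (H : Subgroup G) : ∃ r : G → H, ∀ (h : H) (g : G), r (h * g) = h * r g := by
  let rep : G → G := fun g => (Quotient.mk (QuotientGroup.rightRel H) g).out
  have hrep : ∀ g, g * (rep g)⁻¹ ∈ H := fun g => by
    have : (QuotientGroup.rightRel H) (rep g) g := Quotient.mk_out (s := QuotientGroup.rightRel H) g
    exact QuotientGroup.rightRel_apply.1 this
  refine ⟨fun g => ⟨g * (rep g)⁻¹, hrep g⟩, fun h g => ?_⟩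
  have : rep (h * g) = rep g := by
    simp only [rep]
    congr 1
    refine Quotient.sound (s := QuotientGroup.rightRel H) ?_
    refine QuotientGroup.rightRel_apply.2 ?_
    rw [mul_inv_rev, mul_inv_cancel_left]
    exact H.inv_mem h.2
  apply Subtype.ext
  simp [this, mul_assoc]

theorem InvMean.subgroup (m : InvMean G) (H : Subgroup G) : Nonempty (InvMean H) := by
  obtain ⟨r, hr⟩ := exists_retraction H
  refine ⟨⟨fun A => m.m (r ⁻¹' A), fun A => m.nonneg _, m.univ, fun A B hAB => ?_, fun g A => ?_⟩⟩
  · rw [Set.preimage_union]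
    exact m.union _ _ (hAB.preimage r)
  · rw [← m.inv g (r ⁻¹' A)]
    congr 1
    ext x
    simp [hr]

end Mean

open Filter Topology

section Poisson

theorem exists_poisson {Q : Type*} [Group Q] [Fintype Q] {p : Q → ℝ} (hp : ∀ q, 0 < p q)
    (hp1 : ∑ q, p q = 1) {d : Q → ℝ} (hd : ∑ q, d q = 0) :
    ∃ β : Q → ℝ, ∀ q, β q - ∑ q', p q' * β (q * q'⁻¹) = d q := by
  have hsum : ∀ β : Q → ℝ, ∑ q, ∑ q', p q' * β (q * q'⁻¹) = ∑ q, β q := by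
    intro β
    rw [Finset.sum_comm]
    simp_rw [← Finset.mul_sum]
    have : ∀ q' : Q, ∑ q, β (q * q'⁻¹) = ∑ q, β q := fun q' =>
      Equiv.sum_comp (Equiv.mulRight q'⁻¹) β
    simp_rw [this, ← Finset.sum_mul, hp1, one_mul]
  let T : (Q → ℝ) →ₗ[ℝ] (Q → ℝ) :=
    { toFun := fun β q => β q - ∑ q', p q' * β (q * q'⁻¹) + ∑ q', β q'
      map_add' := fun β γ => by
        funext q
        simp only [Pi.add_apply, mul_add, Finset.sum_add_distrib]; ring
      map_smul' := fun c β => by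
        funext q
        simp only [Pi.smul_apply, smul_eq_mul, RingHom.id_apply, mul_left_comm _ c,
          ← Finset.mul_sum]
        ring }
  have hT : ∀ β q, T β q = β q - ∑ q', p q' * β (q * q'⁻¹) + ∑ q', β q' := fun _ _ => rfl
  have hTsum : ∀ β, ∑ q, T β q = Fintype.card Q * ∑ q, β q := by
    intro β
    simp only [hT, Finset.sum_add_distrib, Finset.sum_sub_distrib, hsum]
    simp
  have hcard : (Fintype.card Q : ℝ) ≠ 0 := by exact_mod_cast Fintype.card_ne_zero
  have hinj : Function.Injective T := by
    rw [injective_iff_map_eq_zero]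
    intro β hβ
    have h0 : ∑ q, β q = 0 := by
      have := hTsum β
      rw [hβ] at this
      simpa [hcard] using this.symm
    have h1 : ∀ q, β q = ∑ q', p q' * β (q * q'⁻¹) := fun q => by
      have := congrFun hβ q
      rw [hT, h0, Pi.zero_apply] at this
      linarith
    obtain ⟨m, hm⟩ := Finite.exists_max β
    have h2 : ∀ q, β q = β m := by
      have h3 : ∑ q', p q' * (β m - β (m * q'⁻¹)) = 0 := by
        simp only [mul_sub, Finset.sum_sub_distrib, ← Finset.sum_mul, hp1, ← h1]; ring
      rw [Finset.sum_eq_zero_iff_of_nonneg fun q' _ =>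
        mul_nonneg (hp q').le (sub_nonneg.2 (hm _))] at h3
      intro q
      have h4 := h3 (q⁻¹ * m) (Finset.mem_univ _)
      have h5 : m * (q⁻¹ * m)⁻¹ = q := by group
      rw [h5] at h4
      rcases mul_eq_zero.1 h4 with h | h
      · exact absurd h (hp _).ne'
      · linarith
    simp only [h2, Finset.sum_const, Finset.card_univ, nsmul_eq_mul] at h0
    funext q
    rw [h2, Pi.zero_apply]
    exact (mul_eq_zero.1 h0).resolve_left hcard
  obtain ⟨β, hβ⟩ := LinearMap.injective_iff_surjective.1 hinj d
  have h0 : ∑ q, β q = 0 := by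
    have := hTsum β
    rw [hβ, hd] at this
    simpa [hcard] using this.symm
  refine ⟨β, fun q => ?_⟩
  have := congrFun hβ q
  rw [hT, h0] at this
  linarith

variable {G : Type*} [Group G] {ℓ μ : G → ℝ} {ζ : ℝ}

theorem Nice.hasSum_finite_quotient (hμ : Nice ℓ μ ζ) (H : Subgroup G) [H.Normal]
    [Fintype (G ⧸ H)] : ∃ p : G ⧸ H → ℝ, (∀ q, 0 < p q) ∧ ∑ q, p q = 1 ∧
      ∀ (β : G ⧸ H → ℝ) (q : G ⧸ H),
        HasSum (fun s : G => μ s * β (q * (s : G ⧸ H)⁻¹)) (∑ q', p q' * β (q * q'⁻¹)) := by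
  classical
  have hs : ∀ q : G ⧸ H, Summable fun s : G => if (s : G ⧸ H) = q then μ s else 0 := fun q =>
    Summable.of_nonneg_of_le (fun s => by split_ifs <;> [exact (hμ.pos s).le; exact le_rfl])
      (fun s => by split_ifs <;> [exact le_rfl; exact (hμ.pos s).le]) hμ.hasSum.summable
  have key : ∀ (β : G ⧸ H → ℝ) (q : G ⧸ H), HasSum (fun s : G => μ s * β (q * (s : G ⧸ H)⁻¹))
      (∑ q', (∑' s : G, if (s : G ⧸ H) = q' then μ s else 0) * β (q * q'⁻¹)) := by
    intro β q
    have := hasSum_sum (s := Finset.univ) fun (q' : G ⧸ H) _ =>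
      ((hs q').hasSum).mul_right (β (q * q'⁻¹))
    refine this.congr_fun fun s => ?_
    rw [Finset.sum_eq_single (s : G ⧸ H)]
    · simp
    · intro b _ hb
      simp [hb.symm]
    · simp
  refine ⟨_, fun q => ?_, ?_, key⟩
  · obtain ⟨x, rfl⟩ := QuotientGroup.mk_surjective q
    exact (hs _).tsum_pos (fun s => by split_ifs <;> [exact (hμ.pos s).le; exact le_rfl]) x
      (by simpa using hμ.pos x)
  · have := key (fun _ => 1) 1
    simp only [mul_one] at this
    exact this.unique hμ.hasSum

/-- A quasi-homomorphism-like function can be corrected by a function on a finite quotient to become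
harmonic. -/
theorem exists_harmonic_correction (hμ : Nice ℓ μ ζ) (H : Subgroup G) [H.Normal] [H.FiniteIndex]
    {h0 : G → ℝ} {φ : G → ℝ} (hφ : ∀ y ∈ H, ∀ x, h0 (y * x) = φ y + h0 x) {K : ℝ}
    (hK : ∀ x s, |h0 (x * s⁻¹) - h0 x| ≤ K * ℓ s) :
    ∃ β : G ⧸ H → ℝ, ∀ x : G, HasSum (fun s => μ s * (h0 (x * s⁻¹) + β ↑(x * s⁻¹))) (h0 x + β x) := by
  classical
  have : Fintype (G ⧸ H) := Fintype.ofFinite _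
  obtain ⟨p, hp, hp1, hpβ⟩ := hμ.hasSum_finite_quotient H
  set D : G → G → ℝ := fun x s => h0 (x * s⁻¹) - h0 x with hD
  have hDinv : ∀ x y s : G, (x : G ⧸ H) = (y : G ⧸ H) → D x s = D y s := by
    intro x y s hxy
    have h1 : x * y⁻¹ ∈ H := by
      have h2 := QuotientGroup.eq.1 hxy.symm
      have h3 := ‹H.Normal›.conj_mem _ h2 y
      simpa [mul_assoc] using h3
    have h2 : ∀ z, h0 (x * z) = φ (x * y⁻¹) + h0 (y * z) := fun z => by
      rw [← hφ _ h1]; congr 1; group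
    have h3 := h2 1
    rw [mul_one, mul_one] at h3
    simp only [hD, h2, h3]; ring
  have hsum : ∀ x, Summable fun s => μ s * D x s := fun x => by
    have h1 := (summable_linear_of_exp hμ.len (fun x => (hμ.pos x).le) hμ.pos_exp hμ.summable).mul_left |K|
    refine Summable.of_norm_bounded h1 fun s => ?_
    rw [norm_mul, Real.norm_eq_abs, Real.norm_eq_abs, abs_of_pos (hμ.pos s)]
    have := hK x s
    have h2 := hμ.len.nonneg s
    have h3 : |D x s| ≤ |K| * (1 + ℓ s) := by
      refine this.trans ?_
      nlinarith [le_abs_self K, abs_nonneg K, mul_le_mul_of_nonneg_right (le_abs_self K) h2]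
    nlinarith [mul_le_mul_of_nonneg_left h3 (hμ.pos s).le]
  set d : G ⧸ H → ℝ := fun q => ∑' s, μ s * D q.out s with hd
  have hdx : ∀ x : G, HasSum (fun s => μ s * D x s) (d x) := fun x => by
    have h1 : ∀ s, D x s = D (x : G ⧸ H).out s := fun s => hDinv _ _ _ (by simp)
    simp only [h1]
    exact (hsum _).hasSum
  have hd0 : ∑ q, d q = 0 := by
    set E : G → ℝ := fun s => ∑ q : G ⧸ H, D q.out s with hE
    have h1 : HasSum (fun s => μ s * E s) (∑ q, d q) := by
      have := hasSum_sum (s := Finset.univ) fun (q : G ⧸ H) _ => (hsum q.out).hasSum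
      refine this.congr_fun fun s => ?_
      rw [hE, Finset.mul_sum]
    have h2 : ∀ s, E s⁻¹ = - E s := by
      intro s
      simp only [hE, ← Finset.sum_neg_distrib]
      refine (Equiv.sum_comp (Equiv.mulRight (s : G ⧸ H)⁻¹) _).symm.trans
        (Finset.sum_congr rfl fun q _ => ?_)
      have h3 : D ((Equiv.mulRight (s : G ⧸ H)⁻¹) q).out s⁻¹ = D (q.out * s⁻¹) s⁻¹ :=
        hDinv _ _ _ (by simp)
      rw [h3]
      simp [hD]
    have h3 : HasSum (fun s => μ s * E s) (- ∑ q, d q) := by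
      have := ((Equiv.inv G).hasSum_iff.2 h1).neg
      refine this.congr_fun fun s => ?_
      simp [hμ.symm, h2]
    have := h1.unique h3
    linarith
  obtain ⟨β, hβ⟩ := exists_poisson hp hp1 hd0
  refine ⟨β, fun x => ?_⟩
  have h1 := ((hdx x).add (hμ.hasSum.mul_right (h0 x))).add (hpβ β x)
  have h2 : d x + 1 * h0 x + ∑ q', p q' * β (x * q'⁻¹) = h0 x + β x := by
    linarith [hβ x]
  rw [h2] at h1
  refine h1.congr_fun fun s => ?_
  simp only [hD, QuotientGroup.mk_mul, QuotientGroup.mk_inv]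
  ring

end Poisson

/-- The length function dominates the word length of a finite set. -/
def WordDom {G : Type*} [Group G] (ℓ : G → ℝ) : Prop :=
  ∃ S : Finset G, ∀ x, ∃ l : List G, (∀ s ∈ l, s ∈ S) ∧ l.prod = x ∧ (l.length : ℝ) ≤ ℓ x

theorem infinite_dim_of_twisted {G : Type*} [Group G] (N : Subgroup G) {ι : Type*} [Infinite ι]
    (Θ : ι → N →* ℂ) (hΘ : Function.Injective Θ) (f : ι → G → ℂ) (hf : ∀ i, ∃ x, f i x ≠ 0)
    (hft : ∀ i (t : N) x, f i (t * x) = Θ i t * f i x) (W : Submodule ℂ (G → ℂ))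
    [FiniteDimensional ℂ W] (hW : ∀ i, f i ∈ W) : False := by
  have hLI : LinearIndependent ℂ f := by
    rw [linearIndependent_iff']
    intro s c hc i hi
    obtain ⟨x, hx⟩ := hf i
    have h1 : LinearIndependent ℂ (fun i => (Θ i : N → ℂ)) :=
      (linearIndependent_monoidHom N ℂ).comp Θ hΘ
    rw [linearIndependent_iff'] at h1
    have h2 := h1 s (fun i => c i * f i x) (by
      funext t
      have := congrFun hc (t * x)
      simp only [Finset.sum_apply, Pi.smul_apply, smul_eq_mul, hft, Pi.zero_apply] at this ⊢
      rw [← this]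
      exact Finset.sum_congr rfl fun j _ => by ring) i hi
    exact (mul_eq_zero.1 h2).resolve_right hx
  have h3 : LinearIndependent ℂ (fun i => (⟨f i, hW i⟩ : W)) :=
    LinearIndependent.of_comp W.subtype hLI
  have := h3.finite
  exact not_finite ι

/-- An absolute value together with a character of the additive group which is continuous for it
and which is not trivial on dilations of a suitable element by a finitely generated group. -/
structure Place {F : Type*} [Field F] (α : Fˣ) where
  v : AbsoluteValue F ℝ
  χ : F → ℂ
  χ_add : ∀ x y, χ (x + y) = χ x * χ y
  χ_norm : ∀ x, ‖χ x‖ = 1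
  v_ne_one : v α ≠ 1
  C : ℝ
  χ_le : ∀ x, ‖χ x - 1‖ ≤ C * v x
  kill : ∀ Γ : Subgroup Fˣ, Γ.FG → α ∈ Γ → ∃ γ ∈ Γ, ∃ ε : ℝ, 0 < ε ∧ ∀ w : ℝ, ∃ X : Finset Fˣ,
    (∀ u ∈ X, u ∈ Γ) ∧ ∀ u ∈ Γ, |Real.log (v (u : F))| ≤ w →
      ∃ u' ∈ X, (χ ((u * u'⁻¹ * γ : Fˣ) : F)).re ≤ 1 - ε

section Cocycle

variable {G : Type*} [Group G] {F : Type*} [Field F]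

theorem exists_retraction_one (H : Subgroup G) :
    ∃ r : G → H, (∀ (h : H) (g : G), r (h * g) = h * r g) ∧ r 1 = 1 := by
  obtain ⟨r, hr⟩ := exists_retraction H
  exact ⟨fun x => r x * (r 1)⁻¹, fun h g => by simp only [hr, mul_assoc], by simp⟩

/-- Exponential growth of an affine cocycle along a retraction. -/
theorem exists_cocycle_bound {ℓ : G → ℝ} (hdom : WordDom ℓ) {H : Subgroup G} [H.FiniteIndex]
    {r : G → H} (hr : ∀ (h : H) (g : G), r (h * g) = h * r g)
    (a : H →* Fˣ) {b : H → F} (hb : ∀ x y, b (x * y) = b x + a x * b y) (v : AbsoluteValue F ℝ) :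
    ∃ K : ℝ, 0 ≤ K ∧ ∀ x s, |Real.log (v (a ((r x)⁻¹ * r (x * s))))| ≤ K * ℓ s ∧
      v (b ((r x)⁻¹ * r (x * s))) ≤ Real.exp (K * ℓ s) := by
  obtain ⟨S, hS⟩ := hdom
  set σ : G → G → H := fun x s => (r x)⁻¹ * r (x * s) with hσ
  have hσmul : ∀ x s t, σ x (s * t) = σ x s * σ (x * s) t := fun x s t => by
    simp only [hσ, mul_assoc, mul_inv_cancel_left]
  have hσH : ∀ (y : H) x s, σ (y * x) s = σ x s := fun y x s => by
    simp only [hσ, mul_assoc, hr]; group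
  have hfin : (Set.range fun p : G × S => σ p.1 p.2).Finite := by
    have h1 : (Set.range fun x : G => ((r x : G)⁻¹ * x)).Finite := by
      have : Finite (Quotient (QuotientGroup.rightRel H)) :=
        Finite.of_equiv _ (QuotientGroup.quotientRightRelEquivQuotientLeftRel H).symm
      refine (Set.finite_range fun q : Quotient (QuotientGroup.rightRel H) =>
        ((r q.out : G)⁻¹ * q.out)).subset ?_
      rintro _ ⟨x, rfl⟩
      refine ⟨Quotient.mk _ x, ?_⟩
      have h2 : (QuotientGroup.rightRel H) (Quotient.mk (QuotientGroup.rightRel H) x).out x :=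
        Quotient.mk_out x
      rw [QuotientGroup.rightRel_apply] at h2
      set z := (Quotient.mk (QuotientGroup.rightRel H) x).out
      have h3 : x = (⟨x * z⁻¹, h2⟩ : H) * z := by simp
      have h4 : r x = ⟨x * z⁻¹, h2⟩ * r z := by rw [← hr]; simp
      simp only [h4]
      simp [mul_assoc]
      rfl
    refine ((h1.prod S.finite_toSet).image fun p => σ p.1 p.2).subset ?_
    rintro _ ⟨⟨x, s⟩, rfl⟩
    refine ⟨((r x : G)⁻¹ * x, s), ⟨⟨x, rfl⟩, s.2⟩, ?_⟩
    exact hσH (r x)⁻¹ x s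
  obtain ⟨B, hB⟩ := (hfin.image fun y => |Real.log (v (a y))| + v (b y)).bddAbove
  have hB' : ∀ x, ∀ s ∈ S, |Real.log (v (a (σ x s)))| + v (b (σ x s)) ≤ B := fun x s hs =>
    hB ⟨_, ⟨(x, ⟨s, hs⟩), rfl⟩, rfl⟩
  set B' := max B 1 with hB1
  have hB1' : 1 ≤ B' := le_max_right _ _
  have hvpos : ∀ u : Fˣ, 0 < v u := fun u => v.pos u.ne_zero
  have hb1 : b 1 = 0 := by
    have := hb 1 1
    simpa using this
  have key : ∀ l : List G, (∀ s ∈ l, s ∈ S) → ∀ x,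
      |Real.log (v (a (σ x l.prod)))| ≤ 2 * B' * l.length ∧
      v (b (σ x l.prod)) ≤ Real.exp (2 * B' * l.length) := by
    intro l
    induction l with
    | nil => intro _ x; simp [hσ, hb1]
    | cons s l ih =>
      intro hl x
      obtain ⟨h1, h2⟩ := ih (fun t ht => hl t (List.mem_cons_of_mem _ ht)) (x * s)
      have h3 := hB' x s (hl s (by simp))
      have h4 : |Real.log (v (a (σ x s)))| ≤ B' := by
        linarith [v.nonneg (b (σ x s)), le_max_left B 1]
      have h5 : v (b (σ x s)) ≤ B' := by
        linarith [abs_nonneg (Real.log (v (a (σ x s)))), le_max_left B 1]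
      rw [List.prod_cons, hσmul, List.length_cons]
      push_cast
      constructor
      · rw [map_mul, Units.val_mul, map_mul, Real.log_mul (hvpos _).ne' (hvpos _).ne']
        refine (abs_add_le _ _).trans ?_
        nlinarith
      · rw [hb]
        refine (v.add_le _ _).trans ?_
        rw [map_mul]
        have h6 : v (a (σ x s)) ≤ Real.exp B' := by
          rw [← Real.exp_log (hvpos (a (σ x s)))]
          exact Real.exp_le_exp.2 ((le_abs_self _).trans h4)
        have h7 : B' + 1 ≤ Real.exp B' := Real.add_one_le_exp _
        have h8 : (1 : ℝ) ≤ Real.exp (2 * B' * l.length) := Real.one_le_exp (by positivity)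
        have h9 : Real.exp (2 * B' * (l.length + 1)) =
            Real.exp B' * Real.exp B' * Real.exp (2 * B' * l.length) := by
          rw [← Real.exp_add, ← Real.exp_add]; congr 1; ring
        rw [h9]
        set P := Real.exp (2 * B' * l.length)
        set A := Real.exp B'
        have h10 : v (a (σ x s)) * v (b (σ (x * s) l.prod)) ≤ A * P :=
          mul_le_mul h6 h2 (v.nonneg _) (by positivity)
        have h11 : B' ≤ A * P := by nlinarith
        have h12 : 2 * (A * P) ≤ A * (A * P) := by
          apply mul_le_mul_of_nonneg_right _ (by positivity); linarith
        nlinarith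
  refine ⟨2 * B', by positivity, fun x s => ?_⟩
  obtain ⟨l, hl, rfl, hlen⟩ := hS s
  obtain ⟨h1, h2⟩ := key l hl x
  have h3 : 2 * B' * l.length ≤ 2 * B' * ℓ l.prod := by gcongr
  exact ⟨h1.trans h3, h2.trans (Real.exp_le_exp.2 h3)⟩

theorem min_two_le {A E ρ : ℝ} (hA2 : A ≤ 2) (hA : A ≤ Real.exp E) (hρ0 : 0 ≤ ρ) (hρ1 : ρ ≤ 1) :
    A ≤ 2 * Real.exp (ρ * E) := by
  rcases le_total 0 E with h | h
  · have := Real.one_le_exp (mul_nonneg hρ0 h)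
    linarith
  · have h1 : Real.exp E ≤ Real.exp (ρ * E) := Real.exp_le_exp.2 (by nlinarith)
    have := Real.exp_pos (ρ * E)
    linarith

theorem WordDom.one_le {ℓ : G → ℝ} (hdom : WordDom ℓ) {s : G} (hs : s ≠ 1) : 1 ≤ ℓ s := by
  obtain ⟨S, hS⟩ := hdom
  obtain ⟨l, -, rfl, hl⟩ := hS s
  rcases l with _ | ⟨t, l⟩
  · simp at hs
  · refine le_trans ?_ hl
    simp

end Cocycle

section Main

variable {G : Type*} [Group G] {F : Type*} [Field F] {ℓ μ : G → ℝ} {ζ : ℝ}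

theorem false_of_cocycle (hμ : Nice ℓ μ ζ) (hFD : FD ℓ μ) (hdom : WordDom ℓ)
    (H : Subgroup G) [H.Normal] [H.FiniteIndex] (hH : Group.FG H)
    (a : H →* Fˣ) (b : H → F) (hb : ∀ x y, b (x * y) = b x + a x * b y)
    (t₀ : H) (hat : a t₀ = 1) (hbt : b t₀ = 1) (τ : H) (P : Place (a τ)) : False := by
  classical
  obtain ⟨v, χ, χ_add, χ_norm, v_ne_one, C, χ_le, kill⟩ := P
  obtain ⟨r, hr, hr1⟩ := exists_retraction_one H
  obtain ⟨K, hK0, hK⟩ := exists_cocycle_bound hdom hr a hb v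
  have hvpos : ∀ u : Fˣ, 0 < v u := fun u => v.pos u.ne_zero
  have hvmul : ∀ u w : Fˣ, Real.log (v ((u * w : Fˣ) : F)) = Real.log (v u) + Real.log (v w) :=
    fun u w => by rw [Units.val_mul, map_mul, Real.log_mul (hvpos _).ne' (hvpos _).ne']
  have hb1 : b 1 = 0 := by simpa using hb 1 1
  have hrs : ∀ x s, r (x * s) = r x * ((r x)⁻¹ * r (x * s)) := fun x s => by group
  have hrH : ∀ t : H, r t = t := fun t => by have := hr t 1; rwa [mul_one, hr1, mul_one] at this
  set h0 : G → ℝ := fun x => -Real.log (v (a (r x))) with hh0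
  have hh0φ : ∀ (y : H) x, h0 (y * x) = -Real.log (v (a y)) + h0 x := fun y x => by
    simp only [hh0, hr, map_mul a, hvmul]; ring
  have hh0lip : ∀ x s, |h0 (x * s⁻¹) - h0 x| ≤ K * ℓ s := fun x s => by
    have h1 := (hK x s⁻¹).1
    rw [hμ.len.inv] at h1
    simp only [hh0]
    rw [hrs x s⁻¹, map_mul a, hvmul, ← abs_neg]
    convert h1 using 2
    ring
  obtain ⟨β, hβ⟩ := exists_harmonic_correction hμ H (φ := fun x => h0 x)
    (fun y hy x => by rw [hh0φ ⟨y, hy⟩ x]; simp only [hh0]; rw [hrH ⟨y, hy⟩]) hh0lip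
  set h : G → ℝ := fun x => h0 x + β x with hh
  obtain ⟨B, hB⟩ : ∃ B, ∀ q, |β q| ≤ B := by
    obtain ⟨m, hm⟩ := Finite.exists_max fun q => |β q|
    exact ⟨_, hm⟩
  have hB0 : 0 ≤ B := (abs_nonneg _).trans (hB 1)
  set ψ : G → ℂ := fun x => χ (b (r x)) with hψ
  set N : Subgroup G := a.ker.map H.subtype with hN
  have hmemN : ∀ t : G, t ∈ N ↔ ∃ ht : t ∈ H, a ⟨t, ht⟩ = 1 := fun t => by
    simp [hN, MonoidHom.mem_ker]
  have hcosetH : ∀ t ∈ H, ∀ x : G, ((t * x : G) : G ⧸ H) = x := fun t ht x => by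
    rw [QuotientGroup.mk_mul, (QuotientGroup.eq_one_iff t).2 ht, one_mul]
  have hψN : ∀ t ∈ N, ∀ x, ψ (t * x) = ψ t * ψ x := fun t ht x => by
    obtain ⟨ht, hat⟩ := (hmemN t).1 ht
    simp only [hψ]
    have h1 := hr ⟨t, ht⟩ x
    have h2 := hrH ⟨t, ht⟩
    simp only at h1 h2
    rw [h1, h2, hb, hat, χ_add]; simp
  have hhN : ∀ t ∈ N, ∀ x, h (t * x) = h x := fun t ht x => by
    obtain ⟨ht, hat⟩ := (hmemN t).1 ht
    simp only [hh]
    rw [hcosetH t ht, hh0φ ⟨t, ht⟩ x, hat]; simp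
  set L : ℝ := -Real.log (v (a τ)) with hL
  have hL0 : L ≠ 0 := by
    rw [hL, neg_ne_zero]
    exact Real.log_ne_zero_of_pos_of_ne_one (hvpos _) v_ne_one
  -- the finite set of coset representatives
  have hcfin : (Set.range fun x : G => ((r x : G)⁻¹ * x)).Finite := by
    refine ((Set.finite_range fun q : G ⧸ H => ((r q.out : G)⁻¹ * q.out))).subset ?_
    rintro _ ⟨x, rfl⟩
    refine ⟨(x : G ⧸ H), ?_⟩
    have h2 : ((x : G ⧸ H).out : G ⧸ H) = x := by simp
    set z := (x : G ⧸ H).out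
    have h3 : x * z⁻¹ ∈ H := by
      have := ‹H.Normal›.conj_mem _ (QuotientGroup.eq.1 h2) z
      simpa [mul_assoc] using this
    have h4 : r x = ⟨x * z⁻¹, h3⟩ * r z := by rw [← hr]; simp
    simp only [h4]
    simp [mul_assoc]
    rfl
  set R := hcfin.toFinset with hR
  have hRx : ∀ x, ((r x : G)⁻¹ * x) ∈ R := fun x => by simp [hR]
  obtain ⟨ρ, hρ0, hρ1, hρK⟩ : ∃ ρ : ℝ, 0 < ρ ∧ ρ ≤ 1 ∧ ρ * K ≤ ζ / 2 := by
    have hζ := hμ.pos_exp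
    refine ⟨min 1 (ζ / 2 / (K + 1)), by positivity, min_le_left _ _, ?_⟩
    have h1 := min_le_right 1 (ζ / 2 / (K + 1))
    calc _ ≤ ζ / 2 / (K + 1) * (K + 1) := by gcongr; linarith
      _ = _ := by field_simp
  obtain ⟨c₀, hc₀⟩ : ∃ c₀ : ℝ, C ≤ Real.exp c₀ := ⟨C, by linarith [Real.add_one_le_exp C]⟩
  have hflat : ∀ x s, ‖ψ (x * s⁻¹) - ψ x‖ ≤
      2 * Real.exp (ρ * (c₀ + B)) * Real.exp (-ρ * h x + ζ / 2 * ℓ s) := fun x s => by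
    have h1 := (hK x s⁻¹).2
    rw [hμ.len.inv] at h1
    set σ := (r x)⁻¹ * r (x * s⁻¹) with hσ
    have h2 : ψ (x * s⁻¹) - ψ x = ψ x * (χ (a (r x) * b σ) - 1) := by
      simp only [hψ]
      rw [hrs x s⁻¹, hb, χ_add]; ring
    have h3 : ‖ψ (x * s⁻¹) - ψ x‖ = ‖χ (a (r x) * b σ) - 1‖ := by
      rw [h2, norm_mul, χ_norm, one_mul]
    have h4 : ‖ψ (x * s⁻¹) - ψ x‖ ≤ 2 := by
      refine (norm_sub_le _ _).trans ?_
      rw [χ_norm, χ_norm]; norm_num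
    have h5 : ‖ψ (x * s⁻¹) - ψ x‖ ≤ Real.exp (c₀ + B - h x + K * ℓ s) := by
      rw [h3]
      refine (χ_le _).trans ?_
      rw [map_mul]
      have h6 : v (a (r x)) ≤ Real.exp (B - h x) := by
        rw [← Real.exp_log (hvpos (a (r x)))]
        refine Real.exp_le_exp.2 ?_
        simp only [hh, hh0]
        linarith [(abs_le.1 (hB x)).2]
      calc C * (v (a (r x)) * v (b σ)) ≤ Real.exp c₀ * (Real.exp (B - h x) * Real.exp (K * ℓ s)) :=
            mul_le_mul hc₀ (mul_le_mul h6 h1 (v.nonneg _) (Real.exp_pos _).le)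
              (mul_nonneg (v.nonneg _) (v.nonneg _)) (Real.exp_pos _).le
        _ = _ := by rw [← Real.exp_add, ← Real.exp_add]; congr 1; ring
    refine (min_two_le h4 h5 hρ0.le hρ1).trans ?_
    rw [mul_assoc, ← Real.exp_add]
    gcongr
    nlinarith [hμ.len.nonneg s]
  have hlip : ∀ x s, |h (x * s⁻¹) - h x| ≤ (K + 2 * B) * ℓ s := fun x s => by
    by_cases hs : s = 1
    · subst hs; simp [hμ.len.one]
    · have h1 := hdom.one_le hs
      have h2 := hh0lip x s
      have h3 : h (x * s⁻¹) - h x = (h0 (x * s⁻¹) - h0 x) + (β ↑(x * s⁻¹) - β x) := by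
        simp only [hh]; ring
      have h4 := abs_sub (β ↑(x * s⁻¹)) (β x)
      have h5 := hB ↑(x * s⁻¹)
      have h6 := hB x
      rw [h3]
      refine (abs_add_le _ _).trans ?_
      nlinarith
  have hkill : ∀ w, ∃ ε > 0, ∃ T : Finset G, ∀ x, |h x| ≤ w → ∃ t ∈ T, x * t * x⁻¹ ∈ N ∧
      (ψ (x * t * x⁻¹)).re ≤ 1 - ε := by
    intro w
    have hfg : a.range.FG := by
      rw [← Group.fg_iff_subgroup_fg]
      exact Group.fg_range a
    obtain ⟨γ, hγ, ε, hε, hX⟩ := kill a.range hfg ⟨τ, rfl⟩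
    obtain ⟨X, hXΓ, hX⟩ := hX (w + B)
    have hy : ∀ u : Fˣ, ∃ y : H, u ∈ X → a y = u⁻¹ * γ := fun u => by
      by_cases hu : u ∈ X
      · obtain ⟨y, hy⟩ := a.range.mul_mem (a.range.inv_mem (hXΓ u hu)) hγ
        exact ⟨y, fun _ => hy⟩
      · exact ⟨1, fun h => absurd h hu⟩
    choose y hy using hy
    refine ⟨ε, hε, (R ×ˢ X).image fun p => p.1⁻¹ * (y p.2 * t₀ * (y p.2)⁻¹ : H) * p.1,
      fun x hx => ?_⟩
    have h1 : |Real.log (v (a (r x)))| ≤ w + B := by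
      have h2 : Real.log (v (a (r x))) = β x - h x := by simp only [hh, hh0]; ring
      rw [h2]
      have h4 := abs_sub (β x) (h x)
      linarith [hB x]
    obtain ⟨u, hu, huχ⟩ := hX _ ⟨r x, rfl⟩ h1
    refine ⟨_, Finset.mem_image.2 ⟨((r x : G)⁻¹ * x, u), Finset.mem_product.2 ⟨hRx x, hu⟩, rfl⟩, ?_⟩
    set g : H := r x * y u with hg
    have h5 : x * (((r x : G)⁻¹ * x)⁻¹ * (y u * t₀ * (y u)⁻¹ : H) * ((r x : G)⁻¹ * x)) * x⁻¹ =
        (g * t₀ * g⁻¹ : H) := by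
      simp only [hg]; push_cast; group
    simp only
    rw [h5]
    have h6 : a (g * t₀ * g⁻¹) = 1 := by simp [hat]
    refine ⟨(hmemN _).2 ⟨(g * t₀ * g⁻¹).2, h6⟩, ?_⟩
    have h7 : b (g * t₀ * g⁻¹) = a g := by
      have h8 : b g + a g * b g⁻¹ = 0 := by rw [← hb, mul_inv_cancel, hb1]
      rw [mul_assoc, hb g, hb t₀, hat, hbt]
      simp only [Units.val_one, one_mul, mul_add, mul_one]
      linear_combination h8
    simp only [hψ]
    rw [hrH, h7, hg, map_mul, hy u hu]
    rwa [← mul_assoc]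
  have hvar : ∀ x, ∃ s ∈ R.image (fun c : G => (c⁻¹ * (τ : G) * c)⁻¹), h (x * s⁻¹) = h x + L := fun x => by
    refine ⟨_, Finset.mem_image.2 ⟨_, hRx x, rfl⟩, ?_⟩
    rw [inv_inv]
    have h1 : x * (((r x : G)⁻¹ * x)⁻¹ * τ * ((r x : G)⁻¹ * x)) =
        (r x * τ * (r x)⁻¹ : H) * x := by
      push_cast; group
    rw [h1]
    simp only [hh]
    rw [hcosetH _ (r x * τ * (r x)⁻¹).2, hh0φ]
    simp only [map_mul a, hvmul, map_inv, hL]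
    have h2 := hvmul (a (r x)) (a (r x))⁻¹
    simp only [mul_inv_cancel, Units.val_one, map_one, Real.log_one] at h2
    linarith
  obtain ⟨f, hfH, ⟨C', hC'⟩, hfN⟩ := exists_equivariant_harmonic hμ
    (h := h) (ψ := ψ) (C := max (K + 2 * B) (2 * Real.exp (ρ * (c₀ + B)))) (c := ρ) (by positivity) hρ0
    (fun x s => (hlip x s).trans (mul_le_mul_of_nonneg_right (le_max_left _ _) (hμ.len.nonneg s))) hβ hL0 _ hvar
    (fun x => χ_norm _) (fun x s => (hflat x s).trans (mul_le_mul_of_nonneg_right (le_max_right _ _) (Real.exp_pos _).le))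
    N ψ hψN hhN hkill
  have hτpow : ∀ (k : ℤ), h (τ ^ k : H) = k * L + β 1 := fun k => by
    simp only [hh]
    have h1 := hh0φ (τ ^ k) 1
    have h2 : ∀ k : ℤ, Real.log (v ((a τ ^ k : Fˣ) : F)) = k * Real.log (v (a τ)) := fun k => by
      rw [Units.val_zpow_eq_zpow_val, map_zpow₀, Real.log_zpow]
    have h3 : h0 1 = 0 := by simp [hh0, hr1]
    rw [mul_one, h3, map_zpow, h2] at h1
    rw [h1, (QuotientGroup.eq_one_iff _).2 (τ ^ k).2, hL]; ring
  have hfne : ∃ x, f x ≠ 0 := by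
    by_contra! hf0
    have h1 : ∀ x, max (h x) 0 ≤ C' := fun x => by
      have h2 := hC' x
      rw [hf0, zero_sub, norm_neg, norm_mul, χ_norm, mul_one, Complex.norm_real, Real.norm_eq_abs] at h2
      exact (le_abs_self _).trans h2
    have h2 : ∀ k : ℤ, k * L ≤ C' - β 1 := fun k => by
      have := (le_max_left _ _).trans (h1 (τ ^ k : H))
      rw [hτpow] at this
      linarith
    obtain ⟨n, hn⟩ := exists_nat_gt ((C' - β 1) / |L|)
    rw [div_lt_iff₀ (abs_pos.2 hL0)] at hn
    rcases le_total 0 L with h3 | h3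
    · have := h2 n
      rw [abs_of_nonneg h3] at hn
      push_cast at this; linarith
    · have := h2 (-n)
      rw [abs_of_nonpos h3] at hn
      push_cast at this; linarith
  obtain ⟨x₀, hx₀⟩ := hfne
  obtain ⟨W, hW, hWmem⟩ := hFD
  have hconj : ∀ (k : ℤ) (t : N), (τ : G) ^ k * t * ((τ : G) ^ k)⁻¹ ∈ N := fun k t => by
    obtain ⟨ht, hat⟩ := (hmemN t).1 t.2
    refine (hmemN _).2 ⟨H.mul_mem (H.mul_mem (H.zpow_mem τ.2 k) ht) (H.inv_mem (H.zpow_mem τ.2 k)), ?_⟩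
    have h1 : (⟨(τ : G) ^ k * t * ((τ : G) ^ k)⁻¹, H.mul_mem (H.mul_mem (H.zpow_mem τ.2 k) ht)
      (H.inv_mem (H.zpow_mem τ.2 k))⟩ : H) = τ ^ k * ⟨t, ht⟩ * (τ ^ k)⁻¹ := by
      ext; simp
    rw [h1]; simp [hat]
  let Θ : ℤ → N →* ℂ := fun k =>
    { toFun := fun t => ψ ((τ : G) ^ k * t * ((τ : G) ^ k)⁻¹)
      map_one' := by
        have h1 : χ 0 = 1 := by
          have h2 := χ_add 0 0
          have h3 : χ 0 ≠ 0 := fun h => by have := χ_norm 0; rw [h] at this; simp at this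
          rw [add_zero] at h2
          exact (mul_eq_left₀ h3).1 h2.symm
        simp [hψ, hr1, hb1, h1]
      map_mul' := fun s t => by
        rw [← hψN _ (hconj k s)]
        congr 1
        push_cast; group }
  have hΘ : ∀ k t, Θ k t = ψ ((τ : G) ^ k * t * ((τ : G) ^ k)⁻¹) := fun _ _ => rfl
  have hΘχ : ∀ (k : ℤ) (t : G) (ht : t ∈ H) (hat : a ⟨t, ht⟩ = 1), Θ k ⟨t, (hmemN t).2 ⟨ht, hat⟩⟩ =
      χ ((a τ : F) ^ k * b ⟨t, ht⟩) := fun k t ht hat => by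
    have h1 : (τ : G) ^ k * t * ((τ : G) ^ k)⁻¹ = (τ ^ k * ⟨t, ht⟩ * (τ ^ k)⁻¹ : H) := by simp
    rw [hΘ]
    simp only
    rw [h1]
    simp only [hψ]
    rw [hrH]
    congr 1
    have h8 : b (τ ^ k) + a (τ ^ k) * b (τ ^ k)⁻¹ = 0 := by rw [← hb, mul_inv_cancel, hb1]
    rw [mul_assoc, hb (τ ^ k), hb ⟨t, ht⟩, hat, ← Units.val_zpow_eq_zpow_val, ← map_zpow]
    simp only [Units.val_one, one_mul, mul_add]
    linear_combination h8
  have hinj : Function.Injective Θ := by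
    intro i j hij
    by_contra hne
    set d := j - i with hd
    have hd0 : d ≠ 0 := sub_ne_zero.2 (Ne.symm hne)
    have hstep : ∀ k t, Θ (k + d) t = Θ k t := by
      intro k t
      have h1 := DFunLike.congr_fun hij ⟨_, hconj (k - i) t⟩
      rw [hΘ, hΘ] at h1 ⊢
      convert h1.symm using 2
      · simp only [hd]; group
      · simp only; group
    have hall : ∀ (n : ℕ) t, Θ (n * d) t = Θ 0 t ∧ Θ (-(n * d)) t = Θ 0 t := by
      intro n t
      induction n with
      | zero => simp
      | succ n ih =>
        push_cast
        constructor
        · rw [← ih.1, ← hstep (n * d)]; congr 2; ring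
        · rw [← ih.2, ← hstep (-((n + 1) * d))]; congr 2; ring
    have hone : ∀ t, Θ 0 t = 1 := by
      rintro ⟨t, ht⟩
      obtain ⟨ht', hat⟩ := (hmemN t).1 ht
      have h1 : ∀ n : ℕ, ‖Θ 0 ⟨t, ht⟩ - 1‖ ≤ C * v (b ⟨t, ht'⟩) * (v (a τ) ^ d) ^ n ∧
          ‖Θ 0 ⟨t, ht⟩ - 1‖ ≤ C * v (b ⟨t, ht'⟩) * (v (a τ) ^ (-d)) ^ n := fun n => by
        constructor
        · rw [← (hall n ⟨t, ht⟩).1, hΘχ _ t ht' hat]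
          refine (χ_le _).trans (le_of_eq ?_)
          rw [map_mul, map_zpow₀, mul_comm (n : ℤ) d, zpow_mul, zpow_natCast]; ring
        · rw [← (hall n ⟨t, ht⟩).2, hΘχ _ t ht' hat]
          refine (χ_le _).trans (le_of_eq ?_)
          rw [map_mul, map_zpow₀, mul_comm (n : ℤ) d, ← neg_mul, zpow_mul, zpow_natCast]; ring
      have h2 : ∀ q : ℝ, 0 ≤ q → q < 1 → (∀ n : ℕ, ‖Θ 0 ⟨t, ht⟩ - 1‖ ≤ C * v (b ⟨t, ht'⟩) * q ^ n) →
          Θ 0 ⟨t, ht⟩ = 1 := fun q hq0 hq hle => by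
        have h3 : Tendsto (fun n : ℕ => C * v (b ⟨t, ht'⟩) * q ^ n) atTop (𝓝 0) := by
          simpa using (tendsto_pow_atTop_nhds_zero_of_lt_one hq0 hq).const_mul (C * v (b ⟨t, ht'⟩))
        have h4 := ge_of_tendsto' h3 hle
        exact sub_eq_zero.1 (norm_le_zero_iff.1 h4)
      have hv := hvpos (a τ)
      have hne : v (a τ) ^ d ≠ 1 := fun h => by
        exact hd0 ((zpow_eq_one_iff_right₀ hv.le v_ne_one).1 h)
      rcases lt_or_gt_of_ne hne with h | h
      · exact h2 _ (by positivity) h fun n => (h1 n).1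
      · refine h2 (v (a τ) ^ (-d)) (by positivity) ?_ fun n => (h1 n).2
        rw [zpow_neg]
        exact inv_lt_one_of_one_lt₀ h
    obtain ⟨ε, hε, T, hT⟩ := hkill |h 1|
    obtain ⟨t, -, htN, hre⟩ := hT 1 le_rfl
    have := hone ⟨_, htN⟩
    rw [hΘ] at this
    simp only [zpow_zero, inv_one, one_mul, mul_one] at this hre
    rw [this, Complex.one_re] at hre
    linarith
  refine infinite_dim_of_twisted N Θ hinj (fun k x => f ((τ : G) ^ k * x)) (fun k =>
    ⟨((τ : G) ^ k)⁻¹ * x₀, by simpa using hx₀⟩) (fun k t x => ?_) W (fun k => ?_)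
  · rw [hΘ, ← hfN _ (hconj k t)]
    congr 1; group
  · have hfle : ∀ x, ‖f x‖ ≤ |h 1| + (K + 2 * B) * ℓ x + C' := fun x => by
      have h1 := hC' x
      have h2 := hlip 1 x⁻¹
      rw [inv_inv, one_mul, hμ.len.inv] at h2
      have h3 : ‖f x‖ ≤ ‖f x - ((max (h x) 0 : ℝ) : ℂ) * ψ x‖ + ‖((max (h x) 0 : ℝ) : ℂ) * ψ x‖ :=
        norm_le_norm_sub_add _ _
      rw [norm_mul, χ_norm, mul_one, Complex.norm_real, Real.norm_eq_abs,
        abs_of_nonneg (le_max_right _ _)] at h3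
      have h4 : max (h x) 0 ≤ |h 1| + (K + 2 * B) * ℓ x := by
        have h5 : |h 1| + (K + 2 * B) * ℓ x ≥ |h x| := by
          have := abs_sub_abs_le_abs_sub (h x) (h 1)
          linarith
        exact max_le ((le_abs_self _).trans h5) ((abs_nonneg _).trans h5)
      linarith
    have hC'0 : 0 ≤ C' := (norm_nonneg _).trans (hC' 1)
    refine hWmem _ (|h 1| + (K + 2 * B) * ℓ ((τ : G) ^ k) + C' + (K + 2 * B)) (fun x => ?_) fun x => ?_
    · refine (hfle _).trans ?_
      have h1 := hμ.len.mul_le ((τ : G) ^ k) x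
      have h2 := hμ.len.nonneg x
      have h3 := hμ.len.nonneg ((τ : G) ^ k)
      have h4 : (K + 2 * B) * ℓ ((τ : G) ^ k * x) ≤ (K + 2 * B) * (ℓ ((τ : G) ^ k) + ℓ x) := by gcongr
      have h5 : 0 ≤ (|h 1| + (K + 2 * B) * ℓ ((τ : G) ^ k) + C') * ℓ x := by positivity
      have h6 : 0 ≤ K + 2 * B := by positivity
      nlinarith
    · refine (hfH ((τ : G) ^ k * x)).congr_fun fun s => ?_
      simp only [mul_assoc]

end Main

section Place

theorem Place.comap {F L : Type*} [Field F] [Field L] (f : F →+* L) {α : Fˣ} {β : Lˣ}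
    (hβ : f α = β) (P : Place β) : Nonempty (Place α) := by
  classical
  have hβ' : Units.map (f : F →* L) α = β := Units.ext hβ
  have hinj : Function.Injective (Units.map (f : F →* L)) := Units.map_injective f.injective
  refine ⟨⟨P.v.comp f.injective, fun x => P.χ (f x), fun x y => by rw [map_add, P.χ_add],
    fun x => P.χ_norm _, ?_, P.C, fun x => P.χ_le _, ?_⟩⟩
  · show P.v (f α) ≠ 1
    rw [hβ]; exact P.v_ne_one
  · intro Γ hΓ hα
    obtain ⟨_, ⟨γ, hγ, rfl⟩, ε, hε, h⟩ := P.kill (Γ.map (Units.map (f : F →* L))) (by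
        obtain ⟨S, hS⟩ := hΓ
        exact ⟨S.image _, by rw [Finset.coe_image, ← MonoidHom.map_closure, hS]⟩)
      ⟨α, hα, hβ'⟩
    refine ⟨γ, hγ, ε, hε, fun w => ?_⟩
    obtain ⟨X, hX, h⟩ := h w
    refine ⟨X.preimage _ hinj.injOn, fun u hu => ?_, fun u hu hw => ?_⟩
    · obtain ⟨u', hu', he⟩ := hX _ (Finset.mem_preimage.1 hu)
      rwa [← hinj he]
    · obtain ⟨u', hu', hre⟩ := h (Units.map (f : F →* L) u) ⟨u, hu, rfl⟩ hw
      obtain ⟨u'', -, rfl⟩ := hX _ hu'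
      refine ⟨u'', Finset.mem_preimage.2 hu', ?_⟩
      rwa [← map_inv, ← map_mul, ← map_mul] at hre

theorem nonempty_place_complex (α : ℂˣ) (hα : ‖(α : ℂ)‖ ≠ 1) : Nonempty (Place α) := by
  classical
  have hpos : ∀ u : ℂˣ, 0 < ‖(u : ℂ)‖ := fun u => norm_pos_iff.2 u.ne_zero
  set χ : ℂ → ℂ := fun y => Complex.exp ((y.re : ℝ) * Complex.I) with hχ
  have hre : ∀ y, (χ y).re = Real.cos y.re := fun y => Complex.exp_ofReal_mul_I_re _
  refine ⟨⟨NormedField.toAbsoluteValue ℂ, χ, fun x y => ?_, fun x => Complex.norm_exp_ofReal_mul_I _,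
    hα, 1, fun x => ?_, ?_⟩⟩
  · simp only [hχ]
    rw [← Complex.exp_add]; congr 1; simp; ring
  · rw [one_mul]
    refine le_trans ?_ (Complex.abs_re_le_norm x)
    have := Real.norm_exp_I_mul_ofReal_sub_one_le (x := x.re)
    rwa [mul_comm] at this
  · intro Γ _ hαΓ
    obtain ⟨δ, hδΓ, hδ⟩ : ∃ δ ∈ Γ, ‖(δ : ℂ)‖ < 1 := by
      rcases lt_or_gt_of_ne hα with h | h
      · exact ⟨α, hαΓ, h⟩
      · refine ⟨α⁻¹, Γ.inv_mem hαΓ, ?_⟩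
        rw [Units.val_inv_eq_inv_val, norm_inv]
        exact inv_lt_one_of_one_lt₀ h
    obtain ⟨γ, hγΓ, hγ, hγ0⟩ : ∃ γ ∈ Γ, ‖(γ : ℂ)‖ < 1 ∧ (γ : ℂ).re ≠ 0 := by
      by_cases h : (δ : ℂ).re = 0
      · refine ⟨δ * δ, Γ.mul_mem hδΓ hδΓ, ?_, ?_⟩
        · rw [Units.val_mul, norm_mul]
          exact mul_lt_one_of_nonneg_of_lt_one_left (norm_nonneg _) hδ hδ.le
        · rw [Units.val_mul, Complex.mul_re, h]
          intro h0
          have h1 : (δ : ℂ).im = 0 := by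
            have : (δ : ℂ).im * (δ : ℂ).im = 0 := by linarith
            exact mul_self_eq_zero.1 this
          exact δ.ne_zero (Complex.ext h h1)
      · exact ⟨δ, hδΓ, hδ, h⟩
    have hcos : Real.cos (γ : ℂ).re < 1 := by
      refine lt_of_le_of_ne (Real.cos_le_one _) fun h => hγ0 ?_
      have h1 := (Complex.abs_re_le_norm (γ : ℂ)).trans_lt hγ
      have h2 := abs_lt.1 h1
      exact (Real.cos_eq_one_iff_of_lt_of_lt (by linarith [Real.pi_gt_three])
        (by linarith [Real.pi_gt_three])).1 h
    set ε := (1 - Real.cos (γ : ℂ).re) / 2 with hε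
    have hε0 : 0 < ε := by rw [hε]; linarith
    refine ⟨γ, hγΓ, ε, hε0, fun w => ?_⟩
    have hcont : Continuous fun z : ℂ => Real.cos (z * (γ : ℂ)).re := by fun_prop
    have hev : ∀ᶠ z in 𝓝 (1 : ℂ), Real.cos (z * (γ : ℂ)).re < 1 - ε := by
      refine (hcont.tendsto 1).eventually_lt_const ?_
      rw [one_mul, hε]; linarith
    obtain ⟨η, hη, hball⟩ := Metric.eventually_nhds_iff.1 hev
    set A : Set ℂ := {z | ∃ u ∈ Γ, (u : ℂ) = z ∧ |Real.log ‖(u : ℂ)‖| ≤ w} with hA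
    have hlog : ∀ u : ℂˣ, |Real.log ‖(u : ℂ)‖| ≤ w → Real.exp (-w) ≤ ‖(u : ℂ)‖ ∧ ‖(u : ℂ)‖ ≤ Real.exp w := by
      intro u hu
      obtain ⟨h1, h2⟩ := abs_le.1 hu
      exact ⟨(Real.le_log_iff_exp_le (hpos u)).1 h1, (Real.log_le_iff_le_exp (hpos u)).1 h2⟩
    have htb : TotallyBounded A := by
      refine (ProperSpace.isCompact_closedBall (0 : ℂ) (Real.exp w)).totallyBounded.subset ?_
      rintro _ ⟨u, -, rfl, hu⟩
      rw [mem_closedBall_zero_iff]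
      exact (hlog u hu).2
    obtain ⟨t, htA, htf, ht⟩ := Metric.finite_approx_of_totallyBounded htb (η * Real.exp (-w))
      (by positivity)
    have hinj : Function.Injective (fun u : ℂˣ => (u : ℂ)) := Units.val_injective
    refine ⟨(htf.preimage hinj.injOn).toFinset, fun u hu => ?_, fun u hu hw => ?_⟩
    · have hu0 : (u : ℂ) ∈ t := by simpa using hu
      obtain ⟨u', hu', h, -⟩ := htA hu0
      rwa [← hinj h]
    · have h1 := ht ⟨u, hu, rfl, hw⟩
      simp only [Set.mem_iUnion, Metric.mem_ball] at h1
      obtain ⟨y, hy, hdist⟩ := h1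
      obtain ⟨u', hu', rfl, hw'⟩ := htA hy
      refine ⟨u', by simpa using hy, ?_⟩
      rw [hre]
      have h2 : dist ((u : ℂ) * (u' : ℂ)⁻¹) 1 < η := by
        have h3 : (u : ℂ) * (u' : ℂ)⁻¹ - 1 = (u - u') * (u' : ℂ)⁻¹ := by
          rw [sub_mul, mul_inv_cancel₀ u'.ne_zero]
        rw [dist_eq_norm, h3, norm_mul, norm_inv, ← div_eq_mul_inv, div_lt_iff₀ (hpos u')]
        rw [dist_eq_norm] at hdist
        exact hdist.trans_le (by gcongr; exact (hlog u' hw').1)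
      have := hball h2
      rw [Units.val_mul, Units.val_mul, Units.val_inv_eq_inv_val]
      exact this.le

theorem exists_circle_character {A : Type*} [AddCommGroup A] {x : A} (hx : x ≠ 0) :
    ∃ χ : A → ℂ, (∀ x y, χ (x + y) = χ x * χ y) ∧ (∀ x, ‖χ x‖ = 1) ∧ χ x ≠ 1 := by
  obtain ⟨c, hc⟩ := CharacterModule.exists_character_apply_ne_zero_of_ne_zero hx
  have key : ∀ y : AddCircle (1 : ℚ), ∃ q : ℚ, (q : AddCircle (1 : ℚ)) = y := fun y =>
    QuotientAddGroup.mk_surjective y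
  choose q hq using key
  have hexp : ∀ p q : ℚ, (p : AddCircle (1 : ℚ)) = q ↔
      Complex.exp (((2 * Real.pi * p : ℝ) : ℂ) * Complex.I) =
      Complex.exp (((2 * Real.pi * q : ℝ) : ℂ) * Complex.I) := by
    intro p q
    rw [Complex.exp_eq_exp_iff_exists_int, QuotientAddGroup.eq, AddSubgroup.mem_zmultiples_iff]
    constructor
    · rintro ⟨k, hk⟩
      refine ⟨-k, ?_⟩
      have : (q : ℂ) = p + k := by
        have h : q = p + k := by simp at hk; linarith
        rw [h]; push_cast; rfl
      push_cast; rw [this]; ring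
    · rintro ⟨k, hk⟩
      refine ⟨-k, ?_⟩
      have h2 : (p : ℂ) = q + k := by
        have h3 : (2 * Real.pi * Complex.I) * (p : ℂ) = (2 * Real.pi * Complex.I) * (q + k) := by
          push_cast at hk; linear_combination hk
        exact mul_left_cancel₀ Complex.two_pi_I_ne_zero h3
      have h3 : p = q + k := by exact_mod_cast h2
      rw [h3]; simp
  refine ⟨fun x => Complex.exp (((2 * Real.pi * q (c x) : ℝ) : ℂ) * Complex.I), fun x y => ?_,
    fun x => Complex.norm_exp_ofReal_mul_I _, fun h => hc ?_⟩
  · have h1 := (hexp (q (c (x + y))) (q (c x) + q (c y))).1 (by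
      rw [hq, AddCircle.coe_add, hq, hq, map_add])
    simp only
    rw [h1, ← Complex.exp_add]; congr 1; push_cast; ring
  · have h1 := (hexp (q (c x)) 0).2 (by simp only at h; rw [h]; simp)
    rw [hq] at h1
    rw [h1]; rfl

end Place

section Nonarchimedean

theorem CommGroup.finite_quotient_of_pow_mem {A : Type*} [CommGroup A] [Group.FG A] (D : Subgroup A)
    (h : ∀ u : A, ∃ n : ℕ, 0 < n ∧ u ^ n ∈ D) : Finite (A ⧸ D) := by
  have h1 : Group.FG (A ⧸ D) := Group.fg_of_surjective (QuotientGroup.mk'_surjective D)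
  have htors : IsMulTorsion (A ⧸ D) := by
    intro q
    obtain ⟨u, rfl⟩ := QuotientGroup.mk_surjective q
    rw [isOfFinOrder_iff_pow_eq_one]
    obtain ⟨n, hn, hu⟩ := h u
    exact ⟨n, hn, by rwa [← QuotientGroup.mk_pow, QuotientGroup.eq_one_iff]⟩
  exact @CommGroup.finite_of_fg_isMulTorsion _ _ h1 htors

variable {L Γ₀ : Type*} [Field L] [LinearOrderedCommGroupWithZero Γ₀]

theorem Valuation.map_eq_one_of_sub_one (w : Valuation L Γ₀) {x : L} (h : w (x - 1) < 1) :
    w x = 1 := by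
  have := w.map_add_eq_of_lt_right (x := x - 1) (y := 1) (by rwa [map_one])
  simpa using this

theorem Valuation.sub_one_mul (w : Valuation L Γ₀) {x y : L} (hx : w (x - 1) < 1)
    (hy : w (y - 1) < 1) : w (x * y - 1) < 1 := by
  have h : x * y - 1 = x * (y - 1) + (x - 1) := by ring
  rw [h]
  refine w.map_add_lt ?_ hx
  rwa [map_mul, w.map_eq_one_of_sub_one hx, one_mul]

theorem Valuation.sub_one_inv (w : Valuation L Γ₀) {x : L} (hx : w (x - 1) < 1) :
    w (x⁻¹ - 1) < 1 := by
  have h1 := w.map_eq_one_of_sub_one hx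
  have h0 : x ≠ 0 := by rintro rfl; simp at h1
  have h : x⁻¹ - 1 = -(x⁻¹ * (x - 1)) := by field_simp; ring
  rw [h, Valuation.map_neg, map_mul, map_inv₀, h1, inv_one, one_mul]
  exact hx

theorem Valuation.sub_one_pow (w : Valuation L Γ₀) {x : L} (hx : w (x - 1) < 1) (n : ℕ) :
    w (x ^ n - 1) < 1 := by
  induction n with
  | zero => simp
  | succ n ih => rw [pow_succ]; exact w.sub_one_mul ih hx

theorem Valuation.sub_one_zpow (w : Valuation L Γ₀) {x : L} (hx : w (x - 1) < 1) (n : ℤ) :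
    w (x ^ n - 1) < 1 := by
  obtain ⟨m, rfl | rfl⟩ := n.eq_nat_or_neg
  · rw [zpow_natCast]; exact w.sub_one_pow hx m
  · rw [zpow_neg, zpow_natCast]; exact w.sub_one_inv (w.sub_one_pow hx m)

/-- A valuation all of whose values are commensurable with that of `ϖ` has real values. -/
theorem Valuation.exists_absoluteValue (w : Valuation L Γ₀) {ϖ : L} (hϖ0 : ϖ ≠ 0)
    (hϖ : w ϖ < 1)
    (hK : ∀ u : L, u ≠ 0 → ∃ N : ℕ, 0 < N ∧ ∃ j : ℤ, w (u ^ N * ϖ ^ j - 1) < 1) :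
    ∃ v : AbsoluteValue L ℝ, ∀ x, v x ≤ 1 ↔ w x ≤ 1 := by
  classical
  have hw0 : 0 < w ϖ := by rw [zero_lt_iff]; exact (w.ne_zero_iff).2 hϖ0
  have hK' : ∀ u : L, ∃ N : ℕ, ∃ j : ℤ, 0 < N ∧ (u ≠ 0 → w u ^ N = w ϖ ^ j) := by
    intro u
    by_cases hu : u = 0
    · exact ⟨1, 0, one_pos, fun h => (h hu).elim⟩
    · obtain ⟨N, hN, j, hj⟩ := hK u hu
      refine ⟨N, -j, hN, fun _ => ?_⟩
      have := w.map_eq_one_of_sub_one hj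
      rw [map_mul, map_pow, map_zpow₀] at this
      rw [zpow_neg]
      exact eq_inv_of_mul_eq_one_left this
  choose N j hN hj using hK'
  have huniq : ∀ u, u ≠ 0 → ∀ (M : ℕ) (i : ℤ), 0 < M → w u ^ M = w ϖ ^ i →
      (i : ℝ) / M = j u / N u := by
    intro u hu M i hM h
    have h1 : w ϖ ^ (i * N u) = w ϖ ^ (j u * M) := by
      rw [zpow_mul, zpow_mul, ← h, ← hj u hu, zpow_natCast, zpow_natCast, ← pow_mul, ← pow_mul,
        mul_comm]
    have h2 : i * N u = j u * M := zpow_right_injective₀ hw0 hϖ.ne h1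
    have h3 : (0 : ℝ) < N u := by exact_mod_cast hN u
    have h4 : (0 : ℝ) < M := by exact_mod_cast hM
    rw [div_eq_div_iff h4.ne' h3.ne']
    exact_mod_cast h2
  set f : L → ℝ := fun u => if u = 0 then 0 else Real.exp (-(j u / N u : ℝ)) with hf
  have hf0 : f 0 = 0 := by simp [hf]
  have hfpos : ∀ u, u ≠ 0 → 0 < f u := fun u hu => by simp only [hf, if_neg hu]; positivity
  have hfnn : ∀ u, 0 ≤ f u := fun u => by
    by_cases hu : u = 0
    · rw [hu, hf0]
    · exact (hfpos u hu).le
  have hmul : ∀ x y, f (x * y) = f x * f y := by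
    intro x y
    by_cases hx : x = 0
    · simp [hx, hf0]
    by_cases hy : y = 0
    · simp [hy, hf0]
    simp only [hf, if_neg hx, if_neg hy, if_neg (mul_ne_zero hx hy)]
    have h := huniq (x * y) (mul_ne_zero hx hy) (N x * N y) (j x * N y + j y * N x)
      (mul_pos (hN x) (hN y)) (by
        rw [map_mul, mul_pow, pow_mul, hj x hx, mul_comm (N x), pow_mul, hj y hy,
          zpow_add₀ hw0.ne', zpow_mul, zpow_mul, zpow_natCast, zpow_natCast])
    rw [← h, ← Real.exp_add]
    congr 1
    have h3 : (0 : ℝ) < N x := by exact_mod_cast hN x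
    have h4 : (0 : ℝ) < N y := by exact_mod_cast hN y
    push_cast
    field_simp
    ring
  have hle : ∀ x, f x ≤ 1 ↔ w x ≤ 1 := by
    intro x
    by_cases hx : x = 0
    · simp [hx, hf0]
    simp only [hf, if_neg hx]
    have h3 : (0 : ℝ) < N x := by exact_mod_cast hN x
    rw [Real.exp_le_one_iff, neg_nonpos, le_div_iff₀ h3, zero_mul,
      ← pow_le_one_iff (hN x).ne', hj x hx, Int.cast_nonneg_iff]
    have := (zpow_right_strictAnti₀ hw0 hϖ).le_iff_ge (a := j x) (b := 0)
    rw [zpow_zero] at this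
    exact this.symm
  have hone : f 1 = 1 := by
    have := hmul 1 1
    rw [one_mul] at this
    exact (mul_eq_left₀ (hfpos 1 one_ne_zero).ne').1 this.symm
  have hadd1 : ∀ x y, w x ≤ w y → f (x + y) ≤ f x + f y := by
    intro x y hxy
    by_cases hy : y = 0
    · have : x = 0 := by
        rw [hy, map_zero, le_zero_iff, w.zero_iff] at hxy
        exact hxy
      simp [hy, this, hf0]
    · have h1 : w ((x + y) * y⁻¹) ≤ 1 := by
        rw [map_mul, map_inv₀, ← div_eq_mul_inv]
        refine div_le_one_of_le₀ ?_ zero_le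
        exact (w.map_add x y).trans (max_le hxy le_rfl)
      have h2 := (hle _).2 h1
      have h3 : f (x + y) = f ((x + y) * y⁻¹) * f y := by
        rw [← hmul, inv_mul_cancel_right₀ hy]
      rw [h3]
      nlinarith [hfnn x, hfnn y]
  refine ⟨⟨⟨f, hmul⟩, hfnn, fun x => ⟨fun h => ?_, fun h => by subst h; exact hf0⟩, fun x y => ?_⟩, hle⟩
  · by_contra hx
    exact (hfpos x hx).ne' h
  · rcases le_total (w x) (w y) with h | h
    · exact hadd1 x y h
    · have := hadd1 y x h
      rwa [add_comm, add_comm (f y)] at this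

theorem nonempty_place_of_valuation (w : Valuation L Γ₀) {ϖ : L} (hϖ0 : ϖ ≠ 0)
    (hϖ : w ϖ < 1)
    (hK : ∀ u : L, u ≠ 0 → ∃ N : ℕ, 0 < N ∧ ∃ j : ℤ, w (u ^ N * ϖ ^ j - 1) < 1)
    (z : Lˣ) (hz : 1 < w (z : L)) : Nonempty (Place z) := by
  classical
  obtain ⟨v, hv⟩ := w.exists_absoluteValue hϖ0 hϖ hK
  have hv1 : ∀ x, w x = 1 → v x = 1 := by
    intro x hx
    have hx0 : x ≠ 0 := by rintro rfl; simp at hx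
    refine le_antisymm ((hv x).2 hx.le) ?_
    have := (hv x⁻¹).2 (by rw [map_inv₀, hx, inv_one])
    rw [map_inv₀] at this
    exact (inv_le_one₀ (v.pos hx0)).1 this
  have hvz : 1 < v z := by
    by_contra h
    exact not_le.2 hz ((hv z).1 (not_lt.1 h))
  let M : AddSubgroup L :=
    { carrier := {x | w x < 1}
      add_mem' := fun {a b} ha hb => w.map_add_lt ha hb
      zero_mem' := by simp
      neg_mem' := fun {a} ha => by simpa using ha }
  have hM : ∀ x, x ∈ M ↔ w x < 1 := fun x => Iff.rfl
  have h1M : (QuotientAddGroup.mk (1 : L) : L ⧸ M) ≠ 0 := by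
    rw [Ne, QuotientAddGroup.eq_zero_iff, hM, map_one]
    exact lt_irrefl _
  obtain ⟨χ, hχa, hχn, hχ1⟩ := exists_circle_character h1M
  have hχ0 : χ 0 = 1 := by
    have := hχa 0 0
    rw [add_zero] at this
    have h0 : χ 0 ≠ 0 := by rw [← norm_ne_zero_iff, hχn]; exact one_ne_zero
    exact (mul_eq_left₀ h0).1 this.symm
  have hχM : ∀ x, w (x - 1) < 1 → χ (x : L ⧸ M) = χ ((1 : L) : L ⧸ M) := by
    intro x hx
    congr 1
    rw [eq_comm, QuotientAddGroup.eq, hM]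
    rwa [neg_add_eq_sub]
  refine ⟨⟨v, fun x => χ (x : L ⧸ M), fun x y => by rw [QuotientAddGroup.mk_add, hχa],
    fun x => hχn _, hvz.ne', 2, fun x => ?_, ?_⟩⟩
  · by_cases hx : w x < 1
    · have : ((x : L ⧸ M)) = 0 := (QuotientAddGroup.eq_zero_iff x).2 hx
      rw [this, hχ0, sub_self, norm_zero]
      exact mul_nonneg zero_le_two (v.nonneg x)
    · have h1 : 1 ≤ v x := by
        have hx0 : x ≠ 0 := by rintro rfl; simp at hx
        have := (hv x⁻¹).2 (by
          rw [map_inv₀]; exact inv_le_one_of_one_le₀ (not_lt.1 hx))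
        rw [map_inv₀] at this
        exact (inv_le_one₀ (v.pos hx0)).1 this
      calc ‖χ (x : L ⧸ M) - 1‖ ≤ ‖χ (x : L ⧸ M)‖ + ‖(1 : ℂ)‖ := norm_sub_le _ _
        _ = 2 := by rw [hχn, norm_one]; norm_num
        _ ≤ 2 * v x := by linarith
  intro Γ hΓ hzΓ
  have hre : (χ ((1 : L) : L ⧸ M)).re < 1 := by
    have h1 := Complex.re_le_norm (χ ((1 : L) : L ⧸ M))
    rw [hχn] at h1
    refine lt_of_le_of_ne h1 fun h => hχ1 ?_
    have h2 := Complex.sq_norm (χ ((1 : L) : L ⧸ M))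
    rw [hχn, Complex.normSq_apply, h] at h2
    have h3 : (χ ((1 : L) : L ⧸ M)).im = 0 := by
      have : (χ ((1 : L) : L ⧸ M)).im * (χ ((1 : L) : L ⧸ M)).im = 0 := by linarith
      exact mul_self_eq_zero.1 this
    exact Complex.ext h h3
  refine ⟨1, Γ.one_mem, 1 - (χ ((1 : L) : L ⧸ M)).re, by linarith, fun W => ?_⟩
  let D : Subgroup Γ :=
    { carrier := {u | ∃ e : ℤ, w (((u : Lˣ) : L) * (z : L) ^ e - 1) < 1}
      mul_mem' := by
        rintro a b ⟨e, he⟩ ⟨e', he'⟩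
        refine ⟨e + e', ?_⟩
        have := w.sub_one_mul he he'
        rw [zpow_add₀ z.ne_zero]
        convert this using 2
        push_cast
        ring
      one_mem' := ⟨0, by simp⟩
      inv_mem' := by
        rintro a ⟨e, he⟩
        refine ⟨-e, ?_⟩
        have := w.sub_one_inv he
        rw [zpow_neg]
        convert this using 2
        rw [mul_inv]
        simp }
  have hD : ∀ u, u ∈ D ↔ ∃ e : ℤ, w (((u : Lˣ) : L) * (z : L) ^ e - 1) < 1 := fun u => Iff.rfl
  have : Group.FG Γ := (Group.fg_iff_subgroup_fg Γ).2 hΓ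
  have : Finite (Γ ⧸ D) := by
    refine CommGroup.finite_quotient_of_pow_mem D fun u => ?_
    obtain ⟨N, hN, j, hj⟩ := hK ((u : Lˣ) : L) (u : Lˣ).ne_zero
    obtain ⟨P, hP, i, hi⟩ := hK (z : L) z.ne_zero
    have hi0 : i ≠ 0 := by
      rintro rfl
      have := w.map_eq_one_of_sub_one hi
      rw [zpow_zero, mul_one, map_pow] at this
      exact (one_lt_pow₀ hz hP.ne').ne' this
    have h1 := w.sub_one_mul (w.sub_one_zpow hj i) (w.sub_one_zpow hi (-j))
    have h2 : (((u : Lˣ) : L) ^ N * ϖ ^ j) ^ i * ((z : L) ^ P * ϖ ^ i) ^ (-j) =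
        ((u : Lˣ) : L) ^ (N * i) * (z : L) ^ (-(P * j)) := by
      rw [mul_zpow, mul_zpow, ← zpow_natCast, ← zpow_natCast, ← zpow_mul, ← zpow_mul, ← zpow_mul,
        ← zpow_mul]
      have : ϖ ^ (j * i) * ϖ ^ (i * -j) = 1 := by
        rw [← zpow_add₀ hϖ0]
        have : j * i + i * -j = 0 := by ring
        rw [this, zpow_zero]
      have h3 : (P : ℤ) * -j = -(P * j) := by ring
      rw [h3]
      linear_combination ((u : Lˣ) : L) ^ (N * i) * (z : L) ^ (-(P * j : ℤ)) * this
    rw [h2] at h1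
    refine ⟨N * i.natAbs, Nat.mul_pos hN (Int.natAbs_pos.2 hi0), ?_⟩
    have h3 : u ^ ((N : ℤ) * i) ∈ D := by
      rw [hD]
      exact ⟨-(P * j), by simpa using h1⟩
    rcases Int.natAbs_eq i with h | h
    · rw [h] at h3
      exact_mod_cast h3
    · rw [h, mul_neg, zpow_neg] at h3
      have := D.inv_mem h3
      rw [inv_inv] at this
      exact_mod_cast this
  let y : Γ ⧸ D → Γ := Quotient.out
  have hy : ∀ u : Γ, ∃ e : ℤ, w (((u * (y (u : Γ ⧸ D))⁻¹ : Γ) : Lˣ) * (z : L) ^ (-e) - 1) < 1 := by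
    intro u
    have h1 : (QuotientGroup.mk (u * (y (u : Γ ⧸ D))⁻¹) : Γ ⧸ D) = 1 := by
      rw [QuotientGroup.mk_mul, QuotientGroup.mk_inv]
      have : (QuotientGroup.mk (y (u : Γ ⧸ D)) : Γ ⧸ D) = u := Quotient.out_eq' _
      rw [this, mul_inv_cancel]
    rw [QuotientGroup.eq_one_iff, hD] at h1
    obtain ⟨e, he⟩ := h1
    exact ⟨-e, by rwa [neg_neg]⟩
  obtain ⟨B, hB⟩ : ∃ B : ℝ, ∀ q, |Real.log (v ((y q : Lˣ) : L))| ≤ B := by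
    obtain ⟨B, hB⟩ := (Set.finite_range fun q => |Real.log (v ((y q : Lˣ) : L))|).bddAbove
    exact ⟨B, fun q => hB ⟨q, rfl⟩⟩
  obtain ⟨E, hE⟩ := exists_nat_ge ((W + B) / Real.log (v z))
  let := Fintype.ofFinite (Γ ⧸ D)
  refine ⟨((Finset.univ : Finset (Γ ⧸ D)) ×ˢ Finset.Icc (-(E : ℤ)) E).image
    fun p => (y p.1 : Lˣ) * z ^ p.2, fun u hu => ?_, fun u hu hW => ?_⟩
  · obtain ⟨p, -, rfl⟩ := Finset.mem_image.1 hu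
    exact Γ.mul_mem (y p.1).2 (Γ.zpow_mem hzΓ _)
  · obtain ⟨e, he⟩ := hy ⟨u, hu⟩
    set q : Γ ⧸ D := ((⟨u, hu⟩ : Γ) : Γ ⧸ D) with hq
    have hlz : 0 < Real.log (v z) := Real.log_pos hvz
    have he1 : w (((u * ((y q : Lˣ) * z ^ e)⁻¹ : Lˣ) : L) - 1) < 1 := by
      convert he using 3
      push_cast
      rw [zpow_neg]
      field_simp
    have hvu : Real.log (v u) = Real.log (v ((y q : Lˣ) : L)) + e * Real.log (v z) := by
      have h1 := hv1 _ (w.map_eq_one_of_sub_one he1)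
      have h2 : (u : L) = ((u * ((y q : Lˣ) * z ^ e)⁻¹ : Lˣ) : L) * (((y q : Lˣ) : L) * (z : L) ^ e) := by
        rw [← Units.val_zpow_eq_zpow_val, ← Units.val_mul, ← Units.val_mul, inv_mul_cancel_right]
      rw [h2, map_mul, h1, one_mul, map_mul, map_zpow₀, Real.log_mul, Real.log_zpow]
      · exact v.ne_zero (Units.ne_zero _)
      · exact zpow_ne_zero _ (v.ne_zero z.ne_zero)
    have heE : |(e : ℝ)| ≤ E := by
      refine le_trans ?_ hE
      rw [le_div_iff₀ hlz]
      nth_rw 1 [← abs_of_pos hlz]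
      rw [← abs_mul]
      have : (e : ℝ) * Real.log (v z) = Real.log (v u) - Real.log (v ((y q : Lˣ) : L)) := by
        rw [hvu]; ring
      rw [this]
      exact (abs_sub _ _).trans (add_le_add hW (hB q))
    refine ⟨(y q : Lˣ) * z ^ e, Finset.mem_image.2 ⟨(q, e), ?_, rfl⟩, ?_⟩
    · rw [Finset.mem_product, Finset.mem_Icc]
      refine ⟨Finset.mem_univ _, ?_⟩
      obtain ⟨h1, h2⟩ := abs_le.1 heE
      exact ⟨by exact_mod_cast h1, by exact_mod_cast h2⟩
    · simp only [mul_one]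
      rw [hχM _ he1]
      linarith

end Nonarchimedean

section ResidueFinite

theorem Valuation.exists_eq_of_sum_eq_zero {L Γ₀ : Type*} [Field L]
    [LinearOrderedCommGroupWithZero Γ₀] (w : Valuation L Γ₀) {ι : Type*} (s : Finset ι)
    (f : ι → L) (h : ∑ i ∈ s, f i = 0) {i₀ : ι} (hi₀ : i₀ ∈ s) (hf : f i₀ ≠ 0) :
    ∃ i ∈ s, ∃ j ∈ s, i ≠ j ∧ f i ≠ 0 ∧ f j ≠ 0 ∧ w (f i) = w (f j) := by
  classical
  obtain ⟨i, hi, hmax⟩ := s.exists_max_image (fun i => w (f i)) ⟨i₀, hi₀⟩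
  have hwi : 0 < w (f i) := by
    refine lt_of_lt_of_le ?_ (hmax i₀ hi₀)
    rw [zero_lt_iff]; exact w.ne_zero_iff.2 hf
  by_contra hcon
  push Not at hcon
  have h1 := w.map_sum_eq_of_lt (f := f) hi (fun j hj => by
    rw [Finset.mem_sdiff, Finset.mem_singleton] at hj
    refine lt_of_le_of_ne (hmax j hj.1) fun he => ?_
    refine hcon i hi j hj.1 (Ne.symm hj.2) (w.ne_zero_iff.1 hwi.ne') ?_ he.symm
    rw [← w.ne_zero_iff, he]; exact hwi.ne')
  rw [h, map_zero] at h1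
  exact hwi.ne h1

theorem exists_pow_eq_one_of_isAlgebraic {k E : Type*} [Field k] [Finite k] [Field E] (f : k →+* E)
    (q : Polynomial k) (hq : q ≠ 0) {y : E} (hy : y ≠ 0) (h : q.eval₂ f y = 0) :
    ∃ N : ℕ, 0 < N ∧ y ^ N = 1 := by
  let _ := f.toAlgebra
  have halgint : IsIntegral k y := by
    rw [← isAlgebraic_iff_isIntegral]
    exact ⟨q, hq, h⟩
  have : FiniteDimensional k (IntermediateField.adjoin k {y}) :=
    IntermediateField.adjoin.finiteDimensional halgint
  have : Finite (IntermediateField.adjoin k {y}) := Module.finite_of_finite k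
  let y' : (IntermediateField.adjoin k {y})ˣ := Units.mk0
    ⟨y, IntermediateField.mem_adjoin_simple_self k y⟩ (fun h => hy (congrArg Subtype.val h))
  obtain ⟨N, hN, he⟩ := (isOfFinOrder_iff_pow_eq_one).1 (isOfFinOrder_of_finite y')
  refine ⟨N, hN, ?_⟩
  have := congrArg (fun u : (IntermediateField.adjoin k {y})ˣ => ((u : IntermediateField.adjoin k {y}) : E)) he
  simpa [y'] using this

theorem nonempty_place_of_not_isIntegral {D L : Type*} [CommRing D] [IsDomain D]
    [IsDiscreteValuationRing D] [Finite (IsLocalRing.ResidueField D)] [Field L] [Algebra D L]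
    (hinj : Function.Injective (algebraMap D L)) (halg : ∀ u : L, IsAlgebraic D u) (z : Lˣ)
    (hz : ¬ IsIntegral D (z : L)) : Nonempty (Place z) := by
  classical
  obtain ⟨V, hV, hzV⟩ := Subring.exists_le_valuationSubring_of_isIntegrallyClosedIn
    (R := (integralClosure D L).toSubring) (x := (z : L)) (by simpa [mem_integralClosure_iff] using hz)
  set w := V.valuation with hw
  have hD : ∀ d : D, algebraMap D L d ∈ V := fun d => hV (isIntegral_algebraMap (x := d))
  have hwD : ∀ d : D, w (algebraMap D L d) ≤ 1 := fun d => (V.valuation_le_one_iff _).2 (hD d)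
  have hwu : ∀ d : Dˣ, w (algebraMap D L d) = 1 := by
    intro d
    refine le_antisymm (hwD _) ?_
    have h1 := hwD (d⁻¹ : Dˣ)
    have h2 : w (algebraMap D L d) * w (algebraMap D L (d⁻¹ : Dˣ)) = 1 := by
      rw [← map_mul, ← map_mul, Units.mul_inv, map_one, map_one]
    calc (1 : _) = w (algebraMap D L d) * w (algebraMap D L (d⁻¹ : Dˣ)) := h2.symm
      _ ≤ w (algebraMap D L d) * 1 := by gcongr
      _ = _ := mul_one _
  have hwz : 1 < w z := by
    rw [← not_le, hw, V.valuation_le_one_iff]; exact hzV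
  obtain ⟨p, hp⟩ := IsDiscreteValuationRing.exists_irreducible D
  set ϖ := algebraMap D L p with hϖ
  have hϖ0 : ϖ ≠ 0 := by
    rw [hϖ, Ne, ← map_zero (algebraMap D L)]; exact fun h => hp.ne_zero (hinj h)
  have hval : ∀ d : D, d ≠ 0 → ∃ n : ℕ, w (algebraMap D L d) = w ϖ ^ n := by
    intro d hd
    obtain ⟨n, u, rfl⟩ := IsDiscreteValuationRing.eq_unit_mul_pow_irreducible hd hp
    exact ⟨n, by rw [map_mul, map_mul, hwu, one_mul, map_pow, map_pow]⟩
  -- every value is commensurable with that of the uniformizer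
  have hcomm : ∀ u : L, u ≠ 0 → ∃ N : ℕ, 0 < N ∧ ∃ j : ℤ, w (u ^ N * ϖ ^ j) = 1 := by
    intro u hu
    obtain ⟨P, hP0, hP⟩ := halg u
    rw [Polynomial.aeval_eq_sum_range] at hP
    have hlead : algebraMap D L P.leadingCoeff ≠ 0 := by
      rw [Ne, ← map_zero (algebraMap D L)]
      exact fun h => hP0 (Polynomial.leadingCoeff_eq_zero.1 (hinj h))
    have := w.exists_eq_of_sum_eq_zero _ _ hP (i₀ := P.natDegree) (by simp) (by
      rw [Algebra.smul_def]; exact mul_ne_zero hlead (pow_ne_zero _ hu))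
    have key : ∀ i j : ℕ, i < j → P.coeff i • u ^ i ≠ 0 → P.coeff j • u ^ j ≠ 0 →
        w (P.coeff i • u ^ i) = w (P.coeff j • u ^ j) →
        ∃ N : ℕ, 0 < N ∧ ∃ j : ℤ, w (u ^ N * ϖ ^ j) = 1 := by
      intro i j hij hi hj h
      have hci : P.coeff i ≠ 0 := fun h => hi (by rw [h, zero_smul])
      have hcj : P.coeff j ≠ 0 := fun h => hj (by rw [h, zero_smul])
      obtain ⟨m, hm⟩ := hval _ hci
      obtain ⟨n, hn⟩ := hval _ hcj
      refine ⟨j - i, by omega, (n : ℤ) - m, ?_⟩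
      rw [Algebra.smul_def, Algebra.smul_def, map_mul, map_mul, hm, hn, ← map_pow w ϖ m,
        ← map_pow w ϖ n, ← map_mul, ← map_mul] at h
      have hne : w (ϖ ^ m * u ^ i) ≠ 0 :=
        w.ne_zero_iff.2 (mul_ne_zero (pow_ne_zero _ hϖ0) (pow_ne_zero _ hu))
      have h3 : u ^ (j - i) * ϖ ^ ((n : ℤ) - m) * (ϖ ^ m * u ^ i) = ϖ ^ n * u ^ j := by
        rw [zpow_sub₀ hϖ0, zpow_natCast, zpow_natCast]
        have : u ^ j = u ^ (j - i) * u ^ i := by rw [← pow_add]; congr 1; omega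
        rw [this]
        field_simp
      have h4 : w (u ^ (j - i) * ϖ ^ ((n : ℤ) - m)) * w (ϖ ^ m * u ^ i) = w (ϖ ^ m * u ^ i) := by
        rw [← map_mul, h3, h]
      exact (mul_eq_right₀ hne).1 h4
    obtain ⟨i, -, j, -, hij, hi, hj, he⟩ := this
    rcases lt_or_gt_of_ne hij with h | h
    · exact key i j h hi hj he
    · exact key j i h hj hi he.symm
  have hϖ1 : w ϖ < 1 := by
    refine lt_of_le_of_ne (hwD p) fun h => ?_
    obtain ⟨N, hN, j, hj⟩ := hcomm z z.ne_zero
    rw [map_mul, map_pow, map_zpow₀, h, one_zpow, mul_one] at hj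
    exact (one_lt_pow₀ hwz hN.ne').ne' hj
  have hunit : ∀ d : D, w (algebraMap D L d) = 1 → IsUnit d := by
    intro d h
    have hd : d ≠ 0 := by rintro rfl; simp at h
    obtain ⟨n, u, rfl⟩ := IsDiscreteValuationRing.eq_unit_mul_pow_irreducible hd hp
    rw [map_mul, map_mul, hwu, one_mul, map_pow, map_pow] at h
    rcases Nat.eq_zero_or_pos n with rfl | hn
    · simp
    · exact ((pow_lt_one₀ zero_le hϖ1 hn.ne').ne h).elim
  let g : D →+* V := (algebraMap D L).codRestrict V.toSubring hD
  have hg : IsLocalHom g := ⟨fun d hd => hunit d (by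
    have h1 : g d ∉ IsLocalRing.maximalIdeal V := by
      rw [IsLocalRing.mem_maximalIdeal, mem_nonunits_iff, not_not]; exact hd
    rw [V.valuation_lt_one_iff, not_lt] at h1
    exact le_antisymm (hwD d) h1)⟩
  have hres : ∀ y : L, w y = 1 → ∃ N : ℕ, 0 < N ∧ w (y ^ N - 1) < 1 := by
    intro y hy
    obtain ⟨P, hP0, hP⟩ := halg y
    have hCp : ¬ IsUnit (Polynomial.C p) := by
      rw [Polynomial.isUnit_C]; exact hp.not_isUnit
    obtain ⟨Q, hQ, hpQ⟩ := (FiniteMultiplicity.of_not_isUnit hCp hP0).exists_eq_pow_mul_and_not_dvd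
    rw [hQ, map_mul, map_pow, Polynomial.aeval_C] at hP
    have hQy : Polynomial.aeval y Q = 0 := (mul_eq_zero.1 hP).resolve_left (pow_ne_zero _ hϖ0)
    let yV : V := ⟨y, (V.valuation_le_one_iff y).1 hy.le⟩
    have hy0 : IsLocalRing.residue V yV ≠ 0 := by
      rw [Ne, IsLocalRing.residue_eq_zero_iff, V.valuation_lt_one_iff]
      exact hy.not_lt
    obtain ⟨N, hN, he⟩ := exists_pow_eq_one_of_isAlgebraic (IsLocalRing.ResidueField.map g)
      (Q.map (IsLocalRing.residue D)) (fun h0 => hpQ (by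
        rw [Polynomial.C_dvd_iff_dvd_coeff]
        intro i
        have h1 := congrArg (fun q => Polynomial.coeff q i) h0
        simp only [Polynomial.coeff_map, Polynomial.coeff_zero] at h1
        rwa [IsLocalRing.residue_eq_zero_iff, hp.maximalIdeal_eq, Ideal.mem_span_singleton] at h1)) hy0 (by
        rw [Polynomial.eval₂_map]
        have h1 : (IsLocalRing.ResidueField.map g).comp (IsLocalRing.residue D) =
          (IsLocalRing.residue V).comp g := RingHom.ext fun d => IsLocalRing.ResidueField.map_residue g d
        rw [h1, ← Polynomial.hom_eval₂]
        have h2 : Q.eval₂ g yV = 0 := by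
          apply Subtype.ext
          have h3 := Polynomial.hom_eval₂ Q g V.subtype yV
          exact h3.trans hQy
        rw [h2, map_zero])
    refine ⟨N, hN, ?_⟩
    have h1 : IsLocalRing.residue V (yV ^ N - 1) = 0 := by
      rw [map_sub, map_pow, he, map_one, sub_self]
    rw [IsLocalRing.residue_eq_zero_iff, V.valuation_lt_one_iff] at h1
    exact h1
  refine nonempty_place_of_valuation w hϖ0 hϖ1 (fun u hu => ?_) z hwz
  obtain ⟨N, hN, j, hj⟩ := hcomm u hu
  obtain ⟨M, hM, he⟩ := hres _ hj
  refine ⟨N * M, Nat.mul_pos hN hM, j * M, ?_⟩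
  rwa [mul_pow, ← pow_mul, ← zpow_natCast (ϖ ^ j), ← zpow_mul] at he

end ResidueFinite

section Embedding

open Polynomial

theorem exists_algHom_of_countable (R F L : Type*) [CommRing R] [IsDomain R] [Countable R]
    [Field F] [Countable F] [Field L] [IsAlgClosed L] [Uncountable L] [Algebra R F] [Algebra R L]
    [FaithfulSMul R F] [FaithfulSMul R L] : Nonempty (F →ₐ[R] L) := by
  obtain ⟨B, hB⟩ := exists_isTranscendenceBasis R F
  obtain ⟨B', hB'⟩ := exists_isTranscendenceBasis R L
  have hR : Cardinal.mk R ≤ Cardinal.aleph0 := Cardinal.mk_le_aleph0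
  have hL : Cardinal.aleph0 < Cardinal.mk L := Cardinal.aleph0_lt_mk
  have hcard := IsAlgClosed.cardinal_eq_cardinal_transcendence_basis_of_aleph0_lt _ hB' hR hL
  have : Infinite B' := by
    rw [Cardinal.infinite_iff]
    simp only [Cardinal.lift_id] at hcard
    exact hcard ▸ hL.le
  have : Countable B := inferInstance
  obtain ⟨f, hf⟩ := exists_injective_nat B
  let e : B → B' := fun b => Infinite.natEmbedding B' (f b)
  have he : Function.Injective e := (Infinite.natEmbedding B').injective.comp hf
  have hind := hB'.1.comp e he
  set A := Algebra.adjoin R (Set.range (Subtype.val : B → F)) with hA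
  let g : A →ₐ[R] L := (MvPolynomial.aeval ((Subtype.val : B' → L) ∘ e)).comp
    (hB.1.aevalEquiv.symm : A →ₐ[R] MvPolynomial B R)
  have hg : Function.Injective g := by
    have h1 : Function.Injective (MvPolynomial.aeval (R := R) ((Subtype.val : B' → L) ∘ e)) := hind
    exact h1.comp hB.1.aevalEquiv.symm.injective
  let _ : Algebra A L := g.toRingHom.toAlgebra
  have hgL : ∀ a : A, algebraMap A L a = g a := fun a => rfl
  have : FaithfulSMul A L := (faithfulSMul_iff_algebraMap_injective A L).2 hg
  have : IsScalarTower R A L := IsScalarTower.of_algebraMap_eq fun r => by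
    rw [hgL, g.commutes]
  have : Algebra.IsAlgebraic A F := hB.isAlgebraic
  exact ⟨(IsAlgClosed.lift (R := A) (S := F) (M := L)).restrictScalars R⟩

theorem exists_algHom_of_transcendental (k : Type*) {F L : Type*} [Field k] [Countable k]
    [Field F] [Countable F] [Field L] [IsAlgClosed L] [Uncountable L] [Algebra k F] [Algebra k L]
    {α : F} (hα : Transcendental k α) {z : L} (hz : Transcendental k z) :
    ∃ f : F →+* L, f α = z := by
  have : Countable k[X] := by
    have h : Cardinal.mk k[X] ≤ Cardinal.aleph0 := by
      refine Polynomial.cardinalMk_le_max.trans ?_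
      exact max_le Cardinal.mk_le_aleph0 le_rfl
    exact Cardinal.mk_le_aleph0_iff.1 h
  let _ : Algebra k[X] F := (aeval α).toRingHom.toAlgebra
  let _ : Algebra k[X] L := (aeval z).toRingHom.toAlgebra
  have : FaithfulSMul k[X] F :=
    (faithfulSMul_iff_algebraMap_injective _ _).2 (transcendental_iff_injective.1 hα)
  have : FaithfulSMul k[X] L :=
    (faithfulSMul_iff_algebraMap_injective _ _).2 (transcendental_iff_injective.1 hz)
  obtain ⟨f⟩ := exists_algHom_of_countable k[X] F L
  refine ⟨f.toRingHom, ?_⟩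
  have h := f.commutes X
  have h1 : algebraMap k[X] F X = α := aeval_X α
  have h2 : algebraMap k[X] L X = z := aeval_X z
  rw [h1, h2] at h
  exact h

theorem exists_ringHom_of_adjoin_hom (k : Type*) {F L : Type*} [Field k]
    [Field F] [Countable F] [Field L] [IsAlgClosed L] [Uncountable L] [Algebra k F]
    {α : F} (g : IntermediateField.adjoin k {α} →+* L) :
    ∃ f : F →+* L, f α = g (IntermediateField.AdjoinSimple.gen k α) := by
  let _ : Algebra (IntermediateField.adjoin k {α}) L := g.toAlgebra
  obtain ⟨f⟩ := exists_algHom_of_countable (IntermediateField.adjoin k {α}) F L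
  exact ⟨f.toRingHom, f.commutes (IntermediateField.AdjoinSimple.gen k α)⟩

theorem exists_ringHom_of_root (k : Type*) {F L : Type*} [Field k]
    [Field F] [Countable F] [Field L] [IsAlgClosed L] [Uncountable L] [Algebra k F] [Algebra k L]
    {α : F} (hα : IsIntegral k α) {z : L} (hz : aeval z (minpoly k α) = 0) :
    ∃ f : F →+* L, f α = z := by
  have hz' : z ∈ (minpoly k α).aroots L :=
    (mem_aroots).2 ⟨minpoly.ne_zero hα, hz⟩
  obtain ⟨f, hf⟩ := exists_ringHom_of_adjoin_hom k
    (((IntermediateField.algHomAdjoinIntegralEquiv k hα).symm ⟨z, hz'⟩).toRingHom)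
  exact ⟨f, hf.trans (IntermediateField.algHomAdjoinIntegralEquiv_symm_apply_gen k hα ⟨z, hz'⟩)⟩

end Embedding

section Existence

open Polynomial

theorem nonempty_place_of_transcendental_charP {F : Type*} [Field F] [Countable F] (p : ℕ)
    [Fact p.Prime] [Algebra (ZMod p) F] (α : Fˣ) (hα : Transcendental (ZMod p) (α : F)) :
    Nonempty (Place α) := by
  let D := PowerSeries (ZMod p)
  let K := FractionRing D
  let L := AlgebraicClosure K
  have : Finite (IsLocalRing.ResidueField D) := Finite.of_equiv (ZMod p)
    (PowerSeries.residueFieldOfPowerSeries (k := ZMod p)).symm.toEquiv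
  have hinjK : Function.Injective (algebraMap D K) := IsFractionRing.injective D K
  have hinj : Function.Injective (algebraMap D L) := by
    rw [IsScalarTower.algebraMap_eq D K L]
    exact (algebraMap K L).injective.comp hinjK
  have halg : ∀ u : L, IsAlgebraic D u := fun u =>
    (IsFractionRing.isAlgebraic_iff D K L).2 (Algebra.IsAlgebraic.isAlgebraic u)
  have : Uncountable L := by
    have h1 : Uncountable (ℕ → ZMod p) := by
      rw [← Cardinal.aleph0_lt_mk_iff, ← Cardinal.power_def, ← Cardinal.mk_nat]
      refine (Cardinal.cantor _).trans_le ?_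
      apply Cardinal.power_le_power_right
      rw [Cardinal.mk_fintype, ZMod.card]
      exact_mod_cast (Fact.out : p.Prime).two_le
    have : Uncountable D := Function.Injective.uncountable
      (f := fun g : ℕ → ZMod p => (PowerSeries.mk g : D)) fun a b h => by
        funext n
        have := congrArg (PowerSeries.coeff n) h
        simpa using this
    exact hinj.uncountable
  set x : L := algebraMap D L PowerSeries.X with hx
  have hx0 : x ≠ 0 := by
    rw [hx, Ne, ← map_zero (algebraMap D L)]
    exact fun h => PowerSeries.X_ne_zero (hinj h)
  have hnotint : ¬ IsIntegral D (x⁻¹) := by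
    intro h
    have h1 : x⁻¹ = algebraMap K L ((algebraMap D K PowerSeries.X)⁻¹) := by
      rw [map_inv₀, ← IsScalarTower.algebraMap_apply]
    rw [h1, isIntegral_algebraMap_iff (algebraMap K L).injective] at h
    obtain ⟨d, hd⟩ := IsIntegrallyClosed.isIntegral_iff.1 h
    have h2 : algebraMap D K (d * PowerSeries.X) = algebraMap D K 1 := by
      rw [map_mul, hd, map_one, inv_mul_cancel₀]
      rw [Ne, ← map_zero (algebraMap D K)]
      exact fun h => PowerSeries.X_ne_zero (hinjK h)
    have h3 := hinjK h2
    have h4 := congrArg (PowerSeries.constantCoeff) h3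
    simp at h4
  have htr : Transcendental (ZMod p) x⁻¹ := by
    intro h
    exact hnotint (isAlgebraic_iff_isIntegral.1 h).tower_top
  obtain ⟨f, hf⟩ := exists_algHom_of_transcendental (ZMod p) hα htr
  obtain ⟨P⟩ := nonempty_place_of_not_isIntegral hinj halg (Units.mk0 x⁻¹ (inv_ne_zero hx0)) hnotint
  exact P.comap f hf

theorem nonempty_place_of_not_isIntegral_int {F : Type*} [Field F] [Countable F] [CharZero F]
    (α : Fˣ) (hα : IsIntegral ℚ (α : F)) (halgint : ¬ IsIntegral ℤ (α : F)) :
    Nonempty (Place α) := by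
  obtain ⟨n, hn⟩ : ∃ n, (minpoly ℚ (α : F)).coeff n ∉ Set.range (algebraMap ℤ ℚ) := by
    by_contra! h
    refine halgint ?_
    obtain ⟨q, hq, -, hqm⟩ := lifts_and_degree_eq_and_monic
      ((lifts_iff_coeff_lifts _).2 h) (minpoly.monic hα)
    refine ⟨q, hqm, ?_⟩
    have h1 := minpoly.aeval ℚ (α : F)
    rw [← hq, aeval_map_algebraMap] at h1
    exact h1
  set c := (minpoly ℚ (α : F)).coeff n with hc
  have hden : c.den ≠ 1 := fun h => hn ⟨c.num, by
    rw [eq_intCast]; exact Rat.coe_int_num_of_den_eq_one h⟩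
  obtain ⟨p, hp, hpc⟩ := Nat.exists_prime_and_dvd hden
  have : Fact p.Prime := ⟨hp⟩
  let L := AlgebraicClosure ℚ_[p]
  have : Finite (IsLocalRing.ResidueField ℤ_[p]) := Finite.of_equiv (ZMod p)
    (PadicInt.residueField (p := p)).symm.toEquiv
  have hinjK : Function.Injective (algebraMap ℤ_[p] ℚ_[p]) := IsFractionRing.injective _ _
  have hinj : Function.Injective (algebraMap ℤ_[p] L) := by
    rw [IsScalarTower.algebraMap_eq ℤ_[p] ℚ_[p] L]
    exact (algebraMap ℚ_[p] L).injective.comp hinjK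
  have halg : ∀ u : L, IsAlgebraic ℤ_[p] u := fun u =>
    (IsFractionRing.isAlgebraic_iff ℤ_[p] ℚ_[p] L).2 (Algebra.IsAlgebraic.isAlgebraic u)
  have : Uncountable L := by
    have : Uncountable ℚ_[p] := by
      rw [← Cardinal.aleph0_lt_mk_iff]
      exact Cardinal.aleph0_lt_continuum.trans_le
        (continuum_le_cardinal_of_nontriviallyNormedField _)
    exact (algebraMap ℚ_[p] L).injective.uncountable
  obtain ⟨z, hz, hzi⟩ : ∃ z : L, ((minpoly ℚ (α : F)).map (algebraMap ℚ L)).IsRoot z ∧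
      ¬ IsIntegral ℤ_[p] z := by
    by_contra! h
    have h1 := isIntegral_coeff_of_factors (R := ℤ_[p]) ((minpoly ℚ (α : F)).map (algebraMap ℚ L))
      (by rw [((minpoly.monic hα).map _).leadingCoeff]; exact isIntegral_one)
      (IsAlgClosed.splits _) h n
    rw [coeff_map, ← hc, IsScalarTower.algebraMap_apply ℚ ℚ_[p] L,
      isIntegral_algebraMap_iff (algebraMap ℚ_[p] L).injective] at h1
    obtain ⟨d, hd⟩ := IsIntegrallyClosed.isIntegral_iff.1 h1
    have h2 : ‖(c : ℚ_[p])‖ ≤ 1 := by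
      rw [eq_ratCast] at hd
      rw [← hd]
      exact d.2
    have h3 : (c : ℚ_[p]) * ((c.den : ℤ) : ℚ_[p]) = ((c.num : ℤ) : ℚ_[p]) := by
      exact_mod_cast congrArg (fun q : ℚ => (q : ℚ_[p])) (Rat.mul_den_eq_num c)
    have h4 : ‖((c.den : ℤ) : ℚ_[p])‖ < 1 :=
      Padic.norm_intCast_lt_one_iff.2 (by exact_mod_cast hpc)
    have h5 : ‖((c.num : ℤ) : ℚ_[p])‖ < 1 := by
      rw [← h3, norm_mul]
      exact mul_lt_one_of_nonneg_of_lt_one_right h2 (norm_nonneg _) h4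
    have h6 := Padic.norm_intCast_lt_one_iff.1 h5
    have h7 : p ∣ c.num.natAbs := Int.natCast_dvd.1 h6
    have h8 := Nat.dvd_gcd h7 hpc
    rw [c.reduced] at h8
    exact hp.one_lt.ne' (Nat.dvd_one.1 h8)
  have hroot : aeval z (minpoly ℚ (α : F)) = 0 := by
    rw [IsRoot, eval_map] at hz; exact hz
  have hz0 : z ≠ 0 := by rintro rfl; exact hzi isIntegral_zero
  obtain ⟨f, hf⟩ := exists_ringHom_of_root ℚ hα hroot
  obtain ⟨P⟩ := nonempty_place_of_not_isIntegral hinj halg (Units.mk0 z hz0) hzi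
  exact P.comap f hf

theorem nonempty_place {F : Type*} [Field F] [Countable F] (α : Fˣ)
    (hα : ∀ n : ℕ, 0 < n → α ^ n ≠ 1) : Nonempty (Place α) := by
  obtain ⟨p, hp⟩ := CharP.exists F
  rcases CharP.char_is_prime_or_zero F p with hpp | rfl
  · have : Fact p.Prime := ⟨hpp⟩
    let _ : Algebra (ZMod p) F := ZMod.algebra F p
    refine nonempty_place_of_transcendental_charP p α fun ⟨q, hq0, hq⟩ => ?_
    obtain ⟨N, hN, h⟩ := exists_pow_eq_one_of_isAlgebraic (algebraMap (ZMod p) F) q hq0 α.ne_zero hq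
    exact hα N hN (Units.ext (by simpa using h))
  have : CharZero F := CharP.charP_to_charZero F
  have : Uncountable ℂ := by
    rw [← Set.countable_univ_iff.not.trans not_countable_iff]
    exact not_countable_complex
  by_cases htr : Transcendental ℚ (α : F)
  · obtain ⟨z, hz, hz1⟩ : ∃ z : ℂ, Transcendental ℚ z ∧ ‖z‖ ≠ 1 := by
      obtain ⟨t, ht⟩ : ∃ t : ℂ, Transcendental ℚ t := by
        by_contra! h
        have h1 := Algebraic.countable ℚ ℂ
        have h2 : {x : ℂ | IsAlgebraic ℚ x} = Set.univ :=
          Set.eq_univ_of_forall fun x => not_not.1 (h x)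
        rw [h2] at h1
        exact not_countable_complex h1
      by_cases h1 : ‖t‖ = 1
      · refine ⟨2 * t, fun h => ht ?_, by rw [norm_mul, h1]; norm_num⟩
        have h2 := h.mul (isAlgebraic_algebraMap (A := ℂ) ((1 : ℚ) / 2))
        have h3 : 2 * t * algebraMap ℚ ℂ (1 / 2) = t := by
          rw [map_div₀, map_one, map_ofNat]; ring
        rwa [h3] at h2
      · exact ⟨t, ht, h1⟩
    obtain ⟨f, hf⟩ := exists_algHom_of_transcendental ℚ htr hz
    obtain ⟨P⟩ := nonempty_place_complex (Units.mk0 z (by rintro rfl; exact hz isAlgebraic_zero)) hz1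
    exact P.comap f hf
  · have halgint : IsIntegral ℚ (α : F) := isAlgebraic_iff_isIntegral.1 (not_not.1 htr)
    by_cases hZ : IsIntegral ℤ (α : F)
    · let K := IntermediateField.adjoin ℚ {(α : F)}
      let x : K := IntermediateField.AdjoinSimple.gen ℚ (α : F)
      have : FiniteDimensional ℚ K := IntermediateField.adjoin.finiteDimensional halgint
      have : NumberField K := ⟨⟩
      have hx : IsIntegral ℤ x := by
        rw [← isIntegral_algebraMap_iff (algebraMap K F).injective]
        exact hZ
      obtain ⟨g, hg⟩ : ∃ g : K →+* ℂ, ‖g x‖ ≠ 1 := by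
        by_contra! h
        obtain ⟨n, hn, he⟩ := NumberField.Embeddings.pow_eq_one_of_norm_eq_one K ℂ hx h
        refine hα n hn (Units.ext ?_)
        have := congrArg (algebraMap K F) he
        simpa [x] using this
      obtain ⟨f, hf⟩ := exists_ringHom_of_adjoin_hom ℚ g
      have h0 : g x ≠ 0 := by
        rw [← hf]
        exact (map_ne_zero f).2 α.ne_zero
      obtain ⟨P⟩ := nonempty_place_complex (Units.mk0 (g x) h0) hg
      exact P.comap f hf
    · exact nonempty_place_of_not_isIntegral_int α halgint hZ

end Existence

section MeanSubspace

theorem InvMean.mono {G : Type*} [Group G] (m : InvMean G) {A B : Set G} (h : A ⊆ B) :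
    m.m A ≤ m.m B := by
  have h1 := m.union A (B \ A) Set.disjoint_sdiff_right
  rw [Set.union_sdiff_cancel h] at h1
  linarith [m.nonneg (B \ A)]

theorem InvMean.le_one {G : Type*} [Group G] (m : InvMean G) (A : Set G) : m.m A ≤ 1 :=
  m.univ ▸ m.mono (Set.subset_univ A)

theorem InvMean.union_add_inter {G : Type*} [Group G] (m : InvMean G) (A B : Set G) :
    m.m (A ∪ B) + m.m (A ∩ B) = m.m A + m.m B := by
  have h1 := m.union A (B \ A) Set.disjoint_sdiff_right
  have h2 := m.union (B ∩ A) (B \ A) (Set.disjoint_sdiff_right.mono_left Set.inter_subset_right)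
  rw [Set.inter_union_sdiff] at h2
  rw [Set.union_sdiff_self] at h1
  rw [Set.inter_comm A B]
  linarith

theorem InvMean.card_mul_le {G ι : Type*} [Group G] (m : InvMean G) (A : ι → Set G) {c δ : ℝ}
    (hδ : 0 ≤ δ) (s : Finset ι) (hc : ∀ i ∈ s, c ≤ m.m (A i))
    (hd : ∀ i ∈ s, ∀ j ∈ s, i ≠ j → m.m (A i ∩ A j) ≤ δ) :
    s.card * c ≤ m.m (⋃ i ∈ s, A i) + (s.card : ℝ) ^ 2 * δ := by
  classical
  have hempty : m.m ∅ = 0 := by have := m.union ∅ ∅ (Set.disjoint_empty _); simp at this; exact this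
  induction s using Finset.induction_on with
  | empty => simp [hempty]
  | insert a s ha ih =>
    have ih := ih (fun i hi => hc i (Finset.mem_insert_of_mem hi)) fun i hi j hj =>
      hd i (Finset.mem_insert_of_mem hi) j (Finset.mem_insert_of_mem hj)
    have key : ∀ t : Finset ι, t ⊆ s → m.m (A a ∩ ⋃ i ∈ t, A i) ≤ t.card * δ := by
      intro t
      induction t using Finset.induction_on with
      | empty => simp [hempty]
      | insert b t hb iht =>
        intro hts
        rw [Finset.insert_subset_iff] at hts
        rw [Finset.set_biUnion_insert, Set.inter_union_distrib_left]
        have h1 := m.union_add_inter (A a ∩ A b) (A a ∩ ⋃ i ∈ t, A i)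
        have h2 := hd a (Finset.mem_insert_self _ _) b (Finset.mem_insert_of_mem hts.1)
          (by rintro rfl; exact ha hts.1)
        have h3 := iht hts.2
        have h4 := m.nonneg ((A a ∩ A b) ∩ (A a ∩ ⋃ i ∈ t, A i))
        rw [Finset.card_insert_of_notMem hb]; push_cast; linarith
    have h1 := m.union_add_inter (A a) (⋃ i ∈ s, A i)
    have h2 := key s le_rfl
    have h3 := hc a (Finset.mem_insert_self _ _)
    rw [Finset.set_biUnion_insert, Finset.card_insert_of_notMem ha]; push_cast
    nlinarith [Nat.cast_nonneg (α := ℝ) s.card]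

variable {F Γ U : Type*} [Field F] [Group Γ] [AddCommGroup U] [Module F U] [FiniteDimensional F U]

/-- A group with an invariant mean acting on a vector space with two eigenvalues of different
absolute value has a proper subspace with a finite orbit. -/
theorem InvMean.exists_finite_orbit (m : InvMean Γ) (ρ : Γ →* (U →ₗ[F] U)) (v : AbsoluteValue F ℝ)
    (γ : Γ) (x y : U) (hx0 : x ≠ 0) (hy0 : y ≠ 0) (a b : F) (hx : ρ γ x = a • x)
    (hy : ρ γ y = b • y) (hab : v b < v a) :
    ∃ W : Submodule F U, W ≠ ⊥ ∧ W ≠ ⊤ ∧ (Set.range fun h => W.map (ρ h)).Finite := by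
  classical
  have hinvρ : ∀ g z, ρ g (ρ g⁻¹ z) = z := fun g z => by
    rw [← Module.End.mul_apply, ← map_mul]; simp
  have hρinv : ∀ g z, ρ g⁻¹ (ρ g z) = z := fun g z => by
    rw [← Module.End.mul_apply, ← map_mul]; simp
  obtain ⟨ξ, hξ⟩ : ∃ ξ : Module.Dual F U, ξ x ≠ 0 := by
    by_contra! h
    exact hx0 ((Module.forall_dual_apply_eq_zero_iff F x).1 h)
  have hb0 : b ≠ 0 := by
    rintro rfl
    rw [zero_smul] at hy
    exact hy0 (by rw [← hρinv γ y, hy, map_zero])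
  have hvb : 0 < v b := v.pos hb0
  set B := Module.finBasis F U
  set f : U → Γ → ℝ := fun z g => v (ξ (ρ g⁻¹ z)) with hf
  have hf0 : ∀ z g, 0 ≤ f z g := fun z g => v.nonneg _
  set N : Γ → ℝ := fun g => ∑ i, f (B i) g with hN
  have hfadd : ∀ z w g, f (z + w) g ≤ f z g + f w g := fun z w g => by
    simp only [hf, map_add]; exact v.add_le _ _
  have hfsmul : ∀ c z g, f (c • z) g = v c * f z g := fun c z g => by simp [hf]
  have hfmul : ∀ h z g, f (ρ h z) g = f z (h⁻¹ * g) := fun h z g => by simp [hf]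
  have hfle : ∀ z, ∃ C, 0 < C ∧ ∀ g, f z g ≤ C * N g := by
    intro z
    have hfz : ∀ (s : Finset _) (g : Γ), f (∑ i ∈ s, B.repr z i • B i) g ≤
        ∑ i ∈ s, v (B.repr z i) * f (B i) g := by
      intro s g
      induction s using Finset.induction_on with
      | empty => simp [hf]
      | insert i s hi ih =>
        rw [Finset.sum_insert hi, Finset.sum_insert hi, ← hfsmul]
        exact (hfadd _ _ _).trans (by linarith)
    refine ⟨∑ i, v (B.repr z i) + 1, ?_, fun g => ?_⟩
    · have := Finset.sum_nonneg fun i (_ : i ∈ Finset.univ) => v.nonneg (B.repr z i)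
      linarith
    · have h1 := hfz Finset.univ g
      rw [B.sum_repr] at h1
      refine h1.trans ?_
      rw [hN, Finset.mul_sum]
      refine Finset.sum_le_sum fun i _ => mul_le_mul_of_nonneg_right ?_ (hf0 _ _)
      have := Finset.single_le_sum (fun i (_ : i ∈ Finset.univ) => v.nonneg (B.repr z i))
        (Finset.mem_univ i)
      linarith
  have hN0 : ∀ g, 0 ≤ N g := fun g => Finset.sum_nonneg fun i _ => hf0 _ _
  have hNpos : ∀ g, 0 < N g := by
    intro g
    obtain ⟨C, hC, h⟩ := hfle (ρ g x)
    have h1 := h g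
    have h2 : 0 < f (ρ g x) g := by
      simp only [hf, hρinv]
      exact v.pos hξ
    exact (pos_iff_pos_of_mul_pos (h2.trans_le h1)).1 hC
  have hNmul : ∀ h, ∃ C, 0 < C ∧ ∀ g, N (h⁻¹ * g) ≤ C * N g := by
    intro h
    choose C hC hle using hfle
    refine ⟨∑ i, C (ρ h (B i)) + 1, ?_, fun g => ?_⟩
    · have := Finset.sum_nonneg fun i (_ : i ∈ Finset.univ) => (hC (ρ h (B i))).le
      linarith
    · have : N (h⁻¹ * g) ≤ (∑ i, C (ρ h (B i))) * N g := by
        rw [Finset.sum_mul]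
        refine Finset.sum_le_sum fun i _ => ?_
        rw [← hfmul]; exact hle _ _
      linarith [hN0 g]
  set S : Set U → ℝ → Set Γ := fun A ε => {g | ∀ z ∈ A, f z g ≤ ε * N g} with hS
  have hSmono : ∀ A, ∀ ε ε' : ℝ, ε ≤ ε' → S A ε ⊆ S A ε' := fun A ε ε' h g hg z hz =>
    (hg z hz).trans (mul_le_mul_of_nonneg_right h (hN0 g))
  set P : Set U → ℝ → Prop := fun A c => ∀ ε, 0 < ε → c ≤ m.m (S A ε) with hP
  have hspan : ∀ A : Set U, ∀ z ∈ Submodule.span F A, ∃ C, 0 ≤ C ∧ ∀ ε, 0 < ε → ∀ g ∈ S A ε,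
      f z g ≤ C * ε * N g := by
    intro A z hz
    induction hz using Submodule.span_induction with
    | mem z hz => exact ⟨1, zero_le_one, fun ε _ g hg => by rw [one_mul]; exact hg z hz⟩
    | zero => exact ⟨0, le_rfl, fun ε _ g _ => by simp [hf]⟩
    | add z w _ _ h1 h2 =>
      obtain ⟨C, hC, h1⟩ := h1
      obtain ⟨D, hD, h2⟩ := h2
      refine ⟨C + D, by positivity, fun ε hε g hg => (hfadd z w g).trans ?_⟩
      linarith [h1 ε hε g hg, h2 ε hε g hg]
    | smul c z _ h1 =>
      obtain ⟨C, hC, h1⟩ := h1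
      refine ⟨v c * C, mul_nonneg (v.nonneg _) hC, fun ε hε g hg => ?_⟩
      rw [hfsmul, mul_assoc, mul_assoc]
      refine mul_le_mul_of_nonneg_left ?_ (v.nonneg _)
      rw [← mul_assoc]; exact h1 ε hε g hg
  have htop : ∀ A c, 0 < c → P A c → Submodule.span F A ≠ ⊤ := by
    intro A c hc hPA htop
    choose C hC hle using fun i => hspan A (B i) (htop ▸ Submodule.mem_top)
    have hCs := Finset.sum_nonneg fun i (_ : i ∈ Finset.univ) => hC i
    set D := ∑ i, C i
    have h1 := hPA (D + 1)⁻¹ (by positivity)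
    have h2 : S A (D + 1)⁻¹ = ∅ := by
      rw [Set.eq_empty_iff_forall_notMem]
      intro g hg
      have h3 : N g ≤ D * (D + 1)⁻¹ * N g := by
        rw [mul_assoc, Finset.sum_mul]
        refine Finset.sum_le_sum fun i _ => ?_
        rw [← mul_assoc]
        exact hle i _ (by positivity) g hg
      have h4 : D * (D + 1)⁻¹ < 1 := by
        rw [← div_eq_mul_inv, div_lt_one (by positivity)]; linarith
      nlinarith [hNpos g]
    have hempty : m.m ∅ = 0 := by
      have := m.union ∅ ∅ (Set.disjoint_empty _); simp at this; exact this
    rw [h2, hempty] at h1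
    linarith
  have htrans : ∀ A c h, P A c → P (ρ h '' A) c := by
    intro A c h hPA ε hε
    obtain ⟨C, hC, hle⟩ := hNmul h
    refine (hPA (ε / C) (by positivity)).trans ?_
    rw [← m.inv h⁻¹]
    refine m.mono fun g hg => ?_
    rintro _ ⟨z, hz, rfl⟩
    rw [hfmul]
    refine (hg z hz).trans ((mul_le_mul_of_nonneg_left (hle g) (by positivity)).trans_eq ?_)
    field_simp
  have hpow : ∀ (z : U) (c : F), ρ γ z = c • z → ∀ (k : ℕ) g, f z ((γ ^ k)⁻¹ * g) = v c ^ k * f z g := by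
    intro z c hz k g
    rw [← hfmul, ← map_pow v, ← hfsmul]
    congr 1
    induction k with
    | zero => simp
    | succ k ih => rw [pow_succ, map_mul, Module.End.mul_apply, hz, map_smul, ih, smul_smul, pow_succ']
  have hmid : ∀ ε : ℝ, 0 < ε → ε < 1 → m.m {g | ε * f y g < f x g ∧ ε * f x g < f y g} = 0 := by
    intro ε hε hε1
    set M := {g | ε * f y g < f x g ∧ ε * f x g < f y g} with hM
    by_contra hne
    have hpos : 0 < m.m M := lt_of_le_of_ne (m.nonneg _) (Ne.symm hne)
    obtain ⟨n, hn⟩ : ∃ n : ℕ, (1 / ε) ^ 2 * v b ^ n < v a ^ n := by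
      have hq : 1 < v a / v b := (one_lt_div hvb).2 hab
      obtain ⟨n, hn⟩ := pow_unbounded_of_one_lt ((1 / ε) ^ 2) hq
      refine ⟨n, ?_⟩
      rwa [div_pow (v a), lt_div_iff₀ (by positivity)] at hn
    have hn' : ∀ j : ℕ, 0 < j → v b ^ (n * j) < ε ^ 2 * v a ^ (n * j) := by
      intro j hj
      have h1 : v b ^ n < ε ^ 2 * v a ^ n := by
        have : (1 / ε) ^ 2 * v b ^ n = v b ^ n / ε ^ 2 := by field_simp
        rw [this, div_lt_iff₀ (by positivity)] at hn
        linarith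
      obtain ⟨i, rfl⟩ := Nat.exists_eq_succ_of_ne_zero hj.ne'
      rw [pow_mul, pow_mul, pow_succ, pow_succ (v a ^ n), ← mul_assoc, mul_comm (ε ^ 2), mul_assoc]
      have h2 : (v b ^ n) ^ i ≤ (v a ^ n) ^ i :=
        pow_le_pow_left₀ (by positivity) (pow_le_pow_left₀ hvb.le hab.le _) _
      exact mul_lt_mul' h2 h1 (by positivity) (by have := hvb.trans hab; positivity)
    set T : ℕ → Set Γ := fun j => {g | (γ ^ (n * j))⁻¹ * g ∈ M} with hT
    have hdis : ∀ i j, i < j → T i ∩ T j = ∅ := by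
      intro i j hij
      rw [Set.eq_empty_iff_forall_notMem]
      rintro g ⟨h1, h2⟩
      obtain ⟨d, rfl⟩ := Nat.exists_eq_add_of_lt hij
      set g' := (γ ^ (n * i))⁻¹ * g with hg'
      have h3 : (γ ^ (n * (i + d + 1)))⁻¹ * g = (γ ^ (n * (d + 1)))⁻¹ * g' := by
        rw [hg', ← mul_assoc, ← mul_inv_rev, ← pow_add]; congr 3; ring
      have h1 : ε * f y g' < f x g' ∧ ε * f x g' < f y g' := h1
      have h2 : ε * f y ((γ ^ (n * (i + d + 1)))⁻¹ * g) < f x ((γ ^ (n * (i + d + 1)))⁻¹ * g) ∧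
        ε * f x ((γ ^ (n * (i + d + 1)))⁻¹ * g) < f y ((γ ^ (n * (i + d + 1)))⁻¹ * g) := h2
      rw [h3, hpow x a hx, hpow y b hy] at h2
      have h4 := hn' (d + 1) (Nat.succ_pos d)
      have hxp : 0 < f x g' := (mul_nonneg hε.le (hf0 _ _)).trans_lt h1.1
      have hyp : 0 < f y g' := (mul_nonneg hε.le (hf0 _ _)).trans_lt h1.2
      have h5 : v b ^ (n * (d + 1)) * f y g' < ε ^ 2 * v a ^ (n * (d + 1)) * f y g' :=
        mul_lt_mul_of_pos_right h4 hyp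
      have h6 : ε * v a ^ (n * (d + 1)) * (ε * f y g') ≤ ε * v a ^ (n * (d + 1)) * f x g' :=
        mul_le_mul_of_nonneg_left h1.1.le (by have := hvb.trans hab; positivity)
      have h7 := h2.2
      nlinarith
    have hempty : m.m ∅ = 0 := by
      have := m.union ∅ ∅ (Set.disjoint_empty _); simp at this; exact this
    obtain ⟨K, hK⟩ := exists_nat_gt (1 / m.m M)
    have h1 := m.card_mul_le T (le_refl (0 : ℝ)) (Finset.range K) (c := m.m M)
      (fun i _ => (m.inv (γ ^ (n * i))⁻¹ M).ge)
      (fun i _ j _ hij => by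
        rcases lt_or_gt_of_ne hij with h | h
        · rw [hdis i j h, hempty]
        · rw [Set.inter_comm, hdis j i h, hempty])
    rw [div_lt_iff₀ hpos] at hK
    have h2 := m.le_one (⋃ i ∈ Finset.range K, T i)
    rw [Finset.card_range] at h1
    linarith
  have hP1 : P {x} (1 / 2) ∨ P {y} (1 / 2) := by
    by_contra! hcon
    simp only [hP] at hcon
    push Not at hcon
    obtain ⟨⟨ε₁, h1, h1'⟩, ε₂, h2, h2'⟩ := hcon
    obtain ⟨C, hC, hCle⟩ := hfle x
    obtain ⟨D, hD, hDle⟩ := hfle y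
    obtain ⟨ε, hε, hε1, hεD, hεC⟩ : ∃ ε : ℝ, 0 < ε ∧ ε < 1 ∧ ε * D ≤ ε₁ ∧ ε * C ≤ ε₂ := by
      refine ⟨min (1 / 2) (min (ε₁ / D) (ε₂ / C)), by positivity, by
        exact (min_le_left _ _).trans_lt (by norm_num), ?_, ?_⟩
      · rw [← le_div_iff₀ hD]; exact (min_le_right _ _).trans (min_le_left _ _)
      · rw [← le_div_iff₀ hC]; exact (min_le_right _ _).trans (min_le_right _ _)
    have hcov : (Set.univ : Set Γ) ⊆
        (S {x} ε₁ ∪ S {y} ε₂) ∪ {g | ε * f y g < f x g ∧ ε * f x g < f y g} := by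
      intro g _
      by_cases hg : ε * f y g < f x g
      · by_cases hg' : ε * f x g < f y g
        · exact Or.inr ⟨hg, hg'⟩
        · refine Or.inl (Or.inr ?_)
          rintro _ rfl
          push Not at hg'
          have := mul_le_mul_of_nonneg_left (hCle g) hε.le
          have := mul_le_mul_of_nonneg_right hεC (hN0 g)
          linarith
      · refine Or.inl (Or.inl ?_)
        rintro _ rfl
        push Not at hg
        have := mul_le_mul_of_nonneg_left (hDle g) hε.le
        have := mul_le_mul_of_nonneg_right hεD (hN0 g)
        linarith
    have h3 := m.mono hcov
    have h4 := m.union_add_inter (S {x} ε₁ ∪ S {y} ε₂) {g | ε * f y g < f x g ∧ ε * f x g < f y g}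
    have h5 := m.union_add_inter (S {x} ε₁) (S {y} ε₂)
    rw [hmid ε hε hε1] at h4
    rw [m.univ] at h3
    have h6 := m.nonneg ((S {x} ε₁ ∪ S {y} ε₂) ∩ {g | ε * f y g < f x g ∧ ε * f x g < f y g})
    have h7 := m.nonneg (S {x} ε₁ ∩ S {y} ε₂)
    linarith
  set Q : ℕ → Prop := fun d => ∃ A c, 0 < c ∧ P A c ∧ Module.finrank F (Submodule.span F A) = d
    with hQ
  have hQ1 : Q 1 := by
    rcases hP1 with h | h
    · exact ⟨{x}, 1 / 2, by norm_num, h, finrank_span_singleton hx0⟩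
    · exact ⟨{y}, 1 / 2, by norm_num, h, finrank_span_singleton hy0⟩
  have hQle : ∀ d, Q d → d ≤ Module.finrank F U := by
    rintro d ⟨A, c, -, -, rfl⟩
    exact Submodule.finrank_le _
  obtain ⟨d, ⟨A, c, hc, hA, hAd⟩, hmax⟩ : ∃ d, Q d ∧ ∀ e, Q e → e ≤ d :=
    ⟨Nat.findGreatest Q (Module.finrank F U), Nat.findGreatest_spec (hQle 1 hQ1) hQ1,
      fun e he => Nat.le_findGreatest (hQle e he) he⟩
  have hd1 : 1 ≤ d := hmax 1 hQ1
  refine ⟨Submodule.span F A, ?_, htop A c hc hA, ?_⟩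
  · intro h
    rw [h, finrank_bot] at hAd
    omega
  have hmapfin : ∀ h, Module.finrank F (Submodule.span F (ρ h '' A)) = d := by
    intro h
    rw [← hAd, ← Submodule.map_span]
    exact (Submodule.equivMapOfInjective _ (Function.LeftInverse.injective (hρinv h))
      _).finrank_eq.symm
  by_contra hinf
  obtain ⟨n, hn⟩ := exists_nat_gt (1 / c)
  rw [div_lt_iff₀ hc] at hn
  have hinf : (Set.range fun h => (Submodule.span F A).map (ρ h)).Infinite := hinf
  obtain ⟨t, ht, htn⟩ := hinf.exists_subset_card_eq n
  have ht : ∀ i ∈ t, ∃ h, (Submodule.span F A).map (ρ h) = i := fun i hi => ht hi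
  choose! r hr using ht
  set δ : ℝ := (n * c - 1) / (2 * (n : ℝ) ^ 2 + 1) with hδ
  have hδpos : 0 < δ := by
    have : 0 < n * c - 1 := by linarith
    positivity
  have hsmall : ∀ i ∈ t, ∀ j ∈ t, i ≠ j → ∃ ε, 0 < ε ∧ m.m (S (ρ (r i) '' A ∪ ρ (r j) '' A) ε) ≤ δ := by
    intro i hi j hj hij
    by_contra! hcon
    have hcon : P (ρ (r i) '' A ∪ ρ (r j) '' A) δ := fun ε hε => (hcon ε hε).le
    have h1 := hmax _ ⟨_, δ, hδpos, hcon, rfl⟩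
    have h2 : Submodule.span F (ρ (r i) '' A) = Submodule.span F (ρ (r i) '' A ∪ ρ (r j) '' A) := by
      refine Submodule.eq_of_le_of_finrank_le (Submodule.span_mono Set.subset_union_left) ?_
      rw [hmapfin]; exact h1
    have h3 : Submodule.span F (ρ (r j) '' A) = Submodule.span F (ρ (r i) '' A ∪ ρ (r j) '' A) := by
      refine Submodule.eq_of_le_of_finrank_le (Submodule.span_mono Set.subset_union_right) ?_
      rw [hmapfin]; exact h1
    apply hij
    rw [← hr i hi, ← hr j hj, Submodule.map_span, Submodule.map_span, h2, h3]
  choose! e he hme using hsmall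
  obtain ⟨ε, hε, hεe⟩ : ∃ ε : ℝ, 0 < ε ∧ ∀ i ∈ t, ∀ j ∈ t, i ≠ j → ε ≤ e i j := by
    set E := insert (1 : ℝ) (((t ×ˢ t).filter fun p => p.1 ≠ p.2).image fun p => e p.1 p.2) with hE
    have hEn : E.Nonempty := ⟨1, Finset.mem_insert_self _ _⟩
    refine ⟨E.min' hEn, ?_, fun i hi j hj hij => Finset.min'_le _ _ ?_⟩
    · rw [Finset.lt_min'_iff]
      intro z hz
      rw [hE, Finset.mem_insert, Finset.mem_image] at hz
      rcases hz with rfl | ⟨⟨i, j⟩, hp, rfl⟩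
      · exact one_pos
      · simp only [Finset.mem_filter, Finset.mem_product] at hp
        exact he i hp.1.1 j hp.1.2 hp.2
    · refine Finset.mem_insert_of_mem (Finset.mem_image.2 ⟨(i, j), ?_, rfl⟩)
      simp [hi, hj, hij]
  have h1 := m.card_mul_le (fun i => S (ρ (r i) '' A) ε) hδpos.le t (c := c)
    (fun i _ => htrans A c (r i) hA ε hε)
    (fun i hi j hj hij => by
      refine (m.mono ?_).trans (hme i hi j hj hij)
      intro g hg z hz
      refine hSmono _ _ _ (hεe i hi j hj hij) ?_ z hz
      rintro w (hw | hw)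
      · exact hg.1 w hw
      · exact hg.2 w hw)
  have h2 := m.le_one (⋃ i ∈ t, S (ρ (r i) '' A) ε)
  rw [htn] at h1
  have h3 : (n : ℝ) ^ 2 * δ < n * c - 1 := by
    rw [hδ, ← mul_div_assoc, div_lt_iff₀ (by positivity)]
    have : 0 < n * c - 1 := by linarith
    nlinarith [sq_nonneg (n : ℝ)]
  linarith

end MeanSubspace

section EigenvalueRatio

theorem Subgroup.finiteIndex_of_finite_range {Γ X : Type*} [Group Γ] (H : Subgroup Γ) (f : Γ → X)
    (hf : (Set.range f).Finite) (h : ∀ g g', f g = f g' → g⁻¹ * g' ∈ H) : H.FiniteIndex := by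
  rw [Subgroup.finiteIndex_iff_finite_quotient]
  have : Finite (Set.range f) := hf
  refine Finite.of_surjective
    (fun x : Set.range f => (QuotientGroup.mk (Classical.choose x.2) : Γ ⧸ H)) ?_
  intro q
  obtain ⟨g, rfl⟩ := QuotientGroup.mk_surjective q
  refine ⟨⟨f g, g, rfl⟩, ?_⟩
  rw [QuotientGroup.eq]
  exact h _ _ (Classical.choose_spec (⟨g, rfl⟩ : ∃ y, f y = f g))

theorem isJacobsonRing_int : IsJacobsonRing ℤ := by
  rw [isJacobsonRing_iff_prime_eq]
  intro P hP
  by_cases h : P = ⊥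
  · subst h
    refine le_antisymm (fun x hx => ?_) Ideal.le_jacobson
    rw [Ideal.mem_jacobson_bot] at hx
    have h1 := Int.isUnit_iff.1 (hx x)
    rw [Ideal.mem_bot]
    rcases h1 with h1 | h1 <;> nlinarith [sq_nonneg x]
  · have := hP.isMaximal h
    exact Ideal.jacobson_eq_self_of_isMaximal

theorem Valuation.mul_lt_one {K Γ₀ : Type*} [Field K] [LinearOrderedCommGroupWithZero Γ₀]
    (w : Valuation K Γ₀) {x y : K} (hx : w x ≤ 1) (hy : w y < 1) : w (x * y) < 1 := by
  rw [map_mul]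
  exact mul_lt_one_of_nonneg_of_lt_one_right hx zero_le hy

theorem Field.finite_of_finiteType_int (k : Type*) [Field k] [Algebra.FiniteType ℤ k] :
    Finite k := by
  have := isJacobsonRing_int
  have hfin : Module.Finite ℤ k := finite_of_finite_type_of_isJacobsonRing ℤ k
  refine Module.finite_of_fg_torsion k ?_
  obtain ⟨p, hp⟩ := CharP.exists k
  have hp0 : p ≠ 0 := by
    rintro rfl
    have : CharZero k := CharP.charP_to_charZero k
    have h1 : Function.Injective (algebraMap ℤ k) := by
      rw [algebraMap_int_eq]; exact Int.cast_injective
    have h2 : IsField ℤ := isField_of_isIntegral_of_isField h1 (Field.toIsField k)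
    exact Int.not_isField h2
  intro x
  refine ⟨⟨(p : ℤ), mem_nonZeroDivisors_of_ne_zero (by exact_mod_cast hp0)⟩, ?_⟩
  show (p : ℤ) • x = 0
  simp

theorem Field.finite_of_surjective {A k : Type*} [CommRing A] [Algebra.FiniteType ℤ A] [Field k]
    (π : A →+* k) (hπ : Function.Surjective π) : Finite k := by
  have : Algebra.FiniteType ℤ k := Algebra.FiniteType.of_surjective π.toIntAlgHom hπ
  exact Field.finite_of_finiteType_int k

theorem exists_ringHom_finite_field.{u} (A : Type u) [CommRing A] [Nontrivial A]
    [Algebra.FiniteType ℤ A] : ∃ (k : Type u) (_ : Field k) (_ : A →+* k), Finite k := by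
  obtain ⟨m, hm⟩ := Ideal.exists_maximal A
  exact ⟨A ⧸ m, Ideal.Quotient.field m, Ideal.Quotient.mk m, @Field.finite_of_surjective _ _ _ _
    (Ideal.Quotient.field m) (Ideal.Quotient.mk m) Ideal.Quotient.mk_surjective⟩

variable {F Γ U : Type*} [Field F] [Group Γ] [AddCommGroup U] [Module F U]

/-- `c` is an eigenvalue of `f`. -/
def IsEig (f : U →ₗ[F] U) (c : F) : Prop := ∃ x, x ≠ 0 ∧ f x = c • x

theorem IsEig.pow {f : U →ₗ[F] U} {c : F} (h : IsEig f c) (n : ℕ) : IsEig (f ^ n) (c ^ n) := by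
  obtain ⟨x, hx, h⟩ := h
  refine ⟨x, hx, ?_⟩
  induction n with
  | zero => simp
  | succ n ih => rw [pow_succ, Module.End.mul_apply, h, map_smul, ih, smul_smul, pow_succ']

theorem IsEig.ne_zero {ρ : Γ →* (U →ₗ[F] U)} {g : Γ} {c : F} (h : IsEig (ρ g) c) : c ≠ 0 := by
  rintro rfl
  obtain ⟨x, hx, h⟩ := h
  apply hx
  have : ρ g⁻¹ (ρ g x) = x := by rw [← Module.End.mul_apply, ← map_mul]; simp
  rw [← this, h]; simp

/-- Off a finite index subgroup, ratios of eigenvalues of prime order only have one possible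
order, which is not any given invertible one. -/
theorem exists_residue [FiniteDimensional F U] [Group.FG Γ] (ρ : Γ →* (U →ₗ[F] U)) (q : ℕ) (hq : (q : F) ≠ 0) :
    ∃ (H : Subgroup Γ) (p : ℕ), H.FiniteIndex ∧ ¬ p ∣ q ∧ ((p : F) = 0 ∨ CharZero F) ∧
      ∀ h ∈ H, ∀ a b, IsEig (ρ h) a → IsEig (ρ h) b → ∀ r, r.Prime → a ^ r = b ^ r →
        a = b ∨ r = p := by
  classical
  obtain ⟨T, hT⟩ := Group.fg_def.1 ‹Group.FG Γ›
  set B := Module.finBasis F U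
  set n := Module.finrank F U
  set M : Γ → Matrix (Fin n) (Fin n) F := fun g => LinearMap.toMatrixAlgEquiv B (ρ g) with hM
  have hMmul : ∀ g h, M (g * h) = M g * M h := fun g h => by simp only [hM, map_mul]
  have hMone : M 1 = 1 := by simp only [hM, map_one]
  set s : Finset F := insert (q : F)⁻¹ (Finset.univ.biUnion fun i : Fin n =>
    Finset.univ.biUnion fun j : Fin n => T.biUnion fun t => {M t i j, M t⁻¹ i j}) with hs
  set A := Algebra.adjoin ℤ (s : Set F) with hA
  have hAft : Algebra.FiniteType ℤ A := Subalgebra.fg_iff_finiteType _ |>.1 ⟨s, rfl⟩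
  have hMA : ∀ g i j, M g i j ∈ A := by
    intro g
    have hg : g ∈ Subgroup.closure (T : Set Γ) := hT ▸ Subgroup.mem_top g
    induction hg using Subgroup.closure_induction'' with
    | one =>
      intro i j
      rw [hMone, Matrix.one_apply]
      split_ifs
      · exact A.one_mem
      · exact A.zero_mem
    | mem t ht =>
      intro i j
      refine Algebra.subset_adjoin ?_
      simp only [hs, Finset.coe_insert, Set.mem_insert_iff, Finset.mem_coe, Finset.mem_biUnion]
      exact Or.inr ⟨i, Finset.mem_univ _, j, Finset.mem_univ _, t, ht, by simp⟩
    | inv_mem t ht =>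
      intro i j
      refine Algebra.subset_adjoin ?_
      simp only [hs, Finset.coe_insert, Set.mem_insert_iff, Finset.mem_coe, Finset.mem_biUnion]
      exact Or.inr ⟨i, Finset.mem_univ _, j, Finset.mem_univ _, t, ht, by simp⟩
    | mul x y _ _ hx hy =>
      intro i j
      rw [hMmul, Matrix.mul_apply]
      exact A.sum_mem fun k _ => A.mul_mem (hx i k) (hy k j)
  have hqA : (q : F)⁻¹ ∈ A := Algebra.subset_adjoin (by simp [hs])
  obtain ⟨k, hk, π, hkfin⟩ := exists_ringHom_finite_field A
  obtain ⟨V, hAV, hmV⟩ := Ideal.image_subset_nonunits_valuationSubring (A := A.toSubring) (RingHom.ker π)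
    (RingHom.ker_ne_top π)
  set w := V.valuation with hw
  have hwA : ∀ x ∈ A, w x ≤ 1 := fun x hx => (V.valuation_le_one_iff x).2 (hAV hx)
  have hwm : ∀ x : A, π x = 0 → w x < 1 := fun x hx =>
    V.mem_nonunits_iff.1 (hmV ⟨x, hx, rfl⟩)
  let f : Γ → Matrix (Fin n) (Fin n) k := fun g =>
    Matrix.of fun i j => π ⟨M g i j, hMA g i j⟩
  let H : Subgroup Γ :=
    { carrier := {g | ∀ i j, w ((M g - 1) i j) < 1}
      one_mem' := fun i j => by simp [hMone]
      mul_mem' := by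
        intro g h hg hh i j
        have h1 : M (g * h) - 1 = M g * (M h - 1) + (M g - 1) := by rw [hMmul]; noncomm_ring
        rw [h1, Matrix.add_apply, Matrix.mul_apply]
        refine w.map_add_lt (w.map_sum_lt one_ne_zero fun k _ => ?_) (hg i j)
        exact w.mul_lt_one (hwA _ (hMA g i k)) (hh k j)
      inv_mem' := by
        intro g hg i j
        have h1 : M g⁻¹ - 1 = M g⁻¹ * (-(M g - 1)) := by
          have : M g⁻¹ * M g = 1 := by rw [← hMmul, inv_mul_cancel, hMone]
          rw [mul_neg, mul_sub, this]; simp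
        rw [h1, Matrix.mul_apply]
        refine w.map_sum_lt one_ne_zero fun k _ => ?_
        refine w.mul_lt_one (hwA _ (hMA _ i k)) ?_
        rw [Matrix.neg_apply, Valuation.map_neg]
        exact hg k j }
  have hH : H.FiniteIndex := by
    refine H.finiteIndex_of_finite_range f (Set.toFinite _) fun g g' hgg i j => ?_
    have h1 : M (g⁻¹ * g') - 1 = M g⁻¹ * (M g' - M g) := by
      have : M g⁻¹ * M g = 1 := by rw [← hMmul, inv_mul_cancel, hMone]
      rw [mul_sub, this, hMmul]
    rw [h1, Matrix.mul_apply]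
    refine w.map_sum_lt one_ne_zero fun k _ => ?_
    refine w.mul_lt_one (hwA _ (hMA _ i k)) ?_
    have h2 : f g' k j = f g k j := by rw [hgg]
    refine hwm (⟨M g' k j, hMA g' k j⟩ - ⟨M g k j, hMA g k j⟩) ?_
    rw [map_sub, sub_eq_zero]
    exact h2
  obtain ⟨p, hp⟩ := CharP.exists k
  have hpp : p.Prime := by
    rcases CharP.char_is_prime_or_zero k p with h | rfl
    · exact h
    · have := CharP.charP_to_charZero k
      exact absurd (Nat.cast_injective (R := k)) (not_injective_infinite_finite _)
  have hwp : w (p : F) < 1 := by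
    refine hwm (p : A) ?_
    rw [map_natCast]
    exact CharP.cast_eq_zero k p
  have hwnat : ∀ r : ℕ, w (r : F) ≤ 1 := fun r => hwA _ (natCast_mem A r)
  have hwprime : ∀ r : ℕ, ¬ p ∣ r → ¬ w (r : F) < 1 := by
    intro r hr hlt
    have h1 : (1 : ℤ) = Nat.gcdA p r * p + Nat.gcdB p r * r := by
      have := Nat.gcd_eq_gcd_ab p r
      rw [(Nat.Prime.coprime_iff_not_dvd hpp).2 hr] at this
      push_cast at this; linarith
    have h2 : (1 : F) = (Nat.gcdA p r : ℤ) * (p : F) + (Nat.gcdB p r : ℤ) * (r : F) := by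
      have := congrArg (Int.cast : ℤ → F) h1
      push_cast at this; exact this
    have h3 : w (1 : F) < 1 := by
      rw [h2]
      refine w.map_add_lt ?_ ?_
      · exact w.mul_lt_one (hwA _ (intCast_mem A _)) hwp
      · exact w.mul_lt_one (hwA _ (intCast_mem A _)) hlt
    simp at h3
  have heig : ∀ h ∈ H, ∀ a, IsEig (ρ h) a → w (a - 1) < 1 := by
    rintro h hh a ⟨x, hx, hxa⟩
    obtain ⟨i, hi⟩ : ∃ i, ∀ j, w (B.repr x j) ≤ w (B.repr x i) := by
      have : Nonempty (Fin n) := by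
        by_contra hne
        rw [not_nonempty_iff] at hne
        exact hx (B.ext_elem fun i => (hne.false i).elim)
      exact Finite.exists_max fun j => w (B.repr x j)
    have hi0 : 0 < w (B.repr x i) := by
      rw [zero_lt_iff]
      intro h0
      apply hx
      refine B.ext_elem fun j => ?_
      have := hi j
      rw [h0, le_zero_iff, w.zero_iff] at this
      simpa using this
    have h1 : (M h - 1).mulVec (B.repr x) i = (a - 1) * B.repr x i := by
      rw [Matrix.sub_mulVec, Matrix.one_mulVec]
      have : (M h).mulVec (B.repr x) = B.repr (ρ h x) := LinearMap.toMatrix_mulVec_repr B B _ _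
      rw [this, hxa]
      simp [sub_mul]
    have h2 : w ((M h - 1).mulVec (B.repr x) i) < w (B.repr x i) := by
      rw [Matrix.mulVec, dotProduct]
      refine w.map_sum_lt hi0.ne' fun k _ => ?_
      rw [map_mul]
      calc w ((M h - 1) i k) * w (B.repr x k) ≤ w ((M h - 1) i k) * w (B.repr x i) :=
            mul_le_mul_right (hi k) _
        _ < 1 * w (B.repr x i) := mul_lt_mul_of_pos_right (hh i k) hi0
        _ = _ := one_mul _
    rw [h1, map_mul] at h2
    exact lt_of_mul_lt_mul_right' (by rwa [one_mul])
  refine ⟨H, p, hH, fun hpq => ?_, ?_, fun h hh a b ha hb r hr hab => ?_⟩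
  · obtain ⟨c, rfl⟩ := hpq
    have h1 : w ((p * c : ℕ) : F) < 1 := by
      rw [Nat.cast_mul, mul_comm]; exact w.mul_lt_one (hwnat c) hwp
    have h2 := hwA _ hqA
    rw [map_inv₀] at h2
    have h3 : w ((p * c : ℕ) : F) ≠ 0 := by rwa [Ne, w.zero_iff]
    rw [inv_le_one₀ (zero_lt_iff.2 h3)] at h2
    exact absurd h1 h2.not_gt
  · obtain ⟨e, he⟩ := CharP.exists F
    rcases CharP.char_is_prime_or_zero F e with h | rfl
    · left
      by_cases hpe : p ∣ e
      · rw [(Nat.prime_dvd_prime_iff_eq hpp h).1 hpe]; exact CharP.cast_eq_zero F e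
      · exact absurd (by rw [CharP.cast_eq_zero F e, map_zero]; exact one_pos) (hwprime e hpe)
    · exact Or.inr (CharP.charP_to_charZero F)
  · by_cases hne : a = b
    · exact Or.inl hne
    right
    have hb0 : b ≠ 0 := hb.ne_zero
    set η := a * b⁻¹ with hη
    have hη1 : w (η - 1) < 1 := w.sub_one_mul (heig h hh a ha) (w.sub_one_inv (heig h hh b hb))
    have hηr : η ^ r = 1 := by rw [hη, mul_pow, hab, ← mul_pow, mul_inv_cancel₀ hb0, one_pow]
    have hηne : η - 1 ≠ 0 := by
      rw [hη, sub_ne_zero]; intro h1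
      exact hne ((mul_inv_eq_one₀ hb0).1 h1)
    have hsum : ∑ i ∈ Finset.range r, η ^ i = 0 := by
      have := geom_sum_mul η r
      rw [hηr, sub_self] at this
      exact (mul_eq_zero.1 this).resolve_right hηne
    have h1 : (r : F) = - ∑ i ∈ Finset.range r, (η ^ i - 1) := by
      rw [Finset.sum_sub_distrib, hsum]; simp
    have h2 : w (r : F) < 1 := by
      rw [h1, Valuation.map_neg]
      exact w.map_sum_lt one_ne_zero fun i _ => w.sub_one_pow hη1 i
    by_contra hrp
    refine hwprime r (fun hdvd => hrp ?_) h2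
    exact ((Nat.prime_dvd_prime_iff_eq hpp hr).1 hdvd).symm

end EigenvalueRatio

section SingleEigenvalue

variable {F Γ U : Type*} [Field F] [Group Γ] [AddCommGroup U] [Module F U] [FiniteDimensional F U]

theorem exists_single_eigenvalue [Group.FG Γ] (ρ : Γ →* (U →ₗ[F] U))
    (hroot : ∀ g a b, IsEig (ρ g) a → IsEig (ρ g) b → ∃ n, 0 < n ∧ a ^ n = b ^ n) :
    ∃ H : Subgroup Γ, H.FiniteIndex ∧
      ∀ h ∈ H, ∀ a b, IsEig (ρ h) a → IsEig (ρ h) b → a = b := by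
  suffices key : ∃ H : Subgroup Γ, H.FiniteIndex ∧ ∀ h ∈ H, ∀ a b, IsEig (ρ h) a →
      IsEig (ρ h) b → ∀ r, r.Prime → a ^ r = b ^ r → a = b by
    obtain ⟨H, hH, h⟩ := key
    refine ⟨H, hH, fun g hg a b ha hb => ?_⟩
    obtain ⟨n, hn, hab⟩ := hroot g a b ha hb
    clear hroot
    induction n using Nat.strong_induction_on with
    | _ n ih =>
    rcases Nat.lt_or_ge 1 n with h1 | h1
    · obtain ⟨r, hr, m, rfl⟩ := Nat.exists_prime_and_dvd h1.ne'
      have hm : 0 < m := Nat.pos_of_mul_pos_left hn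
      refine ih m (by nlinarith [hr.two_le]) hm ?_
      refine h (g ^ m) (H.pow_mem hg m) _ _ (by rw [map_pow]; exact ha.pow m)
        (by rw [map_pow]; exact hb.pow m) r hr ?_
      rw [← pow_mul, ← pow_mul, mul_comm m r]; exact hab
    · obtain rfl : n = 1 := by omega
      simpa using hab
  obtain ⟨H, p, hH, hp1, hpF, h⟩ := exists_residue ρ 1 (by simp)
  by_cases hp0 : (p : F) = 0
  · refine ⟨H, hH, fun g hg a b ha hb r hr hab => ?_⟩
    rcases h g hg a b ha hb r hr hab with h1 | rfl
    · exact h1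
    · have : CharP F r := (CharP.charP_iff_prime_eq_zero hr).2 hp0
      have : Fact r.Prime := ⟨hr⟩
      exact frobenius_inj F r hab
  · have := hpF.resolve_left hp0
    obtain ⟨H', p', hH', hp1', hpF', h'⟩ := exists_residue ρ p hp0
    refine ⟨H ⊓ H', inferInstance, fun g hg a b ha hb r hr hab => ?_⟩
    rcases h g hg.1 a b ha hb r hr hab with h1 | rfl
    · exact h1
    rcases h' g hg.2 a b ha hb r hr hab with h1 | rfl
    · exact h1
    · exact absurd dvd_rfl hp1'

theorem span_range_eq_top [IsAlgClosed F] [Nontrivial U] (ρ : Γ →* (U →ₗ[F] U))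
    (hirr : ∀ W : Submodule F U, (∀ g, ∀ x ∈ W, ρ g x ∈ W) → W = ⊥ ∨ W = ⊤) :
    Submodule.span F (Set.range ρ) = ⊤ := by
  set A := Algebra.adjoin F (Set.range ρ) with hA
  have hsimple : IsSimpleModule A U := by
    rw [isSimpleModule_iff]
    refine { exists_pair_ne := ⟨⊥, ⊤, bot_ne_top⟩, eq_bot_or_eq_top := fun W => ?_ }
    have h1 := hirr (W.restrictScalars F) fun g x hx => by
      have : (⟨ρ g, Algebra.subset_adjoin ⟨g, rfl⟩⟩ : A) • x ∈ W := W.smul_mem _ hx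
      exact this
    simpa using h1
  have hschur := IsSimpleModule.algebraMap_end_bijective_of_isAlgClosed (A := A) (V := U) F
  rw [eq_top_iff]
  intro T _
  have hT : T ∈ A := by
    let T' : Module.End (Module.End A U) U :=
      { toFun := T
        map_add' := map_add T
        map_smul' := by
          intro f x
          obtain ⟨c, rfl⟩ := hschur.2 f
          simp }
    obtain ⟨s, hs⟩ := (Module.finite_def (R := F) (M := U)).1 inferInstance
    obtain ⟨r, hr⟩ := jacobson_density (R := A) T' s
    have : T = r.1 := by
      refine LinearMap.ext_on hs fun x hx => ?_
      exact hr x hx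
    rw [this]; exact r.2
  have h2 : Subalgebra.toSubmodule A = Submodule.span F (Set.range ρ) := by
    refine Algebra.adjoin_eq_span_of_subset (R := F) (A := U →ₗ[F] U) ?_
    have : Set.range ρ = (MonoidHom.mrange ρ : Set (U →ₗ[F] U)) := rfl
    rw [this, Submonoid.closure_eq]
    exact Submodule.subset_span
  rw [← h2]; exact hT

theorem exists_scalar_subgroup [IsAlgClosed F] [Nontrivial U] (ρ : Γ →* (U →ₗ[F] U))
    (hirr : ∀ W : Submodule F U, (∀ g, ∀ x ∈ W, ρ g x ∈ W) → W = ⊥ ∨ W = ⊤)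
    (hsingle : ∀ h a b, IsEig (ρ h) a → IsEig (ρ h) b → a = b) :
    ∃ K : Subgroup Γ, K.FiniteIndex ∧ ∀ k ∈ K, ∃ c : F, ρ k = c • 1 := by
  classical
  have hspan := span_range_eq_top ρ hirr
  set d := Module.finrank F U with hd
  have hdpos : 0 < d := Module.finrank_pos
  have hex : ∀ g, ∃ c, IsEig (ρ g) c := by
    intro g
    obtain ⟨c, hc⟩ := Module.End.exists_eigenvalue (ρ g)
    obtain ⟨x, hx⟩ := hc.exists_hasEigenvector
    exact ⟨c, x, hx.2, hx.apply_eq_smul⟩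
  choose l hl using hex
  have hl0 : ∀ g, l g ≠ 0 := fun g => (hl g).ne_zero
  have hroots : ∀ g, (ρ g).charpoly.roots = Multiset.replicate d (l g) := by
    intro g
    rw [Multiset.eq_replicate]
    refine ⟨?_, fun c hc => ?_⟩
    · rw [← (IsAlgClosed.splits (ρ g).charpoly).natDegree_eq_card_roots,
        LinearMap.charpoly_natDegree]
    · have h1 := Polynomial.isRoot_of_mem_roots hc
      rw [← Module.End.hasEigenvalue_iff_isRoot_charpoly] at h1
      obtain ⟨x, hx⟩ := h1.exists_hasEigenvector
      exact hsingle g _ _ ⟨x, hx.2, hx.apply_eq_smul⟩ (hl g)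
  have hdet : ∀ g, LinearMap.det (ρ g) = l g ^ d := by
    intro g
    rw [Module.End.det_eq_prod_roots_charpoly_of_splits (IsAlgClosed.splits _), hroots]
    simp
  have htr : ∀ g, LinearMap.trace F U (ρ g) = d * l g := by
    intro g
    rw [Module.End.trace_eq_sum_roots_charpoly_of_splits (IsAlgClosed.splits _), hroots]
    simp
  obtain ⟨b, hb, hbspan, hbind⟩ := exists_linearIndependent F (Set.range ρ)
  have hbfin : b.Finite := hbind.setFinite
  have : Finite b := hbfin
  choose κ hκ using fun x : b => hb x.2
  let f : Γ → b → F := fun g x => (l g)⁻¹ * l (g * κ x)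
  have hf : (Set.range f).Finite := by
    refine (Set.Finite.pi' (t := fun x => {y : F | y ^ d = l (κ x) ^ d}) fun x => ?_).subset ?_
    · refine (Polynomial.nthRoots d (l (κ x) ^ d)).toFinset.finite_toSet.subset fun y hy => ?_
      rw [Finset.mem_coe, Multiset.mem_toFinset]
      exact (Polynomial.mem_nthRoots hdpos).2 hy
    · rintro _ ⟨g, rfl⟩ x
      show ((l g)⁻¹ * l (g * κ x)) ^ d = l (κ x) ^ d
      have h1 : l (g * κ x) ^ d = l g ^ d * l (κ x) ^ d := by
        rw [← hdet, ← hdet, ← hdet, map_mul, map_mul]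
      have h2 := hl0 g
      rw [mul_pow, h1, inv_pow]
      field_simp
  let K : Subgroup Γ :=
    { carrier := {k | ∃ c : F, ρ k = c • 1}
      one_mem' := ⟨1, by simp⟩
      mul_mem' := by
        rintro x y ⟨c, hc⟩ ⟨e, he⟩
        exact ⟨c * e, by rw [map_mul, hc, he, smul_mul_smul_comm, one_mul]⟩
      inv_mem' := by
        rintro x ⟨c, hc⟩
        refine ⟨c⁻¹, ?_⟩
        have h1 : ρ x⁻¹ * ρ x = 1 := by rw [← map_mul]; simp
        have hc0 : c ≠ 0 := by
          rintro rfl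
          rw [hc, zero_smul, mul_zero] at h1
          exact zero_ne_one h1
        rw [hc, mul_smul_comm, mul_one] at h1
        rw [← h1, smul_smul, inv_mul_cancel₀ hc0, one_smul] }
  refine ⟨K, K.finiteIndex_of_finite_range f hf fun g g' hgg => ?_, fun k hk => hk⟩
  have htrace : ∀ X : U →ₗ[F] U, LinearMap.trace F U (((l g)⁻¹ • ρ g) * X) =
      LinearMap.trace F U (((l g')⁻¹ • ρ g') * X) := by
    intro X
    have hX : X ∈ Submodule.span F b := by rw [hbspan, hspan]; trivial
    induction hX using Submodule.span_induction with
    | mem X hX =>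
      have h1 : ρ (κ ⟨X, hX⟩) = X := hκ ⟨X, hX⟩
      have h2 : (l g)⁻¹ * l (g * κ ⟨X, hX⟩) = (l g')⁻¹ * l (g' * κ ⟨X, hX⟩) :=
        congrFun hgg ⟨X, hX⟩
      rw [← h1, smul_mul_assoc, smul_mul_assoc, ← map_mul, ← map_mul, map_smul, map_smul, htr, htr,
        smul_eq_mul, smul_eq_mul, mul_left_comm, h2, mul_left_comm]
    | zero => simp
    | add X Y _ _ h1 h2 => rw [mul_add, mul_add, map_add, map_add, h1, h2]
    | smul c X _ h1 => rw [mul_smul_comm, mul_smul_comm, map_smul, map_smul, h1]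
  have heq : (l g)⁻¹ • ρ g = (l g')⁻¹ • ρ g' := by
    set B := Module.finBasis F U
    apply (LinearMap.toMatrixAlgEquiv B).injective
    rw [Matrix.ext_iff_trace_mul_right]
    intro x
    have h1 := htrace ((LinearMap.toMatrixAlgEquiv B).symm x)
    rw [LinearMap.trace_eq_matrix_trace F B, LinearMap.trace_eq_matrix_trace F B] at h1
    change Matrix.trace (LinearMap.toMatrixAlgEquiv B _) =
      Matrix.trace (LinearMap.toMatrixAlgEquiv B _) at h1
    rw [map_mul, map_mul, AlgEquiv.apply_symm_apply] at h1
    exact h1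
  refine ⟨l g' * (l g)⁻¹, ?_⟩
  have h1 : ρ g' = (l g' * (l g)⁻¹) • ρ g := by
    rw [mul_smul, heq, smul_smul, mul_inv_cancel₀ (hl0 g'), one_smul]
  rw [map_mul, h1, mul_smul_comm, ← map_mul, inv_mul_cancel, map_one]

end SingleEigenvalue

section Triangular

theorem Subgroup.finiteIndex_map_subtype {Γ : Type*} [Group Γ] (H : Subgroup Γ) (K : Subgroup H)
    (hH : H.FiniteIndex) (hK : K.FiniteIndex) : (K.map H.subtype).FiniteIndex :=
  ⟨by rw [Subgroup.index_map_subtype]; exact mul_ne_zero hK.index_ne_zero hH.index_ne_zero⟩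

theorem finrank_eq_one_of_strongly_irreducible {F Γ U : Type*} [Field F] [Countable F]
    [IsAlgClosed F] [Group Γ] [Group.FG Γ] (m : InvMean Γ) [AddCommGroup U] [Module F U]
    [FiniteDimensional F U] [Nontrivial U] (ρ : Γ →* (U →ₗ[F] U))
    (hSI : ∀ H : Subgroup Γ, H.FiniteIndex → ∀ W : Submodule F U,
      (∀ h ∈ H, ∀ x ∈ W, ρ h x ∈ W) → W = ⊥ ∨ W = ⊤) :
    Module.finrank F U = 1 := by
  have key : ∀ γ x y, x ≠ 0 → y ≠ 0 → ∀ a b : F, ρ γ x = a • x → ρ γ y = b • y →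
      ∀ v : AbsoluteValue F ℝ, ¬ v b < v a := by
    intro γ x y hx0 hy0 a b hx hy v hab
    obtain ⟨W, hbot, htop, hfin⟩ := m.exists_finite_orbit ρ v γ x y hx0 hy0 a b hx hy hab
    have hmul : ∀ g h : Γ, W.map (ρ (g * h)) = (W.map (ρ h)).map (ρ g) := by
      intro g h
      rw [map_mul, ← Submodule.map_comp]
      rfl
    have hone : W.map (ρ 1) = W := by
      rw [map_one]
      exact Submodule.map_id W
    let K : Subgroup Γ :=
      { carrier := {h | W.map (ρ h) = W}
        one_mem' := hone
        mul_mem' := fun {g h} hg hh => by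
          show W.map (ρ (g * h)) = W
          rw [hmul, hh, hg]
        inv_mem' := fun {g} hg => by
          show W.map (ρ g⁻¹) = W
          have : W.map (ρ g) = W := hg
          nth_rw 1 [← this]
          rw [← hmul, inv_mul_cancel, hone] }
    have hK : K.FiniteIndex := K.finiteIndex_of_finite_range _ hfin fun g g' h => by
      show W.map (ρ (g⁻¹ * g')) = W
      rw [hmul, ← h, ← hmul, inv_mul_cancel, hone]
    rcases hSI K hK W fun h hh x hx => by
      have : W.map (ρ h) = W := hh
      rw [← this]
      exact Submodule.mem_map_of_mem hx with h | h
    · exact hbot h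
    · exact htop h
  obtain ⟨H, hH, hsingle⟩ := exists_single_eigenvalue ρ fun g a b ha hb => by
    by_contra hno
    push Not at hno
    have ha0 := ha.ne_zero
    have hb0 := hb.ne_zero
    obtain ⟨P⟩ := nonempty_place (Units.mk0 (a / b) (div_ne_zero ha0 hb0)) fun n hn h => by
      apply hno n hn
      have h1 := congrArg Units.val h
      simp only [Units.val_pow_eq_pow_val, Units.val_mk0, Units.val_one, div_pow] at h1
      exact (div_eq_one_iff_eq (pow_ne_zero _ hb0)).1 h1
    have h1 : P.v (a / b) ≠ 1 := P.v_ne_one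
    obtain ⟨x, hx0, hx⟩ := ha
    obtain ⟨y, hy0, hy⟩ := hb
    apply h1
    rw [map_div₀, div_eq_one_iff_eq (P.v.ne_zero hb0)]
    exact le_antisymm (not_lt.1 (key g x y hx0 hy0 a b hx hy P.v))
      (not_lt.1 (key g y x hy0 hx0 b a hy hx P.v))
  obtain ⟨K, hK, hscalar⟩ := exists_scalar_subgroup (ρ.comp H.subtype)
    (fun W hW => hSI H hH W fun h hh x hx => hW ⟨h, hh⟩ x hx)
    (fun h a b ha hb => hsingle h h.2 a b ha hb)
  obtain ⟨x, hx⟩ := exists_ne (0 : U)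
  have := hSI _ (H.finiteIndex_map_subtype K hH hK) (F ∙ x) (by
    rintro _ ⟨k, hk, rfl⟩ y hy
    obtain ⟨c, hc⟩ := hscalar k hk
    have h1 : ρ (H.subtype k) = c • 1 := hc
    rw [h1]
    exact Submodule.smul_mem _ c hy)
  rcases this with h | h
  · exact absurd (Submodule.span_singleton_eq_bot.1 h) hx
  · rw [← finrank_top, ← h, finrank_span_singleton hx]

/-- The restriction of a representation to a stable subspace. -/
def MonoidHom.restrictSubmodule {F Γ U : Type*} [Field F] [Group Γ] [AddCommGroup U] [Module F U]
    (ρ : Γ →* (U →ₗ[F] U)) (W : Submodule F U) (hW : ∀ g, ∀ x ∈ W, ρ g x ∈ W) :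
    Γ →* (W →ₗ[F] W) where
  toFun g := (ρ g).restrict (hW g)
  map_one' := by ext; simp
  map_mul' g h := by ext; simp

theorem exists_stable_line {F Γ U : Type*} [Field F] [Countable F]
    [IsAlgClosed F] [Group Γ] [Group.FG Γ] (m : InvMean Γ) [AddCommGroup U] [Module F U]
    [FiniteDimensional F U] [Nontrivial U] (ρ : Γ →* (U →ₗ[F] U)) :
    ∃ H : Subgroup Γ, H.FiniteIndex ∧ ∃ x : U, x ≠ 0 ∧ ∀ h ∈ H, ∃ c : F, ρ h x = c • x := by
  classical
  let p : ℕ → Prop := fun d => ∃ H : Subgroup Γ, H.FiniteIndex ∧ ∃ W : Submodule F U, W ≠ ⊥ ∧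
    Module.finrank F W = d ∧ ∀ h ∈ H, ∀ x ∈ W, ρ h x ∈ W
  have hp : ∃ d, p d := ⟨_, ⊤, inferInstance, ⊤, top_ne_bot, rfl, fun _ _ _ _ => trivial⟩
  obtain ⟨H, hH, W, hW0, hWd, hW⟩ := Nat.find_spec hp
  have hmin : ∀ d, p d → Nat.find hp ≤ d := fun d hd => Nat.find_min' hp hd
  have : Nontrivial W := Submodule.nontrivial_iff_ne_bot.2 hW0
  obtain ⟨m'⟩ := m.subgroup H
  have h1 := finrank_eq_one_of_strongly_irreducible m'
    ((ρ.comp H.subtype).restrictSubmodule W fun g => hW g g.2) (by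
    intro K hK V hV
    by_cases hV0 : V = ⊥
    · exact Or.inl hV0
    right
    have h2 := hmin (Module.finrank F V) ⟨K.map H.subtype, H.finiteIndex_map_subtype K hH hK,
      V.map W.subtype, fun h => hV0 (Submodule.map_injective_of_injective W.injective_subtype
        (h.trans (Submodule.map_bot _).symm)),
      W.finrank_map_subtype_eq V, by
        rintro _ ⟨k, hk, rfl⟩ _ ⟨x, hx, rfl⟩
        exact ⟨_, hV k hk x hx, rfl⟩⟩
    exact Submodule.eq_top_of_finrank_eq (le_antisymm V.finrank_le (hWd ▸ h2)))
  obtain ⟨x, hx⟩ := exists_ne (0 : W)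
  refine ⟨H, hH, x, fun h => hx (Subtype.ext h), fun h hh => ?_⟩
  obtain ⟨c, hc⟩ := (finrank_eq_one_iff_of_nonzero' x hx).1 h1 ⟨ρ h x, hW h hh x x.2⟩
  exact ⟨c, (congrArg Subtype.val hc).symm⟩

theorem exists_triangular_basis {F : Type*} [Field F] [Countable F] [IsAlgClosed F] (n : ℕ) :
    ∀ {Γ U : Type*} [Group Γ] [Group.FG Γ] (_ : InvMean Γ) [AddCommGroup U] [Module F U]
    [FiniteDimensional F U] (_ : Module.finrank F U = n) (ρ : Γ →* (U →ₗ[F] U)),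
    ∃ H : Subgroup Γ, H.FiniteIndex ∧ ∃ b : Module.Basis (Fin n) F U,
      ∀ h ∈ H, ∀ i j, i < j → b.repr (ρ h (b j)) i = 0 := by
  induction n with
  | zero =>
    intro Γ U _ _ m _ _ _ hU ρ
    exact ⟨⊤, inferInstance, Module.finBasisOfFinrankEq F U hU, fun _ _ i => i.elim0⟩
  | succ n ih =>
    intro Γ U _ _ m _ _ _ hU ρ
    have : Nontrivial U := Module.nontrivial_of_finrank_pos (R := F) (by omega)
    let σ : Γ →* (Module.Dual F U →ₗ[F] Module.Dual F U) :=
      { toFun := fun g => (ρ g⁻¹).dualMap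
        map_one' := by ext; simp
        map_mul' := fun g h => by ext; simp }
    obtain ⟨H, hH, ξ, hξ, hst⟩ := exists_stable_line m σ
    have hker : ∀ h ∈ H, ∀ x, ∃ c, ξ (ρ h x) = c * ξ x := by
      intro h hh x
      obtain ⟨c, hc⟩ := hst h⁻¹ (H.inv_mem hh)
      refine ⟨c, ?_⟩
      have := LinearMap.congr_fun hc x
      simpa [σ] using this
    have hker' : ∀ h ∈ H, ∀ x ∈ LinearMap.ker ξ, ρ h x ∈ LinearMap.ker ξ := by
      intro h hh x hx
      obtain ⟨c, hc⟩ := hker h hh x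
      rw [LinearMap.mem_ker] at hx ⊢
      rw [hc, hx, mul_zero]
    obtain ⟨m'⟩ := m.subgroup H
    have hd : Module.finrank F (LinearMap.ker ξ) = n := by
      have := Module.Dual.finrank_ker_add_one_of_ne_zero hξ
      omega
    obtain ⟨K, hK, b, hb⟩ := ih m' hd
      ((ρ.comp H.subtype).restrictSubmodule (LinearMap.ker ξ) fun g => hker' g g.2)
    obtain ⟨y, hy⟩ : ∃ y, ξ y ≠ 0 := by
      by_contra hno
      push Not at hno
      exact hξ (LinearMap.ext hno)
    let B := Module.Basis.mkFinCons y b (by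
      intro c x hx h
      have := congrArg ξ h
      rw [map_add, map_smul, LinearMap.mem_ker.1 hx, add_zero, map_zero, smul_eq_mul] at this
      exact (mul_eq_zero.1 this).resolve_right hy) (by
      intro z
      refine ⟨-(ξ z / ξ y), ?_⟩
      rw [LinearMap.mem_ker, map_add, map_smul, smul_eq_mul]
      field_simp
      ring)
    have hB0 : B 0 = y := by simp [B, Module.Basis.coe_mkFinCons]
    have hBs : ∀ i, B (Fin.succ i) = b i := fun i => by simp [B, Module.Basis.coe_mkFinCons]
    have hker0 : ∀ x : LinearMap.ker ξ, ∀ i, B.repr x i =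
        (Fin.cons (0 : F) (fun i => b.repr x i) : Fin (n + 1) → F) i := by
      intro x
      have : (x : U) = ∑ i, (Fin.cons (0 : F) (fun i => b.repr x i) : Fin (n + 1) → F) i • B i := by
        rw [Fin.sum_univ_succ]
        simp only [Fin.cons_zero, Fin.cons_succ, zero_smul, zero_add, hBs]
        have := congrArg Subtype.val (b.sum_repr x)
        rw [Submodule.coe_sum] at this
        exact this.symm
      intro i
      conv_lhs => rw [this]
      rw [B.repr_sum_self]
    refine ⟨K.map H.subtype, H.finiteIndex_map_subtype K hH hK, B, ?_⟩
    rintro _ ⟨k, hk, rfl⟩ i j hij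
    obtain ⟨j, rfl⟩ := Fin.exists_succ_eq.2 (Fin.ne_zero_of_lt hij)
    rw [hBs]
    have h1 := hker0 ⟨ρ k (b j), hker' k k.2 _ (b j).2⟩ i
    refine h1.trans ?_
    refine Fin.cases ?_ (fun i => ?_) i (motive := fun i => i < j.succ → (Fin.cons (0 : F) _ : Fin (n + 1) → F) i = 0) hij
    · intro _; rfl
    · intro hij
      rw [Fin.cons_succ]
      exact hb k hk i j (Fin.succ_lt_succ_iff.1 hij)

end Triangular

section Decoupling

open Matrix

variable {F H : Type*} [Field F] [Group H] {n : ℕ}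

/-- The matrix coefficients of `T` are lower triangular with diagonal characters `δ`. -/
def IsLowerRep (T : H →* Matrix (Fin n) (Fin n) F) (δ : Fin n → H → F) : Prop :=
  (∀ g i j, i < j → T g i j = 0) ∧ ∀ g i, T g i i = δ i g

theorem IsLowerRep.mul {T : H →* Matrix (Fin n) (Fin n) F} {δ : Fin n → H → F}
    (hT : IsLowerRep T δ) (i : Fin n) (g h : H) : δ i (g * h) = δ i g * δ i h := by
  rw [← hT.2, ← hT.2, ← hT.2, map_mul, Matrix.mul_apply]
  refine Finset.sum_eq_single i (fun k _ hk => ?_) fun h => absurd (Finset.mem_univ i) h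
  rcases lt_or_gt_of_ne hk with h1 | h1
  · rw [hT.1 h k i h1, mul_zero]
  · rw [hT.1 g i k h1, zero_mul]

theorem IsLowerRep.one {T : H →* Matrix (Fin n) (Fin n) F} {δ : Fin n → H → F}
    (hT : IsLowerRep T δ) (i : Fin n) : δ i 1 = 1 := by
  rw [← hT.2, map_one, Matrix.one_apply_eq]

theorem IsLowerRep.ne_zero {T : H →* Matrix (Fin n) (Fin n) F} {δ : Fin n → H → F}
    (hT : IsLowerRep T δ) (i : Fin n) (g : H) : δ i g ≠ 0 := fun h => by
  have := hT.mul i g g⁻¹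
  rw [mul_inv_cancel, hT.one, h, zero_mul] at this
  exact one_ne_zero this

theorem IsLowerRep.decouple_step {T : H →* Matrix (Fin n) (Fin n) F} {δ : Fin n → H → F}
    (hT : IsLowerRep T δ) (hinj : Function.Injective T) (d : ℕ)
    (hd : ∀ g (i j : Fin n), (i : ℕ) < j + d → δ i ≠ δ j → T g i j = 0)
    (hcb : ∀ i j, δ i ≠ δ j → ∀ b : H → F, (∀ g h, b (g * h) = b g + δ i g / δ j g * b h) →
      ∃ c, ∀ g, b g = (δ i g / δ j g - 1) * c) :
    ∃ T' : H →* Matrix (Fin n) (Fin n) F, IsLowerRep T' δ ∧ Function.Injective T' ∧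
      ∀ g (i j : Fin n), (i : ℕ) < j + (d + 1) → δ i ≠ δ j → T' g i j = 0 := by
  classical
  have hc : ∀ (i j : Fin n), ∃ c : F, (i : ℕ) = j + d → δ i ≠ δ j →
      ∀ g, T g i j = (δ i g - δ j g) * c := by
    intro i j
    by_cases h : (i : ℕ) = j + d ∧ δ i ≠ δ j
    · obtain ⟨h1, h2⟩ := h
      have hij : i ≠ j := fun h => h2 (by rw [h])
      obtain ⟨c, hc⟩ := hcb i j h2 (fun g => T g i j / δ j g) (by
        intro g h
        have h3 : T (g * h) i j = δ i g * T h i j + T g i j * δ j h := by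
          rw [map_mul, Matrix.mul_apply, ← hT.2, ← hT.2]
          refine Finset.sum_eq_add i j hij (fun k _ hk => ?_)
            (fun h => absurd (Finset.mem_univ i) h) (fun h => absurd (Finset.mem_univ j) h)
          rcases lt_or_gt_of_ne hk.1 with hki | hki
          · rcases lt_or_gt_of_ne hk.2 with hkj | hkj
            · rw [hT.1 h k j hkj, mul_zero]
            · by_cases h4 : δ i = δ k
              · rw [hd h k j (by omega) (h4 ▸ h2), mul_zero]
              · rw [hd g i k (by omega) h4, zero_mul]
          · rw [hT.1 g i k hki, zero_mul]
        have h4 := hT.ne_zero j g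
        have h5 := hT.ne_zero j h
        show T (g * h) i j / δ j (g * h) = _
        rw [h3, hT.mul j]
        field_simp
        ring)
      refine ⟨c, fun _ _ g => ?_⟩
      have h4 := hT.ne_zero j g
      have := hc g
      field_simp at this
      linear_combination this
    · exact ⟨0, fun h1 h2 => absurd ⟨h1, h2⟩ h⟩
  choose c hc using hc
  let N : Matrix (Fin n) (Fin n) F := fun i j => if (i : ℕ) = j + d ∧ δ i ≠ δ j then c i j else 0
  have hN : ∀ (i j : Fin n), (i : ℕ) ≠ j + d → N i j = 0 := fun i j h => if_neg fun h1 => h h1.1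
  have hNR : ∀ i j, δ i = δ j → N i j = 0 := fun i j h => if_neg fun h1 => h1.2 h
  have hN' : ∀ (i j : Fin n), (i : ℕ) = j + d → δ i ≠ δ j → N i j = c i j := fun i j h1 h2 => if_pos ⟨h1, h2⟩
  have hNlow : ∀ i j, i < j → N i j = 0 := fun i j h => hN i j (by omega)
  have hPlow : (1 + N).BlockTriangular OrderDual.toDual := by
    intro i j h
    have h1 : i < j := h
    rw [Matrix.add_apply, Matrix.one_apply_ne h1.ne, hNlow i j h1, add_zero]
  have hdet : IsUnit (1 + N).det := by
    rw [Matrix.det_of_isLowerTriangular _ hPlow]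
    have : ∀ i, (1 + N) i i = 1 := fun i => by
      rw [Matrix.add_apply, Matrix.one_apply_eq, hNR i i rfl, add_zero]
    simp [this]
  let u : (Matrix (Fin n) (Fin n) F)ˣ := Matrix.nonsingInvUnit (1 + N) hdet
  let T' : H →* Matrix (Fin n) (Fin n) F :=
    { toFun := fun g => u * T g * (u⁻¹ : (Matrix (Fin n) (Fin n) F)ˣ)
      map_one' := by simp
      map_mul' := fun g h => by
        rw [map_mul]
        simp only [mul_assoc, Units.inv_mul_cancel_left] }
  have hT'u : ∀ g, T' g * (1 + N) = (1 + N) * T g := fun g => by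
    show (u * T g * (u⁻¹ : (Matrix (Fin n) (Fin n) F)ˣ)) * (u : Matrix (Fin n) (Fin n) F) = u * T g
    simp only [mul_assoc, Units.inv_mul, mul_one]
  have hlow : ∀ g i j, i < j → T' g i j = 0 := by
    intro g
    have h1 : (T g).BlockTriangular OrderDual.toDual := fun i j h => hT.1 g i j h
    have : Invertible (1 + N) := Matrix.invertibleOfIsUnitDet _ hdet
    have h2 := Matrix.blockTriangular_inv_of_blockTriangular hPlow
    exact fun i j h => ((hPlow.mul h1).mul h2) h
  have hentry : ∀ g (i j : Fin n), (i : ℕ) ≤ j + d →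
      T' g i j = T g i j + N i j * T g j j - T' g i i * N i j := by
    intro g i j hij
    have h1 := congrFun (congrFun (hT'u g) i) j
    rw [mul_add, add_mul, mul_one, one_mul, Matrix.add_apply, Matrix.add_apply,
      Matrix.mul_apply, Matrix.mul_apply,
      Finset.sum_eq_single i (fun k _ hk => by
        rcases lt_or_gt_of_ne hk with h2 | h2
        · rw [hN k j (by omega), mul_zero]
        · rw [hlow g i k h2, zero_mul]) fun h => absurd (Finset.mem_univ i) h,
      Finset.sum_eq_single j (fun k _ hk => by
        rcases lt_or_gt_of_ne hk with h2 | h2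
        · rw [hT.1 g k j h2, mul_zero]
        · rw [hN i k (by omega), zero_mul]) fun h => absurd (Finset.mem_univ j) h] at h1
    linear_combination h1
  have hdiag : ∀ g i, T' g i i = δ i g := by
    intro g i
    rw [hentry g i i (by omega), hNR i i rfl, hT.2]
    ring
  refine ⟨T', ⟨hlow, hdiag⟩, ?_, ?_⟩
  · intro g h hgh
    apply hinj
    have : (1 + N) * T g = (1 + N) * T h := by rw [← hT'u, ← hT'u, hgh]
    exact u.isUnit.mul_left_cancel this
  · intro g i j hij hδ
    rw [hentry g i j (by omega), hdiag, hT.2]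
    by_cases h : (i : ℕ) = j + d
    · rw [hN' i j h hδ, hc i j h hδ g]
      ring
    · rw [hN i j h, hd g i j (by omega) hδ]
      ring

theorem IsLowerRep.decouple {T : H →* Matrix (Fin n) (Fin n) F} {δ : Fin n → H → F}
    (hT : IsLowerRep T δ) (hinj : Function.Injective T)
    (hcb : ∀ i j, δ i ≠ δ j → ∀ b : H → F, (∀ g h, b (g * h) = b g + δ i g / δ j g * b h) →
      ∃ c, ∀ g, b g = (δ i g / δ j g - 1) * c) (d : ℕ) :
    ∃ T' : H →* Matrix (Fin n) (Fin n) F, IsLowerRep T' δ ∧ Function.Injective T' ∧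
      ∀ g (i j : Fin n), (i : ℕ) < j + d → δ i ≠ δ j → T' g i j = 0 := by
  induction d with
  | zero => exact ⟨T, hT, hinj, fun g i j h _ => hT.1 g i j h⟩
  | succ d ih =>
    obtain ⟨T', h1, h2, h3⟩ := ih
    exact h1.decouple_step h2 d h3 hcb

/-- The matrices supported on the lower band of width `d` whose nonzero entries join equal
characters. -/
def Band (δ : Fin n → H → F) (d : ℕ) : AddSubgroup (Matrix (Fin n) (Fin n) F) where
  carrier := {X | ∀ (i j : Fin n), (i : ℕ) < j + d ∨ δ i ≠ δ j → X i j = 0}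
  zero_mem' := fun _ _ _ => rfl
  add_mem' := fun hX hY i j h => by rw [Matrix.add_apply, hX i j h, hY i j h, add_zero]
  neg_mem' := fun hX i j h => by rw [Matrix.neg_apply, hX i j h, neg_zero]

theorem mul_mem_band {K A : Type*} [Field K] {n : ℕ} {δ : Fin n → A → K} {d e : ℕ}
    {X Y : Matrix (Fin n) (Fin n) K}
    (hX : X ∈ Band δ d) (hY : Y ∈ Band δ e) : X * Y ∈ Band δ (d + e) := by
  intro i j h
  rw [Matrix.mul_apply]
  refine Finset.sum_eq_zero fun k _ => ?_
  by_cases h1 : (i : ℕ) < k + d ∨ δ i ≠ δ k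
  · rw [hX i k h1, zero_mul]
  · push Not at h1
    rw [hY k j (h.imp (fun h => by omega) fun h => h1.2 ▸ h), mul_zero]

theorem commutator_mem_band {T : H →* Matrix (Fin n) (Fin n) F} {δ : Fin n → H → F}
    (hT : IsLowerRep T δ) {d : ℕ} {X : Matrix (Fin n) (Fin n) F} (hX : X ∈ Band δ d) (g : H)
    (hg : T g ∈ Band δ 0) : X * T g - T g * X ∈ Band δ (d + 1) := by
  intro i j h
  by_cases h1 : (i : ℕ) < j + d ∨ δ i ≠ δ j
  · rw [Matrix.sub_apply, mul_mem_band hX hg i j h1,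
      mul_mem_band hg hX i j (by rwa [zero_add]), sub_zero]
  · push Not at h1
    have hij : (i : ℕ) = j + d := by
      rcases h with h | h
      · omega
      · exact absurd h1.2 h
    rw [Matrix.sub_apply, Matrix.mul_apply, Matrix.mul_apply,
      Finset.sum_eq_single j (fun k _ hk => by
        rcases lt_or_gt_of_ne hk with h2 | h2
        · rw [hT.1 g k j h2, mul_zero]
        · rw [hX i k (Or.inl (by omega)), zero_mul]) fun h => absurd (Finset.mem_univ j) h,
      Finset.sum_eq_single i (fun k _ hk => by
        rcases lt_or_gt_of_ne hk with h2 | h2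
        · rw [hX k j (Or.inl (by omega)), mul_zero]
        · rw [hT.1 g i k h2, zero_mul]) fun h => absurd (Finset.mem_univ i) h,
      hT.2, hT.2, h1.2]
    ring

theorem IsLowerRep.isNilpotent {T : H →* Matrix (Fin n) (Fin n) F} {δ : Fin n → H → F}
    (hT : IsLowerRep T δ) (hinj : Function.Injective T)
    (hdec : ∀ g i j, δ i ≠ δ j → T g i j = 0) : Group.IsNilpotent H := by
  have h0 : ∀ g, T g ∈ Band δ 0 := fun g i j h => h.elim (hT.1 g i j) (hdec g i j)
  have hone : (1 : Matrix (Fin n) (Fin n) F) ∈ Band δ 0 := map_one T ▸ h0 1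
  let K : ℕ → Subgroup H := fun d =>
    { carrier := {g | T g - 1 ∈ Band δ d}
      one_mem' := by
        show T 1 - 1 ∈ Band δ d
        rw [map_one, sub_self]
        exact zero_mem _
      mul_mem' := fun {g h} hg hh => by
        show T (g * h) - 1 ∈ Band δ d
        have : T (g * h) - 1 = T g * (T h - 1) + (T g - 1) := by
          rw [map_mul, mul_sub, mul_one]; abel
        rw [this]
        refine add_mem ?_ hg
        have := mul_mem_band (h0 g) hh
        rwa [zero_add] at this
      inv_mem' := fun {g} hg => by
        show T g⁻¹ - 1 ∈ Band δ d
        have : T g⁻¹ - 1 = -(T g⁻¹ * (T g - 1)) := by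
          rw [mul_sub, ← map_mul, inv_mul_cancel, map_one, mul_one, neg_sub]
        rw [this]
        refine neg_mem ?_
        have := mul_mem_band (h0 g⁻¹) hg
        rwa [zero_add] at this }
  rw [Subgroup.nilpotent_iff_finite_descending_central_series]
  refine ⟨n, K, ⟨?_, ?_⟩, ?_⟩
  · exact eq_top_iff.2 fun g _ => sub_mem (h0 g) hone
  · intro x d hx g
    show T (x * g * x⁻¹ * g⁻¹) - 1 ∈ Band δ (d + 1)
    have h1 : T (x * g * x⁻¹ * g⁻¹) - 1 = ((T x - 1) * T g - T g * (T x - 1)) * T (x⁻¹ * g⁻¹) := by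
      have : (T x - 1) * T g - T g * (T x - 1) = T (x * g) - T (g * x) := by
        rw [map_mul, map_mul]; noncomm_ring
      rw [this, sub_mul, ← map_mul, ← map_mul, ← map_one T]
      have h2 : x * g * (x⁻¹ * g⁻¹) = x * g * x⁻¹ * g⁻¹ := by group
      have h3 : g * x * (x⁻¹ * g⁻¹) = 1 := by group
      rw [h2, h3]
    rw [h1]
    exact mul_mem_band (e := 0) (commutator_mem_band hT hx g (h0 g)) (h0 _)
  · refine (Subgroup.eq_bot_iff_forall _).2 fun g hg => hinj ?_
    rw [map_one, ← sub_eq_zero]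
    ext i j
    exact hg i j (Or.inl (by omega))

/-- A cocycle that is not a coboundary takes the value `1` on the kernel of its character after
rescaling. -/
theorem exists_normalized_cocycle (a : H →* Fˣ) (b : H → F)
    (hb : ∀ x y, b (x * y) = b x + a x * b y) (ha : ∃ z, a z ≠ 1)
    (hnot : ¬ ∃ c, ∀ g, b g = (a g - 1) * c) :
    ∃ b' : H → F, (∀ x y, b' (x * y) = b' x + a x * b' y) ∧ ∃ t, a t = 1 ∧ b' t = 1 := by
  have : ∃ x y, b (x * y) ≠ b (y * x) := by
    by_contra hno
    push Not at hno
    obtain ⟨z, hz⟩ := ha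
    have hz' : (a z : F) - 1 ≠ 0 := fun h => hz (Units.ext (sub_eq_zero.1 h))
    refine hnot ⟨b z / (a z - 1), fun g => ?_⟩
    have := hno z g
    rw [hb, hb] at this
    field_simp
    linear_combination this
  obtain ⟨x, y, hxy⟩ := this
  set t := x * y * (y * x)⁻¹ with ht
  have hat : a t = 1 := by
    rw [ht, map_mul, map_inv, map_mul, map_mul, mul_comm (a y), mul_inv_cancel]
  have hbt : b t ≠ 0 := by
    intro h
    have := hb t (y * x)
    rw [hat, h, ht, inv_mul_cancel_right] at this
    exact hxy (by simpa using this)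
  refine ⟨fun g => b g / b t, fun x y => ?_, t, hat, div_self hbt⟩
  simp only [hb]
  field_simp

theorem IsLowerRep.isNilpotent_or_exists_cocycle {T : H →* Matrix (Fin n) (Fin n) F}
    {δ : Fin n → H → F} (hT : IsLowerRep T δ) (hinj : Function.Injective T) :
    Group.IsNilpotent H ∨ ∃ i j, δ i ≠ δ j ∧ ∃ (a : H →* Fˣ), (∀ g, (a g : F) = δ i g / δ j g) ∧
      ∃ b : H → F, (∀ x y, b (x * y) = b x + a x * b y) ∧ ∃ t, a t = 1 ∧ b t = 1 := by
  by_cases hcb : ∀ i j, δ i ≠ δ j → ∀ b : H → F,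
      (∀ g h, b (g * h) = b g + δ i g / δ j g * b h) → ∃ c, ∀ g, b g = (δ i g / δ j g - 1) * c
  · left
    obtain ⟨T', h1, h2, h3⟩ := hT.decouple hinj hcb n
    exact h1.isNilpotent h2 fun g i j => h3 g i j (by omega)
  · right
    push Not at hcb
    obtain ⟨i, j, hij, b, hb, hnot⟩ := hcb
    let a : H →* Fˣ :=
      { toFun := fun g => Units.mk0 (δ i g / δ j g) (div_ne_zero (hT.ne_zero i g) (hT.ne_zero j g))
        map_one' := by ext; simp [hT.one]
        map_mul' := fun g h => by ext; simp [hT.mul, mul_div_mul_comm] }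
    refine ⟨i, j, hij, a, fun _ => rfl, exists_normalized_cocycle a b hb ?_ ?_⟩
    · by_contra hno
      push Not at hno
      apply hij
      funext g
      have h1 : δ i g / δ j g = 1 := congrArg Units.val (hno g)
      exact (div_eq_one_iff_eq (hT.ne_zero j g)).1 h1
    · rintro ⟨c, hc⟩
      obtain ⟨g, hg⟩ := hnot c
      exact hg (hc g)

end Decoupling

section VirtuallyNilpotent

theorem exists_torsionfree_characters {Γ A ι : Type*} [Group Γ] [Group.FG Γ] [CommGroup A]
    [Finite ι] (a : ι → Γ →* A) : ∃ K : Subgroup Γ, K.FiniteIndex ∧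
      ∀ i, (∀ x ∈ K, a i x = 1) ∨ ∃ x, ∀ n : ℕ, 0 < n → a i x ^ n ≠ 1 := by
  classical
  let p : ι → Prop := fun i => ∃ x, ∀ n : ℕ, 0 < n → a i x ^ n ≠ 1
  refine ⟨⨅ i, if p i then ⊤ else (a i).ker, Subgroup.finiteIndex_iInf fun i => ?_, fun i => ?_⟩
  · split_ifs with h
    · infer_instance
    · simp only [p] at h
      push Not at h
      have hq : Finite ((a i).range ⧸ (⊥ : Subgroup (a i).range)) := by
        refine CommGroup.finite_quotient_of_pow_mem _ ?_
        rintro ⟨_, x, rfl⟩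
        obtain ⟨n, hn, hx⟩ := h x
        exact ⟨n, hn, Subgroup.mem_bot.2 (Subtype.ext hx)⟩
      have : Finite (a i).range := Finite.of_equiv _ QuotientGroup.quotientBot.toEquiv
      exact Subgroup.finiteIndex_ker (a i)
  · by_cases h : p i
    · exact Or.inr h
    · left
      intro x hx
      have := (Subgroup.mem_iInf.1 hx) i
      rw [if_neg h] at this
      exact this

theorem exists_nilpotent_of_faithful_rep {G F : Type*} [Group G] [Group.FG G] [Field F]
    [Countable F] [IsAlgClosed F] {ℓ μ : G → ℝ} {ζ : ℝ} (hμ : Nice ℓ μ ζ) (hFD : FD ℓ μ)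
    (hdom : WordDom ℓ) {n : ℕ} (ρ : G →* Matrix (Fin n) (Fin n) F) (hρ : Function.Injective ρ) :
    ∃ H : Subgroup G, H.FiniteIndex ∧ Group.IsNilpotent H := by
  obtain ⟨m⟩ := exists_invMean hμ hFD
  obtain ⟨H₁, hH₁, B, hB⟩ := exists_triangular_basis n m (Module.finrank_fin_fun F)
    ((Matrix.toLinAlgEquiv' : Matrix (Fin n) (Fin n) F ≃ₐ[F] _).toMonoidHom.comp ρ)
  let T₁ : H₁ →* Matrix (Fin n) (Fin n) F :=
    ((LinearMap.toMatrixAlgEquiv B).toMonoidHom.comp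
      ((Matrix.toLinAlgEquiv' : Matrix (Fin n) (Fin n) F ≃ₐ[F] _).toMonoidHom.comp ρ)).comp
        H₁.subtype
  have hT₁inj : Function.Injective T₁ := fun x y h => Subtype.ext (hρ
    (Matrix.toLinAlgEquiv'.injective ((LinearMap.toMatrixAlgEquiv B).injective h)))
  have hT₁ : IsLowerRep T₁ fun i g => T₁ g i i := by
    refine ⟨fun g i j hij => ?_, fun _ _ => rfl⟩
    have := hB g g.2 i j hij
    rw [← LinearMap.toMatrixAlgEquiv_apply] at this
    exact this
  let a₁ : Fin n × Fin n → H₁ →* Fˣ := fun p =>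
    { toFun := fun g => Units.mk0 (T₁ g p.1 p.1 / T₁ g p.2 p.2)
        (div_ne_zero (hT₁.ne_zero p.1 g) (hT₁.ne_zero p.2 g))
      map_one' := by ext; simp
      map_mul' := fun g h => by
        ext
        have h1 := hT₁.mul p.1 g h
        have h2 := hT₁.mul p.2 g h
        simp only [Units.val_mk0, Units.val_mul] at h1 h2 ⊢
        rw [h1, h2, mul_div_mul_comm] }
  obtain ⟨K, hK, hdich⟩ := exists_torsionfree_characters a₁
  have hK' := H₁.finiteIndex_map_subtype K hH₁ hK
  set N := (K.map H₁.subtype).normalCore with hN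
  have hNH : N ≤ H₁ := (Subgroup.normalCore_le _).trans (Subgroup.map_subtype_le K)
  have hNK : ∀ x : N, Subgroup.inclusion hNH x ∈ K := by
    intro x
    obtain ⟨k, hk, hkx⟩ := Subgroup.normalCore_le _ x.2
    have : Subgroup.inclusion hNH x = k := Subtype.ext hkx.symm
    rw [this]
    exact hk
  have hNfin : N.FiniteIndex := inferInstance
  refine ⟨N, hNfin, ?_⟩
  let T := T₁.comp (Subgroup.inclusion hNH)
  have hT : IsLowerRep T fun i g => T g i i := ⟨fun g => hT₁.1 _, fun _ _ => rfl⟩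
  refine (hT.isNilpotent_or_exists_cocycle
    (hT₁inj.comp (Subgroup.inclusion_injective hNH))).resolve_right ?_
  rintro ⟨i, j, hij, a, ha, b, hb, t, hat, hbt⟩
  have haa : ∀ g, a g = a₁ (i, j) (Subgroup.inclusion hNH g) := fun g => Units.ext (ha g)
  rcases hdich (i, j) with h | ⟨x, hx⟩
  · apply hij
    funext g
    have h1 := h _ (hNK g)
    rw [← haa] at h1
    have h2 := ha g
    rw [h1, Units.val_one] at h2
    exact ((div_eq_one_iff_eq (hT.ne_zero j g)).1 h2.symm)
  · obtain ⟨k, hk, -, hxk⟩ := Subgroup.exists_pow_mem_of_index_ne_zero hNfin.index_ne_zero (x : G)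
    have haτ : a ⟨(x : G) ^ k, hxk⟩ = a₁ (i, j) x ^ k := by
      rw [haa, ← map_pow]
      rfl
    obtain ⟨P⟩ := nonempty_place (a ⟨(x : G) ^ k, hxk⟩) fun q hq h => by
      rw [haτ, ← pow_mul] at h
      exact hx _ (Nat.mul_pos hk hq) h
    exact false_of_cocycle hμ hFD hdom N inferInstance a b hb t hat hbt _ P

end VirtuallyNilpotent

section Countable

theorem exists_countable_rep {G F : Type*} [Group G] [Countable G] [Field F] {n : ℕ}
    (φ : G →* Matrix.GeneralLinearGroup (Fin n) F) (hφ : Function.Injective φ) :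
    ∃ K : Subfield F, Countable K ∧
      ∃ ρ : G →* Matrix (Fin n) (Fin n) K, Function.Injective ρ := by
  let s : Set F := Set.range fun p : G × Fin n × Fin n => (φ p.1 : Matrix (Fin n) (Fin n) F) p.2.1 p.2.2
  have hs : s.Countable := Set.countable_range _
  refine ⟨Subfield.closure s, ?_, ?_⟩
  · rw [← Cardinal.mk_le_aleph0_iff]
    exact (Subfield.cardinalMk_closure_le_max s).trans (max_le hs.le_aleph0 le_rfl)
  · have hmem : ∀ g i j, (φ g : Matrix (Fin n) (Fin n) F) i j ∈ Subfield.closure s := fun g i j =>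
      Subfield.subset_closure ⟨(g, i, j), rfl⟩
    have hinj : Function.Injective fun M : Matrix (Fin n) (Fin n) (Subfield.closure s) =>
        M.map (Subfield.closure s).subtype := fun M N h => by
      ext i j
      exact congrFun (congrFun h i) j
    have hmap : ∀ g, (Matrix.of fun i j => (⟨_, hmem g i j⟩ : Subfield.closure s)).map
        (Subfield.closure s).subtype = φ g := fun g => rfl
    refine ⟨{ toFun := fun g => Matrix.of fun i j => ⟨_, hmem g i j⟩
              map_one' := hinj ?_
              map_mul' := fun g h => hinj ?_ }, ?_⟩
    · show Matrix.map _ _ = Matrix.map _ _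
      rw [hmap, map_one, Matrix.map_one _ (map_zero _) (map_one _), Units.val_one]
    · show Matrix.map _ _ = Matrix.map _ _
      rw [hmap, map_mul, Matrix.map_mul, hmap, hmap, Units.val_mul]
    · intro g h hgh
      apply hφ
      apply Units.ext
      rw [← hmap g, ← hmap h]
      exact congrArg (fun M => Matrix.map M (Subfield.closure s).subtype) hgh

end Countable

theorem linear_finite_dim_HFk_implies_virtually_nilpotent
    {G : Type*} [Group G]
    (S : Finset G) (hSgen : Subgroup.closure (S : Set G) = ⊤)
    (hSsym : ∀ s ∈ S, s⁻¹ ∈ S)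
    -- `G` is a linear group: it admits an injective homomorphism into `GL n F`
    -- for some `n` and some field `F`.
    {n : ℕ} {F : Type*} [Field F]
    (φ : G →* Matrix.GeneralLinearGroup (Fin n) F) (hφ : Function.Injective φ)
    (μ : G → ℝ) (hnonneg : ∀ x, 0 ≤ μ x) (hprob : HasSum μ 1)
    (hsym : ∀ x : G, μ x⁻¹ = μ x)
    (hadapted : Subgroup.closure {x : G | μ x ≠ 0} = ⊤)
    (hsmooth : ∃ ζ : ℝ, 0 < ζ ∧
      Summable (fun x : G => μ x * Real.exp (ζ * (wordLen (S : Set G) x))))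
    (k : ℕ) (hk : 1 ≤ k)
    (hfin : ∃ W : Submodule ℂ (G → ℂ), FiniteDimensional ℂ W ∧
      HFk (S : Set G) μ k ⊆ (W : Set (G → ℂ))) :
    ∃ H : Subgroup G, H.FiniteIndex ∧ Group.IsNilpotent ↥H := by
  have hword := exists_word hSgen hSsym
  have hFG : Group.FG G := Group.fg_iff.2 ⟨S, hSgen, S.finite_toSet⟩
  have hG : Countable G := by
    refine Function.Surjective.countable (f := fun l : List S => (l.map Subtype.val).prod) fun x => ?_
    obtain ⟨l, hl, -, hx⟩ := hword x
    lift l to List S using hl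
    exact ⟨l, hx⟩
  obtain ⟨ν, ζ, hν, hFD⟩ := exists_nice_fd hSgen hSsym hnonneg hprob hsym hadapted hsmooth hk hfin
  have hdom : WordDom fun x => (wordLen (S : Set G) x : ℝ) := ⟨S, fun x => by
    obtain ⟨l, hl, hlen, hx⟩ := hword x
    exact ⟨l, hl, hx, by rw [hlen]⟩⟩
  obtain ⟨K, hK, ρ, hρ⟩ := exists_countable_rep φ hφ
  have hKbar : Countable (AlgebraicClosure K) := by
    rw [← Cardinal.mk_le_aleph0_iff]
    exact (Algebra.IsAlgebraic.cardinalMk_le_max K _).trans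
      (max_le (Cardinal.mk_le_aleph0_iff.2 hK) le_rfl)
  refine exists_nilpotent_of_faithful_rep hν hFD hdom
    ((algebraMap K (AlgebraicClosure K)).mapMatrix.toMonoidHom.comp ρ) ?_
  intro g h hgh
  apply hρ
  ext i j
  exact congrArg Subtype.val ((algebraMap K (AlgebraicClosure K)).injective
    (congrFun (congrFun hgh i) j))
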